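/- Convergence of the switching-system approximation as the switching cost vanishes: under Assumption (A), fix ε ∈ (0,1) and controls α_1,…,α_J ∈ A with J ≥ 2, and set A' := {α_1,…,α_J}. Suppose that for each c ∈ (0,1] the switching system with cost c admits a viscosity solution U^c = (U_1^c,…,U_J^c), that sup_{c∈(0,1]} max_{1≤j≤J} sup_{[0,T]×ℝ^d} |U_j^c| < ∞, and that u is a viscosity solution of the A'-HJBVI. Then for every j ∈ {1,…,J}, U_j^c converges to u uniformly on every compact subset of [0,T]×ℝ^d as c → 0. -/

import Mathlib

open MeasureTheory Set Filter Topology Metric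
open scoped RealInnerProductSpace Matrix

attribute [local instance] Matrix.normedAddCommGroup Matrix.normedSpace

noncomputable section

abbrev Vec (d : ℕ) := EuclideanSpace ℝ (Fin d)

structure C12 (d : ℕ) where
  toFun : ℝ → Vec d → ℝ
  dt : ℝ → Vec d → ℝ
  grad : ℝ → Vec d → Vec d
  hess : ℝ → Vec d → Matrix (Fin d) (Fin d) ℝ
  hasDt : ∀ t x, HasDerivAt (fun s => toFun s x) (dt t x) t
  hasGrad : ∀ t x, HasGradientAt (toFun t) (grad t x) x
  hasHess : ∀ t x, HasFDerivAt (grad t)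
      ((Matrix.toEuclideanLin (hess t x)).toContinuousLinearMap) x
  cont : Continuous fun p : ℝ × Vec d => toFun p.1 p.2
  cont_dt : Continuous fun p : ℝ × Vec d => dt p.1 p.2
  cont_grad : Continuous fun p : ℝ × Vec d => grad p.1 p.2
  cont_hess : Continuous fun p : ℝ × Vec d => hess p.1 p.2

def mvE {d : ℕ} (M : Matrix (Fin d) (Fin d) ℝ) (v : Vec d) : Vec d :=
  (EuclideanSpace.equiv (Fin d) ℝ).symm (M.mulVec ((EuclideanSpace.equiv (Fin d) ℝ) v))

variable {n d m : ℕ}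

/-- Assumption (A) of the paper. -/
structure AssumptionA (ν : Measure (Vec n)) (A : Set (Vec m)) (T : ℝ)
    (b : Vec m → Vec d → Vec d) (σ : Vec m → Vec d → Matrix (Fin d) (Fin d) ℝ)
    (η : Vec m → Vec d → Vec n → Vec d) (γ : Vec d → Vec n → ℝ)
    (f : Vec m → ℝ → Vec d → ℝ → Vec d → ℝ → ℝ)
    (ζ : ℝ → Vec d → ℝ) (g : Vec d → ℝ) (C : ℝ) : Prop where
  hC : 0 < C
  hT : 0 < T
  hAcpt : IsCompact A
  hAne : A.Nonempty
  hν_sf : SigmaFinite ν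
  hν_zero : ν {0} = 0
  hν_int : Integrable (fun e => min 1 (‖e‖ ^ 2)) ν
  hη_meas : ∀ α x, Measurable (η α x)
  hγ_meas : ∀ x, Measurable (γ x)
  hb : ∀ α ∈ A, ∀ α' ∈ A, ∀ x x' : Vec d,
      ‖b α x - b α' x'‖ + ‖σ α x - σ α' x'‖ ≤ C * (‖x - x'‖ + ‖α - α'‖)
  hη_lip : ∀ α ∈ A, ∀ α' ∈ A, ∀ (x x' : Vec d) (e : Vec n),
      ‖η α x e - η α' x' e‖ ≤ C * (‖x - x'‖ + ‖α - α'‖) * min 1 ‖e‖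
  hη_bdd : ∀ α ∈ A, ∀ (x : Vec d) (e : Vec n), ‖η α x e‖ ≤ C * min 1 ‖e‖
  hγ_lip : ∀ (x x' : Vec d) (e : Vec n),
      |γ x e - γ x' e| ≤ C * ‖x - x'‖ * min 1 (‖e‖ ^ 2)
  hγ_nonneg : ∀ x e, 0 ≤ γ x e
  hγ_bdd : ∀ (x : Vec d) (e : Vec n), γ x e ≤ C * min 1 ‖e‖
  hf_t_cont : ∀ α x u p k, Continuous fun t => f α t x u p k
  hf_bdd : ∀ α ∈ A, ∀ t ∈ Icc (0:ℝ) T, ∀ x : Vec d, |f α t x 0 0 0| ≤ C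
  hf_mono : ∀ α ∈ A, ∀ t ∈ Icc (0:ℝ) T, ∀ (x : Vec d) (p : Vec d) (k u v : ℝ),
      v ≤ u → C * (u - v) ≤ f α t x v p k - f α t x u p k
  hf_k_mono : ∀ α ∈ A, ∀ t ∈ Icc (0:ℝ) T, ∀ (x : Vec d) (u : ℝ) (p : Vec d),
      Monotone fun k => f α t x u p k
  hf_lip : ∀ α ∈ A, ∀ α' ∈ A, ∀ t ∈ Icc (0:ℝ) T, ∀ (x : Vec d) (u v : ℝ) (p q : Vec d) (k k' : ℝ),
      |f α t x u p k - f α' t x v q k'| ≤ C * (‖α - α'‖ + |u - v| + ‖p - q‖ + |k - k'|)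
  hf_x : ∀ R > (0:ℝ), ∃ mR : ℝ → ℝ, Continuous mR ∧ mR 0 = 0 ∧ (∀ r, 0 ≤ mR r) ∧
      ∀ α ∈ A, ∀ t ∈ Icc (0:ℝ) T, ∀ (x x' : Vec d) (u : ℝ) (p : Vec d) (k : ℝ),
        ‖x‖ ≤ R → ‖x'‖ ≤ R → |u| ≤ R →
        |f α t x u p k - f α t x' u p k| ≤ mR (‖x - x'‖ * (1 + ‖p‖))
  hζ_t_cont : ∀ x, Continuous fun t => ζ t x
  hζg_lip : ∀ (t : ℝ) (x x' : Vec d), |g x - g x'| + |ζ t x - ζ t x'| ≤ C * ‖x - x'‖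
  hζg_bdd : ∀ (t : ℝ) (x : Vec d), |g x| + |ζ t x| ≤ C
  hgζ : ∀ x, ζ 0 x ≤ g x

/-- The nonlocal operator `K^α`. -/
def Kop (ν : Measure (Vec n)) (η : Vec m → Vec d → Vec n → Vec d)
    (φ : C12 d) (α : Vec m) (t : ℝ) (x : Vec d) : ℝ :=
  ∫ e, (φ.toFun t (x + η α x e) - φ.toFun t x - ⟪η α x e, φ.grad t x⟫) ∂ν

/-- The nonlocal operator `B^α`. -/
def Bop (ν : Measure (Vec n)) (η : Vec m → Vec d → Vec n → Vec d) (γ : Vec d → Vec n → ℝ)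
    (φ : C12 d) (α : Vec m) (t : ℝ) (x : Vec d) : ℝ :=
  ∫ e, (φ.toFun t (x + η α x e) - φ.toFun t x) * γ x e ∂ν

/-- The local operator `A^α`. -/
def Aop (b : Vec m → Vec d → Vec d) (σ : Vec m → Vec d → Matrix (Fin d) (Fin d) ℝ)
    (φ : C12 d) (α : Vec m) (t : ℝ) (x : Vec d) : ℝ :=
  (1/2) * Matrix.trace (σ α x * (σ α x)ᵀ * φ.hess t x) + ⟪b α x, φ.grad t x⟫

/-- `L^α = A^α + K^α`. -/
def Lop (ν : Measure (Vec n)) (b : Vec m → Vec d → Vec d)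
    (σ : Vec m → Vec d → Matrix (Fin d) (Fin d) ℝ) (η : Vec m → Vec d → Vec n → Vec d)
    (φ : C12 d) (α : Vec m) (t : ℝ) (x : Vec d) : ℝ :=
  Aop b σ φ α t x + Kop ν η φ α t x

/-- Modified diffusion matrix `σ̃`. -/
def sigmaTilde (ν : Measure (Vec n)) (σ : Vec m → Vec d → Matrix (Fin d) (Fin d) ℝ)
    (η : Vec m → Vec d → Vec n → Vec d) (ε : ℝ) (α : Vec m) (x : Vec d) :
    Matrix (Fin d) (Fin d) ℝ :=
  Matrix.of fun i j =>
    if i = j then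
      Real.sqrt ((σ α x i i) ^ 2 + ∫ e in {e : Vec n | ‖e‖ < ε}, (η α x e i) ^ 2 ∂ν)
    else σ α x i j

/-- Truncated `K_ε^α`. -/
def Ktr (ν : Measure (Vec n)) (η : Vec m → Vec d → Vec n → Vec d) (ε : ℝ)
    (φ : C12 d) (α : Vec m) (t : ℝ) (x : Vec d) : ℝ :=
  Kop (ν.restrict {e : Vec n | ε < ‖e‖}) η φ α t x

/-- Truncated `B_ε^α`. -/
def Btr (ν : Measure (Vec n)) (η : Vec m → Vec d → Vec n → Vec d) (γ : Vec d → Vec n → ℝ)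
    (ε : ℝ) (φ : C12 d) (α : Vec m) (t : ℝ) (x : Vec d) : ℝ :=
  Bop (ν.restrict {e : Vec n | ε < ‖e‖}) η γ φ α t x

/-- Truncated `L_ε^α`. -/
def Ltr (ν : Measure (Vec n)) (b : Vec m → Vec d → Vec d)
    (σ : Vec m → Vec d → Matrix (Fin d) (Fin d) ℝ) (η : Vec m → Vec d → Vec n → Vec d)
    (ε : ℝ) (φ : C12 d) (α : Vec m) (t : ℝ) (x : Vec d) : ℝ :=
  (1/2) * Matrix.trace (sigmaTilde ν σ η ε α x * (sigmaTilde ν σ η ε α x)ᵀ * φ.hess t x)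
    + ⟪b α x, φ.grad t x⟫ + Ktr ν η ε φ α t x

/-- Viscosity subsolution of the HJBVI
`min{ u − ζ, ∂ₜu + inf_{α∈A}( −L^α u − f(α,t,x,u,σᵀDu,B^α u) ) } = 0`. -/
def SubsolnHJBVI (ν : Measure (Vec n)) (A : Set (Vec m)) (T : ℝ)
    (b : Vec m → Vec d → Vec d) (σ : Vec m → Vec d → Matrix (Fin d) (Fin d) ℝ)
    (η : Vec m → Vec d → Vec n → Vec d) (γ : Vec d → Vec n → ℝ)
    (f : Vec m → ℝ → Vec d → ℝ → Vec d → ℝ → ℝ) (ζ : ℝ → Vec d → ℝ)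
    (u : ℝ → Vec d → ℝ) : Prop :=
  ∀ (φ : C12 d) (t₀ : ℝ) (x₀ : Vec d), t₀ ∈ Ioc (0:ℝ) T →
    (∀ t ∈ Icc (0:ℝ) T, ∀ x, u t x - φ.toFun t x ≤ u t₀ x₀ - φ.toFun t₀ x₀) →
    min (u t₀ x₀ - ζ t₀ x₀)
      (φ.dt t₀ x₀ + ⨅ α : A, (-(Lop ν b σ η φ (↑α) t₀ x₀)
        - f (↑α) t₀ x₀ (u t₀ x₀) (mvE ((σ (↑α) x₀)ᵀ) (φ.grad t₀ x₀))
            (Bop ν η γ φ (↑α) t₀ x₀))) ≤ 0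

/-- Viscosity supersolution of the HJBVI. -/
def SupersolnHJBVI (ν : Measure (Vec n)) (A : Set (Vec m)) (T : ℝ)
    (b : Vec m → Vec d → Vec d) (σ : Vec m → Vec d → Matrix (Fin d) (Fin d) ℝ)
    (η : Vec m → Vec d → Vec n → Vec d) (γ : Vec d → Vec n → ℝ)
    (f : Vec m → ℝ → Vec d → ℝ → Vec d → ℝ → ℝ) (ζ : ℝ → Vec d → ℝ)
    (u : ℝ → Vec d → ℝ) : Prop :=
  ∀ (φ : C12 d) (t₀ : ℝ) (x₀ : Vec d), t₀ ∈ Ioc (0:ℝ) T →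
    (∀ t ∈ Icc (0:ℝ) T, ∀ x, u t₀ x₀ - φ.toFun t₀ x₀ ≤ u t x - φ.toFun t x) →
    0 ≤ min (u t₀ x₀ - ζ t₀ x₀)
      (φ.dt t₀ x₀ + ⨅ α : A, (-(Lop ν b σ η φ (↑α) t₀ x₀)
        - f (↑α) t₀ x₀ (u t₀ x₀) (mvE ((σ (↑α) x₀)ᵀ) (φ.grad t₀ x₀))
            (Bop ν η γ φ (↑α) t₀ x₀)))

/-- Viscosity subsolution of the `A'`-HJBVI with `ε`-truncated operators. -/
def SubsolnHJBVIe (ν : Measure (Vec n)) (A' : Set (Vec m)) (T : ℝ)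
    (b : Vec m → Vec d → Vec d) (σ : Vec m → Vec d → Matrix (Fin d) (Fin d) ℝ)
    (η : Vec m → Vec d → Vec n → Vec d) (γ : Vec d → Vec n → ℝ)
    (f : Vec m → ℝ → Vec d → ℝ → Vec d → ℝ → ℝ) (ζ : ℝ → Vec d → ℝ) (ε : ℝ)
    (u : ℝ → Vec d → ℝ) : Prop :=
  ∀ (φ : C12 d) (t₀ : ℝ) (x₀ : Vec d), t₀ ∈ Ioc (0:ℝ) T →
    (∀ t ∈ Icc (0:ℝ) T, ∀ x, u t x - φ.toFun t x ≤ u t₀ x₀ - φ.toFun t₀ x₀) →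
    min (u t₀ x₀ - ζ t₀ x₀)
      (φ.dt t₀ x₀ + ⨅ α : A', (-(Ltr ν b σ η ε φ (↑α) t₀ x₀)
        - f (↑α) t₀ x₀ (u t₀ x₀) (mvE ((sigmaTilde ν σ η ε (↑α) x₀)ᵀ) (φ.grad t₀ x₀))
            (Btr ν η γ ε φ (↑α) t₀ x₀))) ≤ 0

/-- Viscosity supersolution of the `A'`-HJBVI with `ε`-truncated operators. -/
def SupersolnHJBVIe (ν : Measure (Vec n)) (A' : Set (Vec m)) (T : ℝ)
    (b : Vec m → Vec d → Vec d) (σ : Vec m → Vec d → Matrix (Fin d) (Fin d) ℝ)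
    (η : Vec m → Vec d → Vec n → Vec d) (γ : Vec d → Vec n → ℝ)
    (f : Vec m → ℝ → Vec d → ℝ → Vec d → ℝ → ℝ) (ζ : ℝ → Vec d → ℝ) (ε : ℝ)
    (u : ℝ → Vec d → ℝ) : Prop :=
  ∀ (φ : C12 d) (t₀ : ℝ) (x₀ : Vec d), t₀ ∈ Ioc (0:ℝ) T →
    (∀ t ∈ Icc (0:ℝ) T, ∀ x, u t₀ x₀ - φ.toFun t₀ x₀ ≤ u t x - φ.toFun t x) →
    0 ≤ min (u t₀ x₀ - ζ t₀ x₀)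
      (φ.dt t₀ x₀ + ⨅ α : A', (-(Ltr ν b σ η ε φ (↑α) t₀ x₀)
        - f (↑α) t₀ x₀ (u t₀ x₀) (mvE ((sigmaTilde ν σ η ε (↑α) x₀)ᵀ) (φ.grad t₀ x₀))
            (Btr ν η γ ε φ (↑α) t₀ x₀)))

/-- The switching obstacle `M_j U = max_{k ≠ j} (U_k − c)`. -/
def MaxSw {J : ℕ} (U : Fin J → ℝ → Vec d → ℝ) (c : ℝ) (j : Fin J) (t : ℝ) (x : Vec d) : ℝ :=
  ⨆ k : {k : Fin J // k ≠ j}, (U (↑k) t x - c)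

/-- Viscosity subsolution of the switching system. -/
def SubsolnSwitch (ν : Measure (Vec n)) (T : ℝ)
    (b : Vec m → Vec d → Vec d) (σ : Vec m → Vec d → Matrix (Fin d) (Fin d) ℝ)
    (η : Vec m → Vec d → Vec n → Vec d) (γ : Vec d → Vec n → ℝ)
    (f : Vec m → ℝ → Vec d → ℝ → Vec d → ℝ → ℝ) (ζ : ℝ → Vec d → ℝ) (ε : ℝ)
    {J : ℕ} (αs : Fin J → Vec m) (c : ℝ) (U : Fin J → ℝ → Vec d → ℝ) : Prop :=
  ∀ (j : Fin J) (φ : C12 d) (t₀ : ℝ) (x₀ : Vec d), t₀ ∈ Ioc (0:ℝ) T →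
    (∀ t ∈ Icc (0:ℝ) T, ∀ x, U j t x - φ.toFun t x ≤ U j t₀ x₀ - φ.toFun t₀ x₀) →
    min (U j t₀ x₀ - ζ t₀ x₀)
      (min (φ.dt t₀ x₀ - Ltr ν b σ η ε φ (αs j) t₀ x₀
          - f (αs j) t₀ x₀ (U j t₀ x₀)
              (mvE ((sigmaTilde ν σ η ε (αs j) x₀)ᵀ) (φ.grad t₀ x₀))
              (Btr ν η γ ε φ (αs j) t₀ x₀))
        (U j t₀ x₀ - MaxSw U c j t₀ x₀)) ≤ 0

/-- Viscosity supersolution of the switching system. -/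
def SupersolnSwitch (ν : Measure (Vec n)) (T : ℝ)
    (b : Vec m → Vec d → Vec d) (σ : Vec m → Vec d → Matrix (Fin d) (Fin d) ℝ)
    (η : Vec m → Vec d → Vec n → Vec d) (γ : Vec d → Vec n → ℝ)
    (f : Vec m → ℝ → Vec d → ℝ → Vec d → ℝ → ℝ) (ζ : ℝ → Vec d → ℝ) (ε : ℝ)
    {J : ℕ} (αs : Fin J → Vec m) (c : ℝ) (U : Fin J → ℝ → Vec d → ℝ) : Prop :=
  ∀ (j : Fin J) (φ : C12 d) (t₀ : ℝ) (x₀ : Vec d), t₀ ∈ Ioc (0:ℝ) T →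
    (∀ t ∈ Icc (0:ℝ) T, ∀ x, U j t₀ x₀ - φ.toFun t₀ x₀ ≤ U j t x - φ.toFun t x) →
    0 ≤ min (U j t₀ x₀ - ζ t₀ x₀)
      (min (φ.dt t₀ x₀ - Ltr ν b σ η ε φ (αs j) t₀ x₀
          - f (αs j) t₀ x₀ (U j t₀ x₀)
              (mvE ((sigmaTilde ν σ η ε (αs j) x₀)ᵀ) (φ.grad t₀ x₀))
              (Btr ν η γ ε φ (αs j) t₀ x₀))
        (U j t₀ x₀ - MaxSw U c j t₀ x₀))

open scoped Pointwise in
/-- Around a Lebesgue density point `x` of `S`, every point `x + h` is `o(‖h‖)`-close to `S`. -/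
theorem exists_near_of_density_one {F : Type*} [NormedAddCommGroup F] [NormedSpace ℝ F]
    [FiniteDimensional ℝ F] [MeasurableSpace F] [BorelSpace F] (μ : Measure F)
    [μ.IsAddHaarMeasure] {S : Set F} {x : F} (hx : x ∈ S)
    (h : Tendsto (fun r => μ (S ∩ closedBall x r) / μ (closedBall x r)) (𝓝[>] 0) (𝓝 1))
    {ω : ℝ} (hω : 0 < ω) :
    ∃ r > 0, ∀ h : F, ‖h‖ < r → ∃ s ∈ S, ‖s - (x + h)‖ ≤ ω * ‖h‖ := by
  obtain ⟨t, -, htf, hcov⟩ :=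
    (isCompact_sphere (0 : F) 1).finite_cover_balls (e := ω / 2) (by positivity)
  have h1 : ∀ e ∈ t, ∀ᶠ r in 𝓝[>] (0 : ℝ),
      (S ∩ ({x} + r • closedBall e (ω / 2))).Nonempty := fun e _ =>
    Measure.eventually_nonempty_inter_smul_of_density_one μ S x h _ measurableSet_closedBall
      (measure_closedBall_pos μ _ (by positivity)).ne'
  have h2 := (htf.eventually_all).2 h1
  rw [eventually_nhdsWithin_iff, Metric.eventually_nhds_iff] at h2
  obtain ⟨r, hr, h2⟩ := h2
  refine ⟨r, hr, fun v hv => ?_⟩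
  by_cases hv0 : v = 0
  · exact ⟨x, hx, by simp [hv0]⟩
  have hvp : 0 < ‖v‖ := norm_pos_iff.2 hv0
  have hmem : ‖v‖⁻¹ • v ∈ sphere (0 : F) 1 := by
    simp [norm_smul, hvp.ne']
  obtain ⟨e, he, hev⟩ := mem_iUnion₂.1 (hcov hmem)
  obtain ⟨s, hsS, hs⟩ := h2 (y := ‖v‖) (by simpa using hv) hvp e he
  refine ⟨s, hsS, ?_⟩
  simp only [singleton_add, mem_image, mem_smul_set] at hs
  obtain ⟨_, ⟨e', he', rfl⟩, rfl⟩ := hs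
  have hv1 : v = ‖v‖ • (‖v‖⁻¹ • v) := by rw [smul_smul, mul_inv_cancel₀ hvp.ne', one_smul]
  have : x + ‖v‖ • e' - (x + v) = ‖v‖ • (e' - e - (‖v‖⁻¹ • v - e)) := by
    conv_lhs => rw [hv1]
    simp only [norm_smul, norm_norm, norm_inv]
    rw [inv_mul_cancel₀ hvp.ne', mul_one]
    simp only [smul_sub]; abel
  rw [this, norm_smul, norm_norm, mul_comm]
  have h3 := norm_sub_le (e' - e) (‖v‖⁻¹ • v - e)
  rw [mem_closedBall, dist_eq_norm] at he'
  rw [mem_ball, dist_eq_norm] at hev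
  have : ‖e' - e - (‖v‖⁻¹ • v - e)‖ ≤ ω := by linarith
  gcongr

/-- A function with two-sided first order expansions with quadratic error on `S` has a Lipschitz
gradient on `S`. -/
theorem norm_sub_le_of_quadratic_error {F : Type*} [NormedAddCommGroup F]
    [InnerProductSpace ℝ F] {H : F → ℝ} {P : F → F} {κ : ℝ} {x₁ x₂ : F}
    (h1 : ∀ h, |H (x₁ + h) - H x₁ - ⟪P x₁, h⟫| ≤ κ * ‖h‖ ^ 2)
    (h2 : ∀ h, |H (x₂ + h) - H x₂ - ⟪P x₂, h⟫| ≤ κ * ‖h‖ ^ 2) :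
    ‖P x₁ - P x₂‖ ≤ 6 * κ * ‖x₁ - x₂‖ := by
  rcases eq_or_ne (P x₁) (P x₂) with hP | hP
  · rw [hP, sub_self, norm_zero]
    by_cases hx : x₁ = x₂
    · simp [hx]
    have hp : 0 < ‖x₂ - x₁‖ ^ 2 := by
      have : 0 < ‖x₂ - x₁‖ := norm_pos_iff.2 (sub_ne_zero.2 (Ne.symm hx))
      positivity
    have := (abs_nonneg _).trans (h1 (x₂ - x₁))
    have : 0 ≤ κ := nonneg_of_mul_nonneg_left this hp
    positivity
  have hd : 0 < ‖P x₁ - P x₂‖ := norm_pos_iff.2 (sub_ne_zero.2 hP)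
  set l := ‖x₁ - x₂‖ with hl
  set D := P x₁ - P x₂ with hD
  have key : ∀ e : F, ‖e‖ = l → ⟪D, e⟫ ≤ κ * (6 * l ^ 2) := by
    intro e he
    have hκ : 0 ≤ κ * l ^ 2 := by
      have := (abs_nonneg _).trans (h1 e)
      rwa [he] at this
    have a1 := (abs_le.1 (h1 (x₂ - x₁ + e))).1
    have a2 := (abs_le.1 (h1 (x₂ - x₁))).2
    have a3 := (abs_le.1 (h2 e)).2
    have b1 : x₁ + (x₂ - x₁ + e) = x₂ + e := by abel
    have b2 : x₁ + (x₂ - x₁) = x₂ := by abel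
    rw [b1, inner_add_right] at a1
    rw [b2, norm_sub_rev x₂ x₁] at a2
    rw [he] at a3
    have b3 : ‖x₂ - x₁ + e‖ ≤ 2 * l := by
      have := norm_add_le (x₂ - x₁) e
      rw [norm_sub_rev x₂ x₁] at this; linarith
    have b4 : κ * ‖x₂ - x₁ + e‖ ^ 2 ≤ 4 * (κ * l ^ 2) := by
      rcases eq_or_lt_of_le (norm_nonneg (x₁ - x₂)) with h0 | h0
      · have hl0 : l = 0 := by rw [hl, ← h0]
        have : ‖x₂ - x₁ + e‖ = 0 := le_antisymm (by rw [hl0] at b3; simpa using b3) (norm_nonneg _)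
        rw [this, hl0]; simp
      · have : 0 ≤ κ := nonneg_of_mul_nonneg_left hκ (by positivity)
        have := mul_le_mul_of_nonneg_left (pow_le_pow_left₀ (norm_nonneg _) b3 2) this
        linarith [this]
    rw [hD, inner_sub_left]
    rw [← hl] at a2
    linarith
  have := key ((l / ‖D‖) • D) (by
    rw [norm_smul, Real.norm_of_nonneg (by positivity)]; field_simp)
  rw [inner_smul_right, real_inner_self_eq_norm_sq] at this
  have e1 : l / ‖D‖ * ‖D‖ ^ 2 = l * ‖D‖ := by field_simp
  rw [e1] at this
  rcases eq_or_lt_of_le (norm_nonneg (x₁ - x₂)) with h0 | h0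
  · have hx : x₁ = x₂ := by
      rw [← sub_eq_zero, ← norm_eq_zero]; exact h0.symm
    exact absurd (by rw [hx]) hP
  · have : l * ‖D‖ ≤ l * (6 * κ * l) := by linarith
    exact le_of_mul_le_mul_left this h0

theorem abs_sub_add_sub_le_of_le {a b c d a' b' c' d' : ℝ} (ha : |a| ≤ a') (hb : |b| ≤ b')
    (hc : |c| ≤ c') (hd : |d| ≤ d') : |a - b + c - d| ≤ a' + b' + c' + d' := by
  rw [abs_le] at *
  constructor <;> linarith [ha.1, ha.2, hb.1, hb.2, hc.1, hc.2, hd.1, hd.2]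

set_option maxHeartbeats 400000 in
/-- Second order expansion at a density point of a set where the function is two-sidedly
quadratically approximable, provided the gradient (extended off the set) is differentiable. -/
theorem second_order_expansion_of_density_one {F : Type*} [NormedAddCommGroup F]
    [InnerProductSpace ℝ F] {H : F → ℝ} {P : F → F} {S : Set F} {κ : ℝ}
    (hS : ∀ z ∈ S, ∀ h, |H (z + h) - H z - ⟪P z, h⟫| ≤ κ * ‖h‖ ^ 2) {x : F} (hx : x ∈ S)
    {P' : F → F} (hP' : EqOn P P' S) {A : F →L[ℝ] F} (hA : HasFDerivAt P' A x)
    (hnear : ∀ ω > 0, ∃ r > 0, ∀ h : F, ‖h‖ < r → ∃ s ∈ S, ‖s - (x + h)‖ ≤ ω * ‖h‖) :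
    ∀ ω > 0, ∃ r > 0, ∀ h : F, ‖h‖ < r →
      |H (x + h) - H x - ⟪P x, h⟫ - 1 / 2 * ⟪A h, h⟫| ≤ ω * ‖h‖ ^ 2 := by
  intro ω₀ hω₀
  set C := 5 * |κ| + 2 + 2 * ‖A‖ with hC
  have hCpos : 0 < C := by positivity
  obtain ⟨N, hN⟩ := exists_nat_gt (max 1 (C / ω₀))
  have hN1 : (1 : ℝ) < N := (le_max_left _ _).trans_lt hN
  have hN2 : C / ω₀ < N := (le_max_right _ _).trans_lt hN
  have hN0 : (0 : ℝ) < N := by linarith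
  set ω : ℝ := 1 / N with hω
  have hωpos : 0 < ω := by positivity
  have hω1 : ω ≤ 1 := by rw [hω, div_le_one hN0]; exact hN1.le
  obtain ⟨r1, hr1, H1⟩ := hnear ω hωpos
  have hA' := hA.isLittleO.def hωpos
  rw [Metric.eventually_nhds_iff] at hA'
  obtain ⟨r2, hr2, H2⟩ := hA'
  refine ⟨min r1 (r2 / 2), by positivity, fun h hh => ?_⟩
  have hh1 : ‖h‖ < r1 := hh.trans_le (min_le_left _ _)
  have hh2 : ‖h‖ < r2 / 2 := hh.trans_le (min_le_right _ _)
  set R : ℝ → ℝ := fun t => H (x + t • h) - H x - ⟪P x, t • h⟫ - 1 / 2 * ⟪A (t • h), t • h⟫ with hR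
  have hAh : |⟪A h, h⟫| ≤ ‖A‖ * ‖h‖ ^ 2 := by
    calc |⟪A h, h⟫| ≤ ‖A h‖ * ‖h‖ := abs_real_inner_le_norm _ _
      _ ≤ ‖A‖ * ‖h‖ * ‖h‖ := by gcongr; exact A.le_opNorm h
      _ = _ := by ring
  have step : ∀ s t : ℝ, 0 ≤ s → s ≤ 1 → t - s = ω →
      |R t - R s| ≤ C * (ω ^ 2 * ‖h‖ ^ 2) := by
    intro s t hs0 hs1 hts
    have hsh : ‖s • h‖ ≤ ‖h‖ := by
      rw [norm_smul, Real.norm_of_nonneg hs0]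
      exact mul_le_of_le_one_left (norm_nonneg _) hs1
    obtain ⟨p, hpS, hp⟩ := H1 (s • h) (hsh.trans_lt hh1)
    replace hp : ‖p - (x + s • h)‖ ≤ ω * ‖h‖ := hp.trans (by gcongr)
    set e := x + s • h - p with he
    have hen : ‖e‖ ≤ ω * ‖h‖ := by rw [he, norm_sub_rev]; exact hp
    have hpx : ‖p - x‖ ≤ 2 * ‖h‖ := by
      have : p - x = s • h - e := by rw [he]; abel
      rw [this]
      calc _ ≤ ‖s • h‖ + ‖e‖ := norm_sub_le _ _
        _ ≤ ‖h‖ + 1 * ‖h‖ := by gcongr; exact hen.trans (by gcongr)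
        _ = _ := by ring
    have B1 := hS p hpS (e + ω • h)
    have B2 := hS p hpS e
    have E1 : p + (e + ω • h) = x + t • h := by
      rw [he, ← hts, sub_smul]; abel
    have E2 : p + e = x + s • h := by rw [he]; abel
    rw [E1] at B1; rw [E2] at B2
    have hk1 : κ * ‖e + ω • h‖ ^ 2 ≤ |κ| * (4 * (ω ^ 2 * ‖h‖ ^ 2)) := by
      have : ‖e + ω • h‖ ≤ 2 * (ω * ‖h‖) := by
        calc _ ≤ ‖e‖ + ‖ω • h‖ := norm_add_le _ _
          _ ≤ ω * ‖h‖ + ω * ‖h‖ := by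
            gcongr; rw [norm_smul, Real.norm_of_nonneg hωpos.le]
          _ = _ := by ring
      calc κ * ‖e + ω • h‖ ^ 2 ≤ |κ| * (2 * (ω * ‖h‖)) ^ 2 := by
            gcongr; exact le_abs_self κ
        _ = _ := by ring
    have hk2 : κ * ‖e‖ ^ 2 ≤ |κ| * (ω ^ 2 * ‖h‖ ^ 2) := by
      calc κ * ‖e‖ ^ 2 ≤ |κ| * (ω * ‖h‖) ^ 2 := by
            gcongr; exact le_abs_self κ
        _ = _ := by ring
    have hd := H2 (y := p) (by rw [dist_eq_norm]; linarith)
    rw [← hP' hpS, ← hP' hx] at hd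
    set q := P p - P x - A (p - x) with hq
    have hqn : ‖q‖ ≤ 2 * ω * ‖h‖ := hd.trans (by nlinarith)
    have hPp : ⟪P p, h⟫ = ⟪P x, h⟫ + s * ⟪A h, h⟫ + (⟪q, h⟫ - ⟪A e, h⟫) := by
      have : P p = P x + (s • A h - A e) + q := by
        have h5 : p - x = s • h - e := by rw [he]; abel
        have h6 : A (p - x) = s • A h - A e := by rw [h5, map_sub, map_smul]
        rw [hq, h6]; abel
      rw [this, inner_add_left, inner_add_left, inner_sub_left, inner_smul_left]
      simp only [conj_trivial]; ring
    have hqh : |⟪q, h⟫ - ⟪A e, h⟫| ≤ (2 + ‖A‖) * (ω * ‖h‖ ^ 2) := by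
      have i1 : |⟪q, h⟫| ≤ 2 * ω * ‖h‖ * ‖h‖ := (abs_real_inner_le_norm _ _).trans (by gcongr)
      have i2 : |⟪A e, h⟫| ≤ ‖A‖ * (ω * ‖h‖) * ‖h‖ := (abs_real_inner_le_norm _ _).trans (by
        gcongr; exact (A.le_opNorm e).trans (by gcongr))
      have := abs_sub (⟪q, h⟫) (⟪A e, h⟫)
      nlinarith
    have hRR : R t - R s = (H (x + t • h) - H p - ⟪P p, e + ω • h⟫)
        - (H (x + s • h) - H p - ⟪P p, e⟫) + ω * (⟪q, h⟫ - ⟪A e, h⟫)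
        - 1 / 2 * ω ^ 2 * ⟪A h, h⟫ := by
      have ht : t = s + ω := by linarith
      simp only [hR, map_smul, inner_smul_left, inner_smul_right, inner_add_right, hPp,
        conj_trivial]
      rw [ht]; ring
    rw [hRR]
    have j1 := B1.trans hk1
    have j2 := B2.trans hk2
    have j3 : |ω * (⟪q, h⟫ - ⟪A e, h⟫)| ≤ (2 + ‖A‖) * (ω ^ 2 * ‖h‖ ^ 2) := by
      rw [abs_mul, abs_of_pos hωpos]
      calc _ ≤ ω * ((2 + ‖A‖) * (ω * ‖h‖ ^ 2)) := by gcongr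
        _ = _ := by ring
    have j4 : |1 / 2 * ω ^ 2 * ⟪A h, h⟫| ≤ ‖A‖ * (ω ^ 2 * ‖h‖ ^ 2) := by
      rw [abs_mul, abs_of_pos (by positivity : (0 : ℝ) < 1 / 2 * ω ^ 2)]
      have : 0 ≤ ω ^ 2 * (‖A‖ * ‖h‖ ^ 2) := by positivity
      nlinarith [mul_le_mul_of_nonneg_left hAh (sq_nonneg ω)]
    rw [hC]
    exact (abs_sub_add_sub_le_of_le j1 j2 j3 j4).trans_eq (by ring)
  have tele : ∀ i : ℕ, i ≤ N → |R (i * ω)| ≤ i * (C * (ω ^ 2 * ‖h‖ ^ 2)) := by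
    intro i
    induction i with
    | zero => intro _; simp [hR]
    | succ i ih =>
      intro hi
      have hiN : (i : ℝ) ≤ N := by exact_mod_cast (Nat.le_of_succ_le hi)
      have := step (i * ω) ((i + 1 : ℕ) * ω) (by positivity)
        (by rw [hω, mul_one_div, div_le_one hN0]; exact hiN) (by push_cast; ring)
      have h3 := ih (Nat.le_of_succ_le hi)
      have h4 : |R ((i + 1 : ℕ) * ω)| ≤ |R ((i + 1 : ℕ) * ω) - R (i * ω)| + |R (i * ω)| := by
        have := abs_add_le (R ((i + 1 : ℕ) * ω) - R (i * ω)) (R (i * ω))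
        simpa using this
      push_cast at *
      linarith
  have hfin := tele N le_rfl
  have hNω : (N : ℝ) * ω = 1 := by rw [hω]; field_simp
  rw [hNω] at hfin
  simp only [hR, one_smul] at hfin
  refine hfin.trans ?_
  have : (N : ℝ) * (C * (ω ^ 2 * ‖h‖ ^ 2)) = (C * ω) * ‖h‖ ^ 2 := by
    rw [show (N : ℝ) * (C * (ω ^ 2 * ‖h‖ ^ 2)) = (N * ω) * (C * ω * ‖h‖ ^ 2) by ring, hNω, one_mul]
  rw [this]
  have : C * ω ≤ ω₀ := by
    rw [hω, mul_one_div, div_le_iff₀ hN0]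
    rw [div_lt_iff₀ hω₀] at hN2; linarith
  gcongr

/-- Alexandrov-type theorem on a set where the function is two-sidedly quadratically
approximable. -/
theorem ae_second_order_expansion {F : Type*} [NormedAddCommGroup F] [InnerProductSpace ℝ F]
    [FiniteDimensional ℝ F] [MeasurableSpace F] [BorelSpace F] (μ : Measure F)
    [μ.IsAddHaarMeasure] {H : F → ℝ} {P : F → F} {S : Set F} {κ : ℝ}
    (hS : ∀ z ∈ S, ∀ h, |H (z + h) - H z - ⟪P z, h⟫| ≤ κ * ‖h‖ ^ 2) (hμ : μ S ≠ 0) :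
    ∃ x ∈ S, ∃ A : F →L[ℝ] F, (∀ u v, ⟪A u, v⟫ = ⟪u, A v⟫) ∧
      ∀ ω > 0, ∃ r > 0, ∀ h : F, ‖h‖ < r →
        |H (x + h) - H x - ⟪P x, h⟫ - 1 / 2 * ⟪A h, h⟫| ≤ ω * ‖h‖ ^ 2 := by
  have hlip : LipschitzOnWith (6 * |κ|).toNNReal P S := by
    refine LipschitzOnWith.of_dist_le_mul fun a ha b hb => ?_
    rw [dist_eq_norm, dist_eq_norm, Real.coe_toNNReal _ (by positivity)]
    refine (norm_sub_le_of_quadratic_error (hS a ha) (hS b hb)).trans ?_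
    gcongr; exact le_abs_self κ
  obtain ⟨P', hP'lip, hP'⟩ := hlip.extend_finite_dimension
  have hae : ∀ᵐ x ∂(μ.restrict S), DifferentiableAt ℝ P' x :=
    ae_restrict_of_ae hP'lip.ae_differentiableAt
  obtain ⟨x, hx, h1, h2⟩ := Measure.exists_mem_of_measure_ne_zero_of_ae hμ
    (hae.and (Besicovitch.ae_tendsto_measure_inter_div μ S))
  set A₀ := fderiv ℝ P' x with hA₀
  refine ⟨x, hx, (1 / 2 : ℝ) • (A₀ + ContinuousLinearMap.adjoint A₀), fun u v => ?_, ?_⟩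
  · simp only [_root_.smul_apply, _root_.add_apply, inner_smul_left,
      inner_smul_right, inner_add_left, inner_add_right, ContinuousLinearMap.adjoint_inner_left,
      ContinuousLinearMap.adjoint_inner_right, conj_trivial]
    ring
  · have := second_order_expansion_of_density_one hS hx hP' h1.hasFDerivAt
      (fun ω hω => exists_near_of_density_one μ hx h2 hω)
    have hq : ∀ h : F, ⟪((1 / 2 : ℝ) • (A₀ + ContinuousLinearMap.adjoint A₀)) h, h⟫
        = ⟪A₀ h, h⟫ := by
      intro h
      simp only [_root_.smul_apply, _root_.add_apply, inner_smul_left,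
        inner_add_left, ContinuousLinearMap.adjoint_inner_left, conj_trivial]
      rw [real_inner_comm (A₀ h) h]; ring
    simpa only [hq] using this

/-- Maximizers in the sup-convolution of an upper semicontinuous function bounded above on a
closed set. -/
theorem exists_isMaxOn_sub_sq {F : Type*} [NormedAddCommGroup F] [InnerProductSpace ℝ F]
    [FiniteDimensional ℝ F] {D : Set F} (hD : IsClosed D) (hne : D.Nonempty) {Q : F → ℝ}
    (hQ : UpperSemicontinuousOn Q D) {M : ℝ} (hM : ∀ z ∈ D, Q z ≤ M) {δ : ℝ} (hδ : 0 < δ)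
    (z : F) : ∃ c ∈ D, ∀ y ∈ D, Q y - ‖z - y‖ ^ 2 / (2 * δ) ≤ Q c - ‖z - c‖ ^ 2 / (2 * δ) := by
  obtain ⟨d₀, hd₀⟩ := hne
  set q₀ := Q d₀ - ‖z - d₀‖ ^ 2 / (2 * δ) with hq₀
  set R := max ‖z - d₀‖ (Real.sqrt (2 * δ * (|M - q₀| + 1))) with hR
  have hcpt : IsCompact (D ∩ closedBall z R) := (isCompact_closedBall z R).inter_left hD
  have hd₀' : d₀ ∈ D ∩ closedBall z R :=
    ⟨hd₀, by rw [mem_closedBall, dist_comm, dist_eq_norm]; exact le_max_left _ _⟩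
  have hus : UpperSemicontinuousOn (fun y => Q y + -(‖z - y‖ ^ 2 / (2 * δ)))
      (D ∩ closedBall z R) :=
    (hQ.mono inter_subset_left).add
      ((by fun_prop : Continuous fun y => -(‖z - y‖ ^ 2 / (2 * δ))).upperSemicontinuous.upperSemicontinuousOn _)
  obtain ⟨c, hc, hmax⟩ := hus.exists_isMaxOn ⟨d₀, hd₀'⟩ hcpt
  refine ⟨c, hc.1, fun y hy => ?_⟩
  by_cases hyR : y ∈ closedBall z R
  · simpa [sub_eq_add_neg] using hmax ⟨hy, hyR⟩
  · have h1 : R < ‖z - y‖ := by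
      rw [mem_closedBall, not_le, dist_comm, dist_eq_norm] at hyR; exact hyR
    have h2 : q₀ ≤ Q c - ‖z - c‖ ^ 2 / (2 * δ) := by
      rw [hq₀]; simpa [sub_eq_add_neg] using hmax hd₀'
    have h3 : 2 * δ * (|M - q₀| + 1) ≤ ‖z - y‖ ^ 2 := by
      have : Real.sqrt (2 * δ * (|M - q₀| + 1)) ≤ ‖z - y‖ := (le_max_right _ _).trans h1.le
      exact Real.sqrt_le_left (by positivity) |>.1 this
    have h4 : |M - q₀| + 1 ≤ ‖z - y‖ ^ 2 / (2 * δ) := by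
      rw [le_div_iff₀ (by positivity)]; linarith
    have := hM y hy
    have := le_abs_self (M - q₀)
    linarith

theorem continuous_of_forall_affine_support {F : Type*} [NormedAddCommGroup F]
    [InnerProductSpace ℝ F] [FiniteDimensional ℝ F] {G : F → ℝ} {p : F → F}
    (h : ∀ z y, G z + ⟪p z, y - z⟫ ≤ G y) : Continuous G := by
  have : ConvexOn ℝ univ G := by
    refine ⟨convex_univ, fun x _ y _ a b ha hb hab => ?_⟩
    have h1 := h (a • x + b • y) x
    have h2 := h (a • x + b • y) y
    have e1 : x - (a • x + b • y) = b • (x - y) := by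
      have : a = 1 - b := by linarith
      rw [this, sub_smul, one_smul, smul_sub]; abel
    have e2 : y - (a • x + b • y) = (-a) • (x - y) := by
      have : b = 1 - a := by linarith
      rw [this, sub_smul, one_smul, neg_smul, smul_sub]; abel
    rw [e1, inner_smul_right] at h1
    rw [e2, inner_smul_right] at h2
    set z := a • x + b • y
    set i := ⟪p z, x - y⟫
    have h3 := mul_le_mul_of_nonneg_left h1 ha
    have h4 := mul_le_mul_of_nonneg_left h2 hb
    simp only [smul_eq_mul]
    have : (a + b) * G z ≤ a * G x + b * G y := by linarith
    rwa [hab, one_mul] at this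
  simpa [continuousOn_univ] using this.continuousOn isOpen_univ

theorem eq_of_inner_sub_le_sq {F : Type*} [NormedAddCommGroup F] [InnerProductSpace ℝ F]
    {P q : F} {κ : ℝ} (h : ∀ v, ⟪P - q, v⟫ ≤ κ * ‖v‖ ^ 2) : P = q := by
  by_contra hne
  have hpos : 0 < ‖P - q‖ ^ 2 := by
    have : 0 < ‖P - q‖ := norm_pos_iff.2 (sub_ne_zero.2 hne)
    positivity
  set t : ℝ := 1 / (2 * (|κ| + 1))
  have ht : 0 < t := by positivity
  have h1 := h (t • (P - q))
  rw [inner_smul_right, real_inner_self_eq_norm_sq, norm_smul, mul_pow, Real.norm_of_nonneg ht.le]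
    at h1
  have h2 : 1 ≤ κ * t := by
    have : t * ‖P - q‖ ^ 2 * 1 ≤ t * ‖P - q‖ ^ 2 * (κ * t) := by linarith
    exact le_of_mul_le_mul_left this (by positivity)
  have h3 : κ * t ≤ 1 / 2 := by
    have : κ * t ≤ (|κ| + 1) * t := by gcongr; linarith [le_abs_self κ]
    have : (|κ| + 1) * t = 1 / 2 := by simp only [t]; field_simp
    linarith
  linarith

theorem norm_sq_expand {F G : Type*} [NormedAddCommGroup F] [InnerProductSpace ℝ F]
    [NormedAddCommGroup G] [InnerProductSpace ℝ G] (L : F →L[ℝ] G) (z h : F) :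
    ‖L (z + h)‖ ^ 2 = ‖L z‖ ^ 2 + 2 * ⟪L z, L h⟫ + ‖L h‖ ^ 2 := by
  rw [map_add]; exact norm_add_sq_real _ _

theorem sq_expand_sub {F : Type*} [NormedAddCommGroup F] [InnerProductSpace ℝ F] (z h y : F) :
    ‖z + h - y‖ ^ 2 = ‖z - y‖ ^ 2 + 2 * ⟪z - y, h⟫ + ‖h‖ ^ 2 := by
  rw [show z + h - y = (z - y) + h by abel]; exact norm_add_sq_real _ _

set_option maxHeartbeats 800000 in
/-- Jensen's lemma for the sup-convolution of `Q` penalized by a quadratic form `½‖L z‖²`. -/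
theorem jensen_sup_convolution {F G : Type*} [NormedAddCommGroup F] [InnerProductSpace ℝ F]
    [FiniteDimensional ℝ F] [NormedAddCommGroup G] [InnerProductSpace ℝ G]
    [FiniteDimensional ℝ G] (L : F →L[ℝ] G)
    {D : Set F} (hD : IsClosed D) (hne : D.Nonempty) {Q : F → ℝ}
    (hQ : UpperSemicontinuousOn Q D) {M : ℝ} (hM : ∀ z ∈ D, Q z ≤ M) {δ : ℝ} (hδ : 0 < δ)
    {ρ : ℝ} (hρ : 0 < ρ) :
    ∃ (H : F → ℝ) (z c : F) (A : F →L[ℝ] F), c ∈ D ∧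
      (∀ y, ∀ y' ∈ D, Q y' - ‖y - y'‖ ^ 2 / (2 * δ) ≤ H y) ∧
      (∀ y, ∃ y' ∈ D, H y = Q y' - ‖y - y'‖ ^ 2 / (2 * δ)) ∧
      H z = Q c - ‖z - c‖ ^ 2 / (2 * δ) ∧
      (∀ y, H y - ‖L y‖ ^ 2 / 2 ≤ H z - ‖L z‖ ^ 2 / 2 + ρ) ∧
      (∀ h, |⟪(1 / δ) • (c - z), h⟫ - ⟪L z, L h⟫| ≤ ρ * ‖h‖) ∧
      (∀ u v, ⟪A u, v⟫ = ⟪u, A v⟫) ∧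
      (∀ h, ⟪A h, h⟫ ≤ ‖L h‖ ^ 2 + ρ * ‖h‖ ^ 2) ∧
      ∀ ω > 0, ∃ r > 0, ∀ h : F, ‖h‖ < r →
        |H (z + h) - H z - ⟪(1 / δ) • (c - z), h⟫ - 1 / 2 * ⟪A h, h⟫| ≤ ω * ‖h‖ ^ 2 := by
  choose c hcD hc using fun z => exists_isMaxOn_sub_sq hD hne hQ hM hδ z
  set H : F → ℝ := fun z => Q (c z) - ‖z - c z‖ ^ 2 / (2 * δ) with hH
  set P : F → F := fun z => (1 / δ) • (c z - z) with hP
  have hlow : ∀ z h, H z + ⟪P z, h⟫ - ‖h‖ ^ 2 / (2 * δ) ≤ H (z + h) := by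
    intro z h
    have h1 := hc (z + h) (c z) (hcD z)
    rw [sq_expand_sub] at h1
    have h2 : ⟪P z, h⟫ = -(2 * ⟪z - c z, h⟫ / (2 * δ)) := by
      simp only [hP]
      rw [inner_smul_left, ← neg_sub z (c z), inner_neg_left]
      simp only [conj_trivial]; field_simp
    rw [h2]; simp only [hH]
    rw [add_div, add_div] at h1
    linarith
  have hHM : ∀ z, H z ≤ M := fun z => by
    have := hM _ (hcD z)
    have : 0 ≤ ‖z - c z‖ ^ 2 / (2 * δ) := by positivity
    simp only [hH]; linarith
  have hHc : Continuous H := by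
    have : Continuous fun z => H z + ‖z‖ ^ 2 / (2 * δ) := by
      refine continuous_of_forall_affine_support (p := fun z => P z + (1 / δ) • z) fun z y => ?_
      have h1 := hlow z (y - z)
      rw [add_sub_cancel] at h1
      have h2 : ‖y‖ ^ 2 = ‖z‖ ^ 2 + 2 * ⟪z, y - z⟫ + ‖y - z‖ ^ 2 := by
        have := norm_add_sq_real z (y - z)
        rwa [add_sub_cancel] at this
      rw [inner_add_left, inner_smul_left z, h2, add_div, add_div]
      have h3 : 2 * ⟪z, y - z⟫ / (2 * δ) = 1 / δ * ⟪z, y - z⟫ := by field_simp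
      rw [h3]; simp only [conj_trivial]
      linarith
    have h2 : H = fun z => (H z + ‖z‖ ^ 2 / (2 * δ)) - ‖z‖ ^ 2 / (2 * δ) := by
      funext z; ring
    rw [h2]
    exact this.sub (by fun_prop)
  set ρ₁ := ρ / 8 with hρ₁
  have hρ₁p : 0 < ρ₁ := by positivity
  set Θ : F → ℝ := fun z => ‖L z‖ ^ 2 / 2 with hΘ
  have hΘ0 : ∀ z, 0 ≤ Θ z := fun z => by simp only [hΘ]; positivity
  have hbdd : BddAbove (range fun z => H z - Θ z) :=
    ⟨M, by rintro _ ⟨z, rfl⟩; have := hHM z; have := hΘ0 z; simp only; linarith⟩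
  obtain ⟨_, ⟨zh, rfl⟩, hzh⟩ := exists_lt_of_lt_csSup (range_nonempty fun z => H z - Θ z)
    (show sSup (range fun z => H z - Θ z) - ρ₁ / 2 < sSup (range fun z => H z - Θ z) by linarith)
  replace hzh : ∀ z, H z - Θ z ≤ H zh - Θ zh + ρ₁ / 2 := fun z => by
    have := le_csSup hbdd (mem_range_self z); simp only at hzh this; linarith
  set Ψ : F → F → ℝ := fun p z => H z - Θ z - ρ₁ * ‖z - zh‖ ^ 2 - ⟪p, z⟫ with hΨ
  set S : Set F := {z | ∃ p : F, ‖p‖ ≤ ρ₁ / 2 ∧ ∀ y, Ψ p y ≤ Ψ p z} with hS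
  have hex : ∀ p : F, ‖p‖ ≤ ρ₁ / 2 → ∃ z, ∀ y, Ψ p y ≤ Ψ p z := by
    intro p hp
    have hcont : Continuous (Ψ p) := by
      simp only [hΨ, hΘ]; fun_prop
    refine hcont.exists_forall_ge' zh ?_
    have hev : ∀ᶠ z in cocompact F, 1 ≤ ‖z - zh‖ := by
      have : Tendsto (fun z : F => ‖z - zh‖) (cocompact F) atTop := by
        have := tendsto_dist_right_cocompact_atTop zh (α := F)
        simpa [dist_eq_norm] using this
      exact this.eventually_ge_atTop 1
    filter_upwards [hev] with z hz
    have h1 := hzh z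
    have h2 : -(ρ₁ / 2 * ‖z - zh‖) ≤ ⟪p, z - zh⟫ := by
      have := (abs_le.1 (abs_real_inner_le_norm p (z - zh))).1
      have : ‖p‖ * ‖z - zh‖ ≤ ρ₁ / 2 * ‖z - zh‖ := by gcongr
      linarith
    rw [inner_sub_right] at h2
    have h3 : ρ₁ * ‖z - zh‖ ≤ ρ₁ * ‖z - zh‖ ^ 2 := by
      gcongr; nlinarith
    have h4 : ρ₁ * 1 ≤ ρ₁ * ‖z - zh‖ := by gcongr
    simp only [hΨ, sub_self, norm_zero]
    linarith
  -- properties on `S`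
  have hSp : ∀ z, ∀ p : F, ‖p‖ ≤ ρ₁ / 2 → (∀ y, Ψ p y ≤ Ψ p z) →
      ‖z - zh‖ ≤ 1 ∧ (∀ y, H y - Θ y ≤ H z - Θ z + ρ₁) ∧
      (∀ v, ⟪P z, v⟫ = ⟪L z, L v⟫ + 2 * ρ₁ * ⟪z - zh, v⟫ + ⟪p, v⟫) ∧
      (∀ h, H (z + h) ≤ H z + ⟪P z, h⟫ + ‖L h‖ ^ 2 / 2 + ρ₁ * ‖h‖ ^ 2) := by
    intro z p hp hmax
    have h2 : |⟪p, z - zh⟫| ≤ ρ₁ / 2 * ‖z - zh‖ :=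
      (abs_real_inner_le_norm p (z - zh)).trans (by gcongr)
    have h1 := hmax zh
    have h3 := hzh z
    have h2' := abs_le.1 h2
    rw [inner_sub_right] at h2'
    simp only [hΨ, sub_self, norm_zero] at h1
    have hs : ‖z - zh‖ ≤ 1 := by
      by_contra hcon
      push Not at hcon
      nlinarith [h2'.1, h2'.2]
    have hexp : ∀ h, H (z + h) ≤ H z + (⟪L z, L h⟫ + 2 * ρ₁ * ⟪z - zh, h⟫ + ⟪p, h⟫)
        + ‖L h‖ ^ 2 / 2 + ρ₁ * ‖h‖ ^ 2 := by
      intro h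
      have h4 := hmax (z + h)
      simp only [hΨ, hΘ] at h4
      rw [norm_sq_expand, sq_expand_sub, inner_add_right] at h4
      linarith
    set q : F := ContinuousLinearMap.adjoint L (L z) + (2 * ρ₁) • (z - zh) + p with hq
    have hqi : ∀ v, ⟪q, v⟫ = ⟪L z, L v⟫ + 2 * ρ₁ * ⟪z - zh, v⟫ + ⟪p, v⟫ := by
      intro v
      rw [hq, inner_add_left, inner_add_left, inner_smul_left,
        ContinuousLinearMap.adjoint_inner_left]
      simp only [conj_trivial]
    have hPq : P z = q := by
      refine eq_of_inner_sub_le_sq (κ := 1 / (2 * δ) + ‖L‖ ^ 2 / 2 + ρ₁) fun v => ?_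
      have h5 := hlow z v
      have h6 := hexp v
      rw [← hqi] at h6
      rw [inner_sub_left]
      have h7 : ‖L v‖ ^ 2 ≤ ‖L‖ ^ 2 * ‖v‖ ^ 2 := by
        rw [← mul_pow]; gcongr; exact L.le_opNorm v
      have h8 : ‖v‖ ^ 2 / (2 * δ) = 1 / (2 * δ) * ‖v‖ ^ 2 := by ring
      rw [h8] at h5
      linarith
    refine ⟨hs, fun y => ?_, fun v => by rw [hPq, hqi], fun h => ?_⟩
    · have h5 := hzh y
      have : 0 ≤ ρ₁ * ‖z - zh‖ ^ 2 := by positivity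
      have : ρ₁ / 2 * ‖z - zh‖ ≤ ρ₁ / 2 := by nlinarith
      nlinarith [h2'.1, h2'.2]
    · rw [hPq, hqi]; exact hexp h
  set κ := 1 / (2 * δ) + ‖L‖ ^ 2 / 2 + ρ₁ with hκ
  have hquad : ∀ z ∈ S, ∀ h, |H (z + h) - H z - ⟪P z, h⟫| ≤ κ * ‖h‖ ^ 2 := by
    rintro z ⟨p, hp, hmax⟩ h
    obtain ⟨-, -, -, h4⟩ := hSp z p hp hmax
    have h5 := hlow z h
    have h6 := h4 h
    have h7 : ‖L h‖ ^ 2 ≤ ‖L‖ ^ 2 * ‖h‖ ^ 2 := by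
      rw [← mul_pow]; gcongr; exact L.le_opNorm h
    have h8 : ‖h‖ ^ 2 / (2 * δ) = 1 / (2 * δ) * ‖h‖ ^ 2 := by ring
    have h9 : 0 ≤ 1 / (2 * δ) * ‖h‖ ^ 2 := by positivity
    have h10 : 0 ≤ ‖L‖ ^ 2 * ‖h‖ ^ 2 := by positivity
    have h11 : 0 ≤ ρ₁ * ‖h‖ ^ 2 := by positivity
    rw [h8] at h5
    rw [hκ, abs_le]
    constructor <;> linarith
  let : MeasurableSpace F := borel F
  have : BorelSpace F := ⟨rfl⟩
  set μ : Measure F := μH[(Module.finrank ℝ F : ℝ)] with hμ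
  have hμS : μ S ≠ 0 := by
    intro h0
    set Φ : F → F := fun z => P z - ContinuousLinearMap.adjoint L (L z) - (2 * ρ₁) • (z - zh)
      with hΦ
    set K : ℝ := 6 * |κ| + ‖ContinuousLinearMap.adjoint L‖ * ‖L‖ + 2 * ρ₁ with hK
    have hlip : LipschitzOnWith K.toNNReal Φ S := by
      refine LipschitzOnWith.of_dist_le_mul fun a ha b hb => ?_
      rw [dist_eq_norm, dist_eq_norm, Real.coe_toNNReal _ (by positivity)]
      have h1 := norm_sub_le_of_quadratic_error (hquad a ha) (hquad b hb)
      have e : Φ a - Φ b = (P a - P b) - ContinuousLinearMap.adjoint L (L (a - b))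
          - (2 * ρ₁) • (a - b) := by
        simp only [hΦ, map_sub, smul_sub]; abel
      rw [e]
      calc _ ≤ ‖P a - P b‖ + ‖ContinuousLinearMap.adjoint L (L (a - b))‖
            + ‖(2 * ρ₁) • (a - b)‖ := by
              refine (norm_sub_le _ _).trans ?_
              gcongr
              exact norm_sub_le _ _
        _ ≤ 6 * |κ| * ‖a - b‖ + ‖ContinuousLinearMap.adjoint L‖ * (‖L‖ * ‖a - b‖)
            + 2 * ρ₁ * ‖a - b‖ := by
              gcongr
              · refine h1.trans ?_
                gcongr; exact le_abs_self κ
              · refine (ContinuousLinearMap.le_opNorm _ _).trans ?_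
                gcongr; exact L.le_opNorm _
              · rw [norm_smul, Real.norm_of_nonneg (by positivity)]
        _ = _ := by rw [hK]; ring
    have h1 := hlip.hausdorffMeasure_image_le (d := (Module.finrank ℝ F : ℝ)) (by positivity)
    rw [← hμ, h0, mul_zero] at h1
    have hsub : closedBall (0 : F) (ρ₁ / 2) ⊆ Φ '' S := by
      intro p hp
      rw [mem_closedBall, dist_zero_right] at hp
      obtain ⟨z, hz⟩ := hex p hp
      refine ⟨z, ⟨p, hp, hz⟩, ?_⟩
      obtain ⟨-, -, h3, -⟩ := hSp z p hp hz
      refine ext_inner_right ℝ fun v => ?_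
      simp only [hΦ]
      rw [inner_sub_left, inner_sub_left, h3, inner_smul_left,
        ContinuousLinearMap.adjoint_inner_left]
      simp only [conj_trivial]; ring
    have h2 := measure_mono (μ := μ) hsub
    have h3 := measure_closedBall_pos μ (0 : F) (by positivity : 0 < ρ₁ / 2)
    exact absurd (h3.trans_le (h2.trans h1)) (lt_irrefl _)
  obtain ⟨z, ⟨p, hp, hmax⟩, A, hAs, hA⟩ := ae_second_order_expansion μ hquad hμS
  obtain ⟨hz1, hz2, hz3, hz4⟩ := hSp z p hp hmax
  refine ⟨H, z, c z, A, hcD z, fun y y' hy' => hc y y' hy', fun y => ⟨c y, hcD y, rfl⟩, rfl,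
    fun y => ?_, fun h => ?_, hAs, fun h => ?_, hA⟩
  · have := hz2 y; simp only [hΘ] at this; linarith
  · have := hz3 h
    simp only [hP] at this
    rw [this]
    have h1 : ⟪L z, L h⟫ + 2 * ρ₁ * ⟪z - zh, h⟫ + ⟪p, h⟫ - ⟪L z, L h⟫ =
      2 * ρ₁ * ⟪z - zh, h⟫ + ⟪p, h⟫ := by ring
    rw [h1]
    calc _ ≤ |2 * ρ₁ * ⟪z - zh, h⟫| + |⟪p, h⟫| := abs_add_le _ _
      _ ≤ 2 * ρ₁ * (1 * ‖h‖) + ρ₁ / 2 * ‖h‖ := by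
          rw [abs_mul, abs_of_pos (by positivity : 0 < 2 * ρ₁)]
          gcongr
          · exact (abs_real_inner_le_norm _ _).trans (by gcongr)
          · exact (abs_real_inner_le_norm _ _).trans (by gcongr)
      _ ≤ ρ * ‖h‖ := by
          have : 0 ≤ ρ * ‖h‖ := by positivity
          rw [hρ₁]; linarith
  · by_cases hh : h = 0
    · simp [hh]
    have hpos : 0 < ‖h‖ := norm_pos_iff.2 hh
    obtain ⟨r, hr, hr'⟩ := hA ρ₁ hρ₁p
    set t := r / (2 * ‖h‖) with ht
    have htp : 0 < t := by positivity
    have hth : ‖t • h‖ = t * ‖h‖ := by rw [norm_smul, Real.norm_of_nonneg htp.le]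
    have h1 := (abs_le.1 (hr' (t • h) (by rw [hth, ht]; field_simp; linarith))).1
    have h2 := hz4 (t • h)
    rw [hth] at h1 h2
    simp only [map_smul, inner_smul_left, inner_smul_right, norm_smul, conj_trivial,
      Real.norm_of_nonneg htp.le] at h1 h2
    have h3 : t ^ 2 * ⟪A h, h⟫ ≤ t ^ 2 * (‖L h‖ ^ 2 + 4 * ρ₁ * ‖h‖ ^ 2) := by nlinarith
    have h4 := le_of_mul_le_mul_left h3 (by positivity)
    have : 0 ≤ ρ * ‖h‖ ^ 2 := by positivity
    rw [hρ₁] at h4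
    linarith

theorem norm_sub_sq_le_three {E : Type*} [NormedAddCommGroup E] (x y a b : E) :
    ‖x - y‖ ^ 2 ≤ 3 * (‖a - x‖ ^ 2 + ‖b - y‖ ^ 2 + ‖a - b‖ ^ 2) := by
  have h : ‖x - y‖ ≤ ‖a - x‖ + ‖b - y‖ + ‖a - b‖ := by
    have e : x - y = -(a - x) + (b - y) + (a - b) := by abel
    rw [e]
    refine (norm_add_le _ _).trans ?_
    gcongr
    refine (norm_add_le _ _).trans ?_
    rw [norm_neg]
  calc ‖x - y‖ ^ 2 ≤ (‖a - x‖ + ‖b - y‖ + ‖a - b‖) ^ 2 := by gcongr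
    _ ≤ _ := by
      nlinarith [sq_nonneg (‖a - x‖ - ‖b - y‖), sq_nonneg (‖a - x‖ - ‖a - b‖),
        sq_nonneg (‖b - y‖ - ‖a - b‖)]

/-- If a function is separable, the cross block of its second order expansion vanishes. -/
theorem cross_block_eq_zero {E : Type*} [NormedAddCommGroup E] [InnerProductSpace ℝ E]
    {H : E → ℝ} {z p : E} {A : E →L[ℝ] E} (hAs : ∀ u v, ⟪A u, v⟫ = ⟪u, A v⟫)
    (hA : ∀ ω > 0, ∃ r > 0, ∀ h : E, ‖h‖ < r →
        |H (z + h) - H z - ⟪p, h⟫ - 1 / 2 * ⟪A h, h⟫| ≤ ω * ‖h‖ ^ 2) {a b : E}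
    (hsep : ∀ t : ℝ, H (z + t • (a + b)) + H z = H (z + t • a) + H (z + t • b)) :
    ⟪A a, b⟫ = 0 := by
  by_contra hne
  have hpos : 0 < |⟪A a, b⟫| := abs_pos.2 hne
  set N := ‖a + b‖ ^ 2 + ‖a‖ ^ 2 + ‖b‖ ^ 2 with hN
  have hN0 : 0 ≤ N := by positivity
  set ω := |⟪A a, b⟫| / (2 * (N + 1)) with hω
  obtain ⟨r, hr, h⟩ := hA ω (by positivity)
  set B := ‖a + b‖ + ‖a‖ + ‖b‖ + 1 with hB
  have hBp : 0 < B := by positivity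
  set t := r / (2 * B) with ht
  have htp : 0 < t := by positivity
  have htr : ∀ v : E, ‖v‖ ≤ B → ‖t • v‖ < r := by
    intro v hv
    rw [norm_smul, Real.norm_of_nonneg htp.le]
    calc t * ‖v‖ ≤ t * B := by gcongr
      _ = r / 2 := by rw [ht]; field_simp
      _ < r := by linarith
  have h1 := h (t • (a + b)) (htr _ (by rw [hB]; linarith [norm_nonneg a, norm_nonneg b]))
  have h2 := h (t • a) (htr _ (by rw [hB]; linarith [norm_nonneg (a + b), norm_nonneg b]))
  have h3 := h (t • b) (htr _ (by rw [hB]; linarith [norm_nonneg (a + b), norm_nonneg a]))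
  have hs := hsep t
  have hba : ⟪A b, a⟫ = ⟪A a, b⟫ := by rw [hAs, real_inner_comm]
  rw [norm_smul, mul_pow, Real.norm_of_nonneg htp.le] at h1 h2 h3
  simp only [map_smul, map_add, inner_smul_left, inner_smul_right, inner_add_left, inner_add_right,
    conj_trivial, hba] at h1 h2 h3
  rw [abs_le] at h1 h2 h3
  have key : |t ^ 2 * ⟪A a, b⟫| ≤ t ^ 2 * (ω * N) := by
    rw [hN, abs_le]
    constructor <;> linarith [h1.1, h1.2, h2.1, h2.2, h3.1, h3.2]
  rw [abs_mul, abs_of_pos (by positivity : 0 < t ^ 2)] at key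
  have key2 := le_of_mul_le_mul_left key (by positivity)
  have : ω * N ≤ |⟪A a, b⟫| / 2 := by
    rw [hω, div_mul_eq_mul_div, div_le_div_iff₀ (by positivity) (by positivity)]
    nlinarith
  linarith

set_option maxHeartbeats 800000 in
/-- Theorem on sums (Ishii's lemma) in approximate form: near a maximum of
`V x - W y - ‖x - y‖² / (6δ)` there are second order touchings of `V` from above and of `W` from
below whose Hessians satisfy the matrix inequality. -/
theorem theorem_on_sums {E : Type*} [NormedAddCommGroup E] [InnerProductSpace ℝ E]
    [FiniteDimensional ℝ E] {D : Set E} (hD : IsClosed D) (hne : D.Nonempty) {V W : E → ℝ}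
    (hV : UpperSemicontinuousOn V D) (hW : LowerSemicontinuousOn W D) {M : ℝ}
    (hM : ∀ x ∈ D, ∀ y ∈ D, V x - W y ≤ M) {δ : ℝ} (hδ : 0 < δ) {ρ : ℝ} (hρ : 0 < ρ) :
    ∃ x ∈ D, ∃ y ∈ D, ∃ (P Q : E) (X Y : E →L[ℝ] E),
      (∀ x' ∈ D, ∀ y' ∈ D, V x' - W y' - ‖x' - y'‖ ^ 2 / (6 * δ) ≤
        V x - W y - ‖x - y‖ ^ 2 / (6 * δ) + ρ) ∧
      ‖P - (1 / (3 * δ)) • (x - y)‖ ≤ ρ ∧ ‖Q - (1 / (3 * δ)) • (x - y)‖ ≤ ρ ∧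
      (∀ u v, ⟪X u, v⟫ = ⟪u, X v⟫) ∧ (∀ u v, ⟪Y u, v⟫ = ⟪u, Y v⟫) ∧
      (∀ ξ ξ', ⟪X ξ, ξ⟫ - ⟪Y ξ', ξ'⟫ ≤ ‖ξ - ξ'‖ ^ 2 / δ + ρ * (‖ξ‖ ^ 2 + ‖ξ'‖ ^ 2)) ∧
      (∀ ω > 0, ∃ r > 0, ∀ x' ∈ D, ‖x' - x‖ < r →
        V x' ≤ V x + ⟪P, x' - x⟫ + 1 / 2 * ⟪X (x' - x), x' - x⟫ + ω * ‖x' - x‖ ^ 2) ∧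
      (∀ ω > 0, ∃ r > 0, ∀ y' ∈ D, ‖y' - y‖ < r →
        W y + ⟪Q, y' - y⟫ + 1 / 2 * ⟪Y (y' - y), y' - y⟫ - ω * ‖y' - y‖ ^ 2 ≤ W y') := by
  let F := WithLp 2 (E × E)
  let mk : E → E → F := fun a b => WithLp.toLp 2 (a, b)
  let ι₁ : E →L[ℝ] F := (WithLp.prodContinuousLinearEquiv 2 ℝ E E).symm.toContinuousLinearMap ∘L
    ContinuousLinearMap.inl ℝ E E
  let ι₂ : E →L[ℝ] F := (WithLp.prodContinuousLinearEquiv 2 ℝ E E).symm.toContinuousLinearMap ∘L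
    ContinuousLinearMap.inr ℝ E E
  let π₁ : F →L[ℝ] E := ContinuousLinearMap.fst ℝ E E ∘L
    (WithLp.prodContinuousLinearEquiv 2 ℝ E E).toContinuousLinearMap
  let π₂ : F →L[ℝ] E := ContinuousLinearMap.snd ℝ E E ∘L
    (WithLp.prodContinuousLinearEquiv 2 ℝ E E).toContinuousLinearMap
  have hι₁ : ∀ a, ι₁ a = mk a 0 := fun a => rfl
  have hι₂ : ∀ a, ι₂ a = mk 0 a := fun a => rfl
  have hπ₁ : ∀ z : F, π₁ z = z.fst := fun a => rfl
  have hπ₂ : ∀ z : F, π₂ z = z.snd := fun a => rfl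
  have hinner : ∀ u v : F, ⟪u, v⟫ = ⟪π₁ u, π₁ v⟫ + ⟪π₂ u, π₂ v⟫ := fun u v =>
    WithLp.prod_inner_apply u v
  have hnorm : ∀ u : F, ‖u‖ ^ 2 = ‖π₁ u‖ ^ 2 + ‖π₂ u‖ ^ 2 := fun u =>
    WithLp.prod_norm_sq_eq_of_L2 u
  have h11 : ∀ a, π₁ (ι₁ a) = a := fun a => rfl
  have h21 : ∀ a, π₂ (ι₁ a) = 0 := fun a => rfl
  have h12 : ∀ a, π₁ (ι₂ a) = 0 := fun a => rfl
  have h22 : ∀ a, π₂ (ι₂ a) = a := fun a => rfl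
  have hmk1 : ∀ a b, π₁ (mk a b) = a := fun a b => rfl
  have hmk2 : ∀ a b, π₂ (mk a b) = b := fun a b => rfl
  have hmkz : ∀ z, mk (π₁ z) (π₂ z) = z := fun z => rfl
  have hmkadd : ∀ a b, mk a b = ι₁ a + ι₂ b := fun a b => by
    apply (WithLp.equiv 2 (E × E)).injective
    exact Prod.ext (add_zero a).symm (zero_add b).symm
  have hnorm1 : ∀ a, ‖ι₁ a‖ = ‖a‖ := fun a => by
    have := hnorm (ι₁ a)
    rw [h11, h21] at this
    rw [norm_zero] at this
    exact (sq_eq_sq₀ (norm_nonneg _) (norm_nonneg _)).1 (by linarith)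
  have hnorm2 : ∀ a, ‖ι₂ a‖ = ‖a‖ := fun a => by
    have := hnorm (ι₂ a)
    rw [h12, h22] at this
    rw [norm_zero] at this
    exact (sq_eq_sq₀ (norm_nonneg _) (norm_nonneg _)).1 (by linarith)
  let L : F →L[ℝ] E := (1 / Real.sqrt δ) • (π₁ - π₂)
  have hL : ∀ u v, ⟪L u, L v⟫ = ⟪π₁ u - π₂ u, π₁ v - π₂ v⟫ / δ := fun u v => by
    have : (1 / Real.sqrt δ) * (1 / Real.sqrt δ) = 1 / δ := by
      rw [div_mul_div_comm, one_mul, Real.mul_self_sqrt hδ.le]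
    simp only [L, _root_.smul_apply, _root_.sub_apply, inner_smul_left, inner_smul_right,
      conj_trivial]
    rw [← mul_assoc, this]; ring
  have hL2 : ∀ u, ‖L u‖ ^ 2 = ‖π₁ u - π₂ u‖ ^ 2 / δ := fun u => by
    rw [← real_inner_self_eq_norm_sq, hL, real_inner_self_eq_norm_sq]
  set DD : Set F := {z | π₁ z ∈ D ∧ π₂ z ∈ D} with hDD
  have hDDc : IsClosed DD := (hD.preimage π₁.continuous).inter (hD.preimage π₂.continuous)
  have hDDne : DD.Nonempty := by
    obtain ⟨x, hx⟩ := hne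
    exact ⟨mk x x, hx, hx⟩
  set Q₀ : F → ℝ := fun z => V (π₁ z) + -W (π₂ z) with hQ₀
  have hQus : UpperSemicontinuousOn Q₀ DD := by
    refine UpperSemicontinuousOn.add ?_ ?_
    · exact hV.comp π₁.continuous.continuousOn fun z hz => hz.1
    · have : UpperSemicontinuousOn (fun y => -W y) D := by
        intro y hy c hc
        have := hW y hy (-c) (by linarith)
        filter_upwards [this] with w hw using by linarith
      exact this.comp π₂.continuous.continuousOn fun z hz => hz.2
  obtain ⟨H, z, c, A, hc, hHge, hHeq, hHz, hmax, hgrad, hAs, hAle, hexp⟩ :=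
    jensen_sup_convolution L hDDc hDDne hQus
      (fun z hz => by simpa [hQ₀, sub_eq_add_neg] using hM _ hz.1 _ hz.2) hδ
      (show 0 < ρ / 2 by positivity)
  have hsep1 : ∀ a b a' b', H (mk a b) + H (mk a' b') ≤ H (mk a b') + H (mk a' b) := by
    intro a b a' b'
    obtain ⟨s, hs, hs'⟩ := hHeq (mk a b)
    obtain ⟨t, ht, ht'⟩ := hHeq (mk a' b')
    have h1 := hHge (mk a b') (mk (π₁ s) (π₂ t)) ⟨hs.1, ht.2⟩
    have h2 := hHge (mk a' b) (mk (π₁ t) (π₂ s)) ⟨ht.1, hs.2⟩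
    rw [hs', ht']
    simp only [hnorm, map_sub, hmk1, hmk2, hQ₀, add_div] at h1 h2 ⊢
    linarith
  have hsep : ∀ a b a' b', H (mk a b) + H (mk a' b') = H (mk a b') + H (mk a' b) :=
    fun a b a' b' => le_antisymm (hsep1 a b a' b') (hsep1 a b' a' b)
  have hcross : ∀ a b, ⟪A (ι₁ a), ι₂ b⟫ = 0 := fun a b => by
    refine cross_block_eq_zero hAs hexp fun t => ?_
    have h1 := hsep (π₁ z + t • a) (π₂ z + t • b) (π₁ z) (π₂ z)
    have hdec : ι₁ (π₁ z) + ι₂ (π₂ z) = z := by rw [← hmkadd, hmkz]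
    have e1 : z + t • (ι₁ a + ι₂ b) = mk (π₁ z + t • a) (π₂ z + t • b) := by
      rw [hmkadd, map_add, map_add, map_smul, map_smul, smul_add]
      conv_lhs => rw [← hdec]
      abel
    have e2 : z + t • ι₁ a = mk (π₁ z + t • a) (π₂ z) := by
      rw [hmkadd, map_add, map_smul]
      conv_lhs => rw [← hdec]
      abel
    have e3 : z + t • ι₂ b = mk (π₁ z) (π₂ z + t • b) := by
      rw [hmkadd, map_add, map_smul]
      conv_lhs => rw [← hdec]
      abel
    rw [hmkz z] at h1
    rw [e1, e2, e3]; linarith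
  set e : E := (1 / δ) • (π₁ z - π₂ z) with he
  set x := π₁ c with hx
  set y := π₂ c with hy
  set P : E := (1 / δ) • (x - π₁ z) with hP
  set Q : E := -((1 / δ) • (y - π₂ z)) with hQ
  have hself : ∀ v : E, ⟪v, v⟫ ≤ ρ / 2 * ‖v‖ → ‖v‖ ≤ ρ / 2 := by
    intro v hv
    rw [real_inner_self_eq_norm_sq] at hv
    by_contra hcon
    push Not at hcon
    nlinarith [norm_nonneg v]
  have hei : ∀ v, ⟪e, v⟫ = ⟪π₁ z - π₂ z, v⟫ / δ := fun v => by
    rw [he, inner_smul_left]; simp only [conj_trivial]; ring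
  have hQi : ∀ v, ⟪Q, v⟫ = -⟪(1 / δ) • (y - π₂ z), v⟫ := fun v => by
    rw [hQ, inner_neg_left]
  have hPe : ‖P - e‖ ≤ ρ / 2 := by
    refine hself _ ?_
    have h1 := (abs_le.1 (hgrad (ι₁ (P - e)))).2
    rw [hnorm1, hL, hinner, h11, h21, inner_zero_right, add_zero, sub_zero, map_smul, map_sub,
      ← hx, ← hP, ← hei, ← inner_sub_left] at h1
    exact h1
  have hQe : ‖Q - e‖ ≤ ρ / 2 := by
    refine hself _ ?_
    have h1 := (abs_le.1 (hgrad (ι₂ (Q - e)))).1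
    rw [hnorm2, hL, hinner, h12, h22, inner_zero_right, zero_add, zero_sub, map_smul, map_sub,
      inner_neg_right, ← hy, neg_div, ← hei] at h1
    have h2 := hQi (Q - e)
    rw [inner_sub_left]
    linarith
  have hxy : (1 / (3 * δ)) • (x - y) = e + (1 / 3 : ℝ) • ((P - e) + (Q - e)) := by
    have e1 : P + Q = (1 / δ) • (x - y) - e := by
      rw [hP, hQ, he]; simp only [smul_sub]; abel
    have e2 : (P - e) + (Q - e) = (1 / δ) • (x - y) - (3 : ℝ) • e := by
      rw [show (P - e) + (Q - e) = (P + Q) - e - e by abel, e1,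
        show (3 : ℝ) • e = e + e + e by rw [show (3 : ℝ) = 1 + 1 + 1 by norm_num]; simp [add_smul]]
      abel
    have e3 : (1 / 3 : ℝ) * (1 / δ) = 1 / (3 * δ) := by ring
    have e4 : (1 / 3 : ℝ) * 3 = 1 := by norm_num
    rw [e2, smul_sub (1 / 3 : ℝ), smul_smul (1 / 3 : ℝ), smul_smul (1 / 3 : ℝ), e3, e4, one_smul]
    abel
  have hclose : ‖(1 / 3 : ℝ) • ((P - e) + (Q - e))‖ ≤ ρ / 2 := by
    rw [norm_smul, Real.norm_of_nonneg (by norm_num)]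
    have := norm_add_le (P - e) (Q - e)
    linarith
  refine ⟨x, hc.1, y, hc.2, P, Q, π₁ ∘L A ∘L ι₁, -(π₂ ∘L A ∘L ι₂), ?_, ?_, ?_, ?_, ?_, ?_, ?_, ?_⟩
  · intro x' hx' y' hy'
    set w : E := (1 / 3 : ℝ) • (x' - y') with hw
    have h1 := hmax (mk (x' - w) (y' + w))
    have h2 := hHge (mk (x' - w) (y' + w)) (mk x' y') ⟨hx', hy'⟩
    have h3 := norm_sub_sq_le_three x y (π₁ z) (π₂ z)
    rw [hHz] at h1
    simp only [hL2, hnorm, map_sub, hmk1, hmk2, hQ₀, ← hx, ← hy] at h1 h2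
    have e1 : x' - w - x' = -w := by abel
    have e2 : y' + w - y' = w := by abel
    have e3 : x' - w - (y' + w) = w := by
      have : x' - y' = (3 : ℝ) • w := by rw [hw, smul_smul]; norm_num
      rw [show x' - w - (y' + w) = (x' - y') - w - w by abel, this,
        show (3 : ℝ) • w = w + w + w by rw [show (3 : ℝ) = 1 + 1 + 1 by norm_num]; simp [add_smul]]
      abel
    have e4 : ‖x' - y'‖ ^ 2 = 9 * ‖w‖ ^ 2 := by
      rw [hw, norm_smul, Real.norm_of_nonneg (by norm_num)]; ring
    rw [e1, e2, norm_neg] at h2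
    rw [e3] at h1
    rw [e4]
    have h4 : ‖x - y‖ ^ 2 / (6 * δ) ≤
        (‖π₁ z - x‖ ^ 2 + ‖π₂ z - y‖ ^ 2) / (2 * δ) + ‖π₁ z - π₂ z‖ ^ 2 / δ / 2 := by
      rw [div_div, mul_comm δ 2, ← add_div, div_le_div_iff₀ (by positivity) (by positivity)]
      nlinarith
    have h5 : 9 * ‖w‖ ^ 2 / (6 * δ) =
        (‖w‖ ^ 2 + ‖w‖ ^ 2) / (2 * δ) + ‖w‖ ^ 2 / δ / 2 := by field_simp; ring
    linarith
  · rw [hxy]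
    calc _ = ‖(P - e) - (1 / 3 : ℝ) • ((P - e) + (Q - e))‖ := by congr 1; abel
      _ ≤ ρ / 2 + ρ / 2 := (norm_sub_le _ _).trans (add_le_add hPe hclose)
      _ = ρ := by ring
  · rw [hxy]
    calc _ = ‖(Q - e) - (1 / 3 : ℝ) • ((P - e) + (Q - e))‖ := by congr 1; abel
      _ ≤ ρ / 2 + ρ / 2 := (norm_sub_le _ _).trans (add_le_add hQe hclose)
      _ = ρ := by ring
  · intro u v
    have := hAs (ι₁ u) (ι₁ v)
    rw [hinner, hinner, h11, h21, h11, h21] at this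
    simpa using this
  · intro u v
    have := hAs (ι₂ u) (ι₂ v)
    rw [hinner, hinner, h12, h22, h12, h22] at this
    simpa using this
  · intro ξ ξ'
    have h1 := hAle (ι₁ ξ + ι₂ ξ')
    have hc' : ⟪A (ι₂ ξ'), ι₁ ξ⟫ = 0 := by rw [hAs, real_inner_comm, hcross]
    rw [← hmkadd, hL2, hnorm, hmk1, hmk2, hmkadd, map_add, inner_add_left, inner_add_right,
      inner_add_right, hcross, hc',
      hinner (A (ι₁ ξ)), hinner (A (ι₂ ξ')), h11, h21, h12, h22] at h1
    simp only [ContinuousLinearMap.comp_apply, _root_.neg_apply, inner_neg_left]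
    simp only [inner_zero_right] at h1
    have : 0 ≤ ρ * (‖ξ‖ ^ 2 + ‖ξ'‖ ^ 2) := by positivity
    linarith
  · intro ω hω
    obtain ⟨r, hr, h⟩ := hexp ω hω
    refine ⟨r, hr, fun x' hx' hxr => ?_⟩
    have h1 := (abs_le.1 (h (ι₁ (x' - x)) (by rwa [hnorm1]))).2
    have h2 := hHge (z + ι₁ (x' - x)) (c + ι₁ (x' - x))
      ⟨by rw [map_add, h11, ← hx, add_sub_cancel]; exact hx',
        by rw [map_add, h21, add_zero]; exact hc.2⟩
    rw [add_sub_add_right_eq_sub] at h2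
    simp only [hQ₀, map_add, h11, h21, add_zero, ← hx, ← hy, add_sub_cancel] at h2
    have hPc : π₁ ((1 / δ) • (c - z)) = P := by rw [map_smul, map_sub]
    rw [hHz, hnorm1, hinner, hinner (A _), h11, h21, hPc, map_sub] at h1
    simp only [hQ₀, inner_zero_right, add_zero] at h1
    simp only [ContinuousLinearMap.comp_apply, map_sub ι₁]
    rw [← hx, ← hy] at h1
    simp only [map_sub] at h1 h2 ⊢
    linarith
  · intro ω hω
    obtain ⟨r, hr, h⟩ := hexp ω hω
    refine ⟨r, hr, fun y' hy' hyr => ?_⟩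
    have h1 := (abs_le.1 (h (ι₂ (y' - y)) (by rwa [hnorm2]))).2
    have h2 := hHge (z + ι₂ (y' - y)) (c + ι₂ (y' - y))
      ⟨by rw [map_add, h12, add_zero]; exact hc.1,
        by rw [map_add, h22, ← hy, add_sub_cancel]; exact hy'⟩
    rw [add_sub_add_right_eq_sub] at h2
    simp only [hQ₀, map_add, h12, h22, add_zero, ← hx, ← hy, add_sub_cancel] at h2
    have hQc : π₂ ((1 / δ) • (c - z)) = -Q := by rw [map_smul, map_sub, hQ, neg_neg]
    rw [hHz, hnorm2, hinner, hinner (A _), h12, h22, hQc, inner_neg_left] at h1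
    simp only [hQ₀, inner_zero_right, zero_add] at h1
    simp only [ContinuousLinearMap.comp_apply, _root_.neg_apply, inner_neg_left]
    rw [← hx, ← hy] at h1
    simp only [map_sub] at h1 h2 ⊢
    linarith

/-- The space-time quadratic form used as local test function. -/
def quadForm (t₀ : ℝ) (x₀ : Vec d) (a κ : ℝ) (p : Vec d) (X : Vec d →L[ℝ] Vec d)
    (t : ℝ) (x : Vec d) : ℝ :=
  a * (t - t₀) + κ * (t - t₀) ^ 2 + ⟪p, x - x₀⟫ + 1 / 2 * ⟪X (x - x₀), x - x₀⟫

lemma quadForm_self (t₀ : ℝ) (x₀ : Vec d) (a κ : ℝ) (p : Vec d) (X : Vec d →L[ℝ] Vec d) :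
    quadForm t₀ x₀ a κ p X t₀ x₀ = 0 := by
  simp [quadForm]

lemma contDiff_quadForm (t₀ : ℝ) (x₀ : Vec d) (a κ : ℝ) (p : Vec d) (X : Vec d →L[ℝ] Vec d) :
    ContDiff ℝ (⊤ : ℕ∞) fun z : ℝ × Vec d => quadForm t₀ x₀ a κ p X z.1 z.2 := by
  unfold quadForm
  have h1 : ContDiff ℝ (⊤ : ℕ∞) fun z : ℝ × Vec d => z.1 - t₀ := by fun_prop
  have h2 : ContDiff ℝ (⊤ : ℕ∞) fun z : ℝ × Vec d => z.2 - x₀ := by fun_prop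
  have h3 : ContDiff ℝ (⊤ : ℕ∞) fun z : ℝ × Vec d => X (z.2 - x₀) := X.contDiff.comp h2
  exact (((contDiff_const.mul h1).add (contDiff_const.mul (h1.pow 2))).add
    (contDiff_const.inner ℝ h2)).add (contDiff_const.mul (h3.inner ℝ h2))

/-- A smooth function on space-time as an element of `C12`. -/
def C12.ofContDiff (F : ℝ × Vec d → ℝ) (hF : ContDiff ℝ (⊤ : ℕ∞) F) : C12 d := by
  have hG : ContDiff ℝ (⊤ : ℕ∞) fun z : ℝ × Vec d =>
      (InnerProductSpace.toDual ℝ (Vec d)).symm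
        ((fderiv ℝ F z).comp (ContinuousLinearMap.inr ℝ ℝ (Vec d))) := by
    have h1 : ContDiff ℝ (⊤ : ℕ∞) (fderiv ℝ F) := hF.fderiv_right (by simp)
    exact (InnerProductSpace.toDual ℝ (Vec d)).symm.contDiff.comp
      (h1.clm_comp contDiff_const)
  have hdiff : Differentiable ℝ F := hF.differentiable (by simp)
  exact
  { toFun := fun t x => F (t, x)
    dt := fun t x => fderiv ℝ F (t, x) (1, 0)
    grad := fun t x => (InnerProductSpace.toDual ℝ (Vec d)).symm
        ((fderiv ℝ F (t, x)).comp (ContinuousLinearMap.inr ℝ ℝ (Vec d)))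
    hess := fun t x => Matrix.toEuclideanLin.symm
        (((fderiv ℝ (fun z : ℝ × Vec d => (InnerProductSpace.toDual ℝ (Vec d)).symm
        ((fderiv ℝ F z).comp (ContinuousLinearMap.inr ℝ ℝ (Vec d)))) (t, x)).comp
          (ContinuousLinearMap.inr ℝ ℝ (Vec d))).toLinearMap)
    hasDt := fun t x => by
      have h1 : HasDerivAt (fun s : ℝ => (s, x)) ((1 : ℝ), (0 : Vec d)) t :=
        (hasDerivAt_id t).prodMk (hasDerivAt_const t x)
      exact (hdiff (t, x)).hasFDerivAt.comp_hasDerivAt t h1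
    hasGrad := fun t x => by
      rw [hasGradientAt_iff_hasFDerivAt, LinearIsometryEquiv.apply_symm_apply]
      exact (hdiff (t, x)).hasFDerivAt.comp x (hasFDerivAt_prodMk_right t x)
    hasHess := fun t x => by
      rw [LinearEquiv.apply_symm_apply]
      have h := ((hG.differentiable (by simp)) (t, x)).hasFDerivAt.comp x
        (hasFDerivAt_prodMk_right t x)
      exact h.congr_fderiv (by ext v; rfl)
    cont := hF.continuous
    cont_dt := by
      have h1 : Continuous (fderiv ℝ F) := hF.continuous_fderiv (by simp)
      exact h1.clm_apply continuous_const
    cont_grad := hG.continuous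
    cont_hess := by
      have h1 := hG.continuous_fderiv (by simp)
      have h2 := h1.clm_comp (continuous_const (y := ContinuousLinearMap.inr ℝ ℝ (Vec d)))
      let Φ : (Vec d →L[ℝ] Vec d) →ₗ[ℝ] Matrix (Fin d) (Fin d) ℝ :=
        (Matrix.toEuclideanLin (𝕜 := ℝ) (m := Fin d) (n := Fin d)).symm.toLinearMap ∘ₗ
          (ContinuousLinearMap.coeLM ℝ)
      have h3 : Continuous Φ := LinearMap.continuous_of_finiteDimensional Φ
      exact h3.comp h2 }

lemma hasGradientAt_quad (c : ℝ) (x₀ : Vec d) (p : Vec d) (X : Vec d →L[ℝ] Vec d)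
    (hX : ∀ u v, ⟪X u, v⟫ = ⟪u, X v⟫) (x : Vec d) :
    HasGradientAt (fun x => c + ⟪p, x - x₀⟫ + 1 / 2 * ⟪X (x - x₀), x - x₀⟫)
      (p + X (x - x₀)) x := by
  rw [hasGradientAt_iff_hasFDerivAt]
  have h2 : HasFDerivAt (fun x : Vec d => x - x₀) (ContinuousLinearMap.id ℝ (Vec d)) x :=
    (hasFDerivAt_id x).sub_const x₀
  have h3 := X.hasFDerivAt.comp x h2
  have h4 := (((hasFDerivAt_const p x).inner ℝ h2).const_add c).add
    ((h3.inner ℝ h2).const_mul (1 / 2))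
  refine h4.congr_fderiv ?_
  ext v
  simp [InnerProductSpace.toDual_apply_apply]
  have e : ⟪X v, x - x₀⟫ = ⟪X x, v⟫ - ⟪X x₀, v⟫ := by
    rw [hX v, real_inner_comm, map_sub, inner_sub_left]
  rw [inner_sub_left, e]
  ring

/-- The derivatives of a `C12` function agreeing locally with a quadratic. -/
lemma C12.jet_of_eventuallyEq (φ : C12 d) {t₀ : ℝ} {x₀ : Vec d} {c a κ : ℝ} {p : Vec d}
    {X : Vec d →L[ℝ] Vec d} (hX : ∀ u v, ⟪X u, v⟫ = ⟪u, X v⟫)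
    (h : ∀ᶠ z : ℝ × Vec d in 𝓝 (t₀, x₀), φ.toFun z.1 z.2 = c + quadForm t₀ x₀ a κ p X z.1 z.2) :
    φ.toFun t₀ x₀ = c ∧ φ.dt t₀ x₀ = a ∧ φ.grad t₀ x₀ = p ∧
      (Matrix.toEuclideanLin (φ.hess t₀ x₀)).toContinuousLinearMap = X := by
  have hgrad : ∀ᶠ x in 𝓝 x₀, φ.grad t₀ x = p + X (x - x₀) := by
    have h1 : Tendsto (fun x : Vec d => (t₀, x)) (𝓝 x₀) (𝓝 (t₀, x₀)) :=
      (Continuous.prodMk_right t₀).tendsto x₀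
    filter_upwards [(h1.eventually h).eventually_nhds] with x hx
    refine (φ.hasGrad t₀ x).unique ?_
    refine (hasGradientAt_quad c x₀ p X hX x).congr_of_eventuallyEq ?_
    filter_upwards [hx] with y hy
    rw [hy]; simp only [quadForm]; ring
  refine ⟨?_, ?_, ?_, ?_⟩
  · have := h.self_of_nhds
    simpa [quadForm_self] using this
  · refine (φ.hasDt t₀ x₀).unique ?_
    have h1 : Tendsto (fun t : ℝ => (t, x₀)) (𝓝 t₀) (𝓝 (t₀, x₀)) :=
      (Continuous.prodMk_left x₀).tendsto t₀
    have h2 : HasDerivAt (fun t : ℝ => c + (a * (t - t₀) + κ * (t - t₀) ^ 2)) a t₀ := by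
      have e1 : HasDerivAt (fun t : ℝ => t - t₀) 1 t₀ := (hasDerivAt_id t₀).sub_const t₀
      have e2 := ((e1.const_mul a).add ((e1.pow 2).const_mul κ)).const_add c
      refine e2.congr_deriv ?_
      simp
    refine h2.congr_of_eventuallyEq ?_
    filter_upwards [h1.eventually h] with t ht
    rw [ht]; simp [quadForm]
  · simpa using hgrad.self_of_nhds
  · refine (φ.hasHess t₀ x₀).unique ?_
    have h2 : HasFDerivAt (fun x : Vec d => p + X (x - x₀)) X x₀ := by
      have e1 : HasFDerivAt (fun x : Vec d => x - x₀) (ContinuousLinearMap.id ℝ (Vec d)) x₀ :=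
        (hasFDerivAt_id x₀).sub_const x₀
      have := (X.hasFDerivAt.comp x₀ e1).const_add p
      simpa using this
    exact h2.congr_of_eventuallyEq hgrad

/-- A local quadratic test function touching `U` from above can be replaced by a global `C12`
test function which is arbitrarily close to `U`. -/
lemma exists_C12_touching {T : ℝ} (hT : 0 ≤ T) {U : ℝ → Vec d → ℝ}
    (hU : ContinuousOn (fun z : ℝ × Vec d => U z.1 z.2) (Icc 0 T ×ˢ univ))
    {t₀ : ℝ} (ht₀ : t₀ ∈ Icc 0 T) {x₀ : Vec d} {a κ : ℝ} {p : Vec d} {X : Vec d →L[ℝ] Vec d}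
    (hX : ∀ u v, ⟪X u, v⟫ = ⟪u, X v⟫) {r : ℝ} (hr : 0 < r)
    (htouch : ∀ t ∈ Icc 0 T, ∀ x, |t - t₀| < r → ‖x - x₀‖ < r →
      U t x ≤ U t₀ x₀ + quadForm t₀ x₀ a κ p X t x) {ρ : ℝ} (hρ : 0 < ρ) :
    ∃ φ : C12 d, φ.toFun t₀ x₀ = U t₀ x₀ ∧ φ.dt t₀ x₀ = a ∧ φ.grad t₀ x₀ = p ∧
      (Matrix.toEuclideanLin (φ.hess t₀ x₀)).toContinuousLinearMap = X ∧
      ∀ t ∈ Icc 0 T, ∀ x, U t x ≤ φ.toFun t x ∧ φ.toFun t x ≤ U t x + ρ := by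
  set Ut : ℝ × Vec d → ℝ := fun z => U (projIcc 0 T hT z.1) z.2 with hUt
  have hUtc : Continuous Ut := by
    have h1 : Continuous fun z : ℝ × Vec d => (((projIcc 0 T hT z.1 : Icc 0 T) : ℝ), z.2) := by
      fun_prop
    exact hU.comp_continuous h1 (fun z => ⟨(projIcc 0 T hT z.1).2, mem_univ _⟩)
  have hUte : ∀ t ∈ Icc 0 T, ∀ x, Ut (t, x) = U t x := by
    intro t ht x
    simp [hUt, projIcc_of_mem hT ht]
  obtain ⟨G, hG, hGd, -⟩ := (hUtc.add continuous_const : Continuous fun z => Ut z + ρ / 2)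
    |>.exists_contDiff_approx (⊤ : ℕ∞) (ε := fun _ => ρ / 2) continuous_const
      (fun _ => half_pos hρ)
  set q : ℝ × Vec d → ℝ := fun z => U t₀ x₀ + quadForm t₀ x₀ a κ p X z.1 z.2 with hq
  have hqs : ContDiff ℝ (⊤ : ℕ∞) q := contDiff_const.add (contDiff_quadForm t₀ x₀ a κ p X)
  have hz : q (t₀, x₀) = Ut (t₀, x₀) := by
    simp [hq, quadForm_self, hUte t₀ ht₀]
  have hopen : IsOpen {z : ℝ × Vec d | q z < Ut z + ρ ∧ |z.1 - t₀| < r ∧ ‖z.2 - x₀‖ < r} := by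
    refine (isOpen_lt hqs.continuous (hUtc.add continuous_const)).inter
      ((isOpen_lt (f := fun z : ℝ × Vec d => |z.1 - t₀|) (by fun_prop)
        continuous_const).inter (isOpen_lt (f := fun z : ℝ × Vec d => ‖z.2 - x₀‖)
        (by fun_prop) continuous_const))
  have hmem : (t₀, x₀) ∈ {z : ℝ × Vec d | q z < Ut z + ρ ∧ |z.1 - t₀| < r ∧ ‖z.2 - x₀‖ < r} := by
    refine ⟨?_, by simpa using hr, by simpa using hr⟩
    rw [hz]; linarith
  obtain ⟨R, hR, hball⟩ := Metric.isOpen_iff.1 hopen _ hmem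
  let χ : ContDiffBump ((t₀, x₀) : ℝ × Vec d) := ⟨R / 4, R / 2, by positivity, by linarith⟩
  set F : ℝ × Vec d → ℝ := fun z => χ z * q z + (1 - χ z) * G z with hF
  have hFs : ContDiff ℝ (⊤ : ℕ∞) F :=
    (χ.contDiff.mul hqs).add ((contDiff_const.sub χ.contDiff).mul hG)
  refine ⟨C12.ofContDiff F hFs, ?_⟩
  have hev : ∀ᶠ z : ℝ × Vec d in 𝓝 (t₀, x₀), (C12.ofContDiff F hFs).toFun z.1 z.2
      = U t₀ x₀ + quadForm t₀ x₀ a κ p X z.1 z.2 := by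
    filter_upwards [χ.eventuallyEq_one] with z hz
    change χ z * q z + (1 - χ z) * G z = _
    rw [hz]; simp [hq]
  obtain ⟨h1, h2, h3, h4⟩ := (C12.ofContDiff F hFs).jet_of_eventuallyEq hX hev
  refine ⟨h1, h2, h3, h4, ?_⟩
  intro t ht x
  change U t x ≤ χ (t, x) * q (t, x) + (1 - χ (t, x)) * G (t, x) ∧
    χ (t, x) * q (t, x) + (1 - χ (t, x)) * G (t, x) ≤ U t x + ρ
  have hg := hGd (t, x)
  rw [Real.dist_eq, abs_lt, Pi.add_apply, hUte t ht] at hg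
  have hc0 := χ.nonneg (x := (t, x))
  have hc1 := χ.le_one (x := (t, x))
  by_cases hm : (t, x) ∈ ball ((t₀, x₀) : ℝ × Vec d) R
  · obtain ⟨m1, m2, m3⟩ := hball hm
    rw [hUte t ht] at m1
    have m4 : U t x ≤ q (t, x) := htouch t ht x m2 m3
    constructor <;> nlinarith
  · have : χ (t, x) = 0 := by
      refine χ.zero_of_le_dist ?_
      have : R ≤ dist (t, x) (t₀, x₀) := by simpa using hm
      change R / 2 ≤ _
      linarith
    rw [this]
    constructor <;> linarith

/-- The data of a Bellman-type obstacle problem with finite jump measure. -/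
structure Coef (n d : ℕ) (ι : Type) where
  T : ℝ
  μ : Measure (Vec n)
  b : ι → Vec d → Vec d
  s : ι → Vec d → Fin d → Vec d
  η : ι → Vec d → Vec n → Vec d
  γ : Vec d → Vec n → ℝ
  f : ι → ℝ → Vec d → ℝ → Vec d → ℝ → ℝ
  ζ : ℝ → Vec d → ℝ
  L : ℝ
  c₀ : ℝ
  hT : 0 < T
  hc₀ : 0 < c₀
  hL : 1 ≤ L
  hμ : IsFiniteMeasure μ
  hμL : μ.real univ ≤ L
  hb : ∀ j x y, ‖b j x - b j y‖ ≤ L * ‖x - y‖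
  hb0 : ∀ j x, ‖b j x‖ ≤ L * (1 + ‖x‖)
  hs : ∀ j x y k, ‖s j x k - s j y k‖ ≤ L * ‖x - y‖
  hs0 : ∀ j x k, ‖s j x k‖ ≤ L * (1 + ‖x‖)
  hηm : ∀ j x, Measurable (η j x)
  hη : ∀ j x y, ∀ᵐ e ∂μ, ‖η j x e - η j y e‖ ≤ L * ‖x - y‖
  hη0 : ∀ j x e, ‖η j x e‖ ≤ L
  hγm : ∀ x, Measurable (γ x)
  hγ : ∀ x y e, |γ x e - γ y e| ≤ L * ‖x - y‖
  hγ0 : ∀ x e, 0 ≤ γ x e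
  hγ1 : ∀ x e, γ x e ≤ L
  hf_t : ∀ j x u p k, Continuous fun t => f j t x u p k
  hf_mono : ∀ j, ∀ t ∈ Icc 0 T, ∀ x p k u v, v ≤ u → c₀ * (u - v) ≤ f j t x v p k - f j t x u p k
  hf_k : ∀ j, ∀ t ∈ Icc 0 T, ∀ x u p, Monotone fun k => f j t x u p k
  hf_lip : ∀ j, ∀ t ∈ Icc 0 T, ∀ x u v p q k k',
    |f j t x u p k - f j t x v q k'| ≤ L * (|u - v| + ‖p - q‖ + |k - k'|)
  hf_x : ∀ j, ∀ R > (0 : ℝ), ∃ mR : ℝ → ℝ, Continuous mR ∧ mR 0 = 0 ∧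
    ∀ t ∈ Icc 0 T, ∀ x y u p k, ‖x‖ ≤ R → ‖y‖ ≤ R → |u| ≤ R →
      |f j t x u p k - f j t y u p k| ≤ mR (‖x - y‖ * (1 + ‖p‖))
  hζ : Continuous fun z : ℝ × Vec d => ζ z.1 z.2

namespace Coef

variable {ι : Type} (𝒞 : Coef n d ι)

/-- Compensated nonlocal term. -/
def Kw (j : ι) (w : Vec d → ℝ) (x p : Vec d) : ℝ :=
  ∫ e, (w (x + 𝒞.η j x e) - w x - ⟪𝒞.η j x e, p⟫) ∂𝒞.μ

/-- Weighted nonlocal term. -/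
def Bw (j : ι) (w : Vec d → ℝ) (x : Vec d) : ℝ :=
  ∫ e, (w (x + 𝒞.η j x e) - w x) * 𝒞.γ x e ∂𝒞.μ

/-- The transposed diffusion matrix applied to a vector. -/
def St (j : ι) (x p : Vec d) : Vec d := WithLp.toLp 2 fun k => ⟪𝒞.s j x k, p⟫

/-- The operator of the equation, evaluated at a jet. -/
def Ham (j : ι) (u₀ : ℝ) (w : Vec d → ℝ) (t : ℝ) (x : Vec d) (a : ℝ) (p : Vec d)
    (X : Vec d →L[ℝ] Vec d) : ℝ :=
  a - (1 / 2 * ∑ k, ⟪X (𝒞.s j x k), 𝒞.s j x k⟫ + ⟪𝒞.b j x, p⟫ + 𝒞.Kw j w x p)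
    - 𝒞.f j t x u₀ (𝒞.St j x p) (𝒞.Bw j w x)

lemma measurable_jump {w : Vec d → ℝ} (hw : Measurable w) (j : ι) (x : Vec d) :
    Measurable fun e => w (x + 𝒞.η j x e) - w x :=
  (hw.comp ((𝒞.hηm j x).const_add x)).sub_const _

lemma integrable_of_bdd {F : Vec n → ℝ} (hF : Measurable F) {K : ℝ} (hK : ∀ e, |F e| ≤ K) :
    Integrable F 𝒞.μ := by
  have := 𝒞.hμ
  exact Integrable.of_bound hF.aestronglyMeasurable K (Eventually.of_forall hK)

lemma integral_le_of_le {F : Vec n → ℝ} {K : ℝ} (hK0 : 0 ≤ K) (hF : Integrable F 𝒞.μ)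
    (hK : ∀ᵐ e ∂𝒞.μ, F e ≤ K) : ∫ e, F e ∂𝒞.μ ≤ 𝒞.L * K := by
  have := 𝒞.hμ
  calc ∫ e, F e ∂𝒞.μ ≤ ∫ _, K ∂𝒞.μ := integral_mono_ae hF (integrable_const K) hK
    _ = 𝒞.μ.real univ * K := by simp
    _ ≤ 𝒞.L * K := mul_le_mul_of_nonneg_right 𝒞.hμL hK0

lemma L_pos : 0 < 𝒞.L := lt_of_lt_of_le one_pos 𝒞.hL

lemma abs_jump_le {w : Vec d → ℝ} {M : ℝ} (hM : ∀ x, |w x| ≤ M) (x y : Vec d) :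
    |w x - w y| ≤ 2 * M := by
  have h1 := abs_le.1 (hM x)
  have h2 := abs_le.1 (hM y)
  rw [abs_le]; constructor <;> linarith

lemma integrable_K {w : Vec d → ℝ} (hw : Measurable w) {M : ℝ} (hM : ∀ x, |w x| ≤ M)
    (j : ι) (x p : Vec d) :
    Integrable (fun e => w (x + 𝒞.η j x e) - w x - ⟪𝒞.η j x e, p⟫) 𝒞.μ := by
  refine 𝒞.integrable_of_bdd (K := 2 * M + 𝒞.L * ‖p‖)
    ((𝒞.measurable_jump hw j x).sub ((𝒞.hηm j x).inner_const)) fun e => ?_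
  refine (abs_sub _ _).trans (add_le_add (abs_jump_le hM _ _) ?_)
  exact (abs_real_inner_le_norm _ _).trans
    (mul_le_mul_of_nonneg_right (𝒞.hη0 j x e) (norm_nonneg _))

lemma integrable_B {w : Vec d → ℝ} (hw : Measurable w) {M : ℝ} (hM : ∀ x, |w x| ≤ M)
    (j : ι) (x y : Vec d) :
    Integrable (fun e => (w (x + 𝒞.η j x e) - w x) * 𝒞.γ y e) 𝒞.μ := by
  refine 𝒞.integrable_of_bdd (K := 2 * M * 𝒞.L)
    ((𝒞.measurable_jump hw j x).mul (𝒞.hγm y)) fun e => ?_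
  rw [abs_mul, abs_of_nonneg (𝒞.hγ0 y e)]
  exact mul_le_mul (abs_jump_le hM _ _) (𝒞.hγ1 y e) (𝒞.hγ0 y e)
    ((abs_nonneg _).trans (abs_jump_le hM x x))

lemma norm_St_sub_le (j : ι) (x y p q : Vec d) {E : ℝ}
    (h : ∀ k, |⟪𝒞.s j x k, p⟫ - ⟪𝒞.s j y k, q⟫| ≤ E) :
    ‖𝒞.St j x p - 𝒞.St j y q‖ ≤ d * E := by
  have h1 : ∀ v : Vec d, ‖v‖ ≤ ∑ k, |v k| := by
    intro v
    rw [EuclideanSpace.norm_eq]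
    refine Real.sqrt_le_iff.2 ⟨Finset.sum_nonneg fun _ _ => abs_nonneg _, ?_⟩
    simp only [Real.norm_eq_abs]
    exact Finset.sum_sq_le_sq_sum_of_nonneg fun _ _ => abs_nonneg _
  refine (h1 _).trans ?_
  calc ∑ k, |(𝒞.St j x p - 𝒞.St j y q) k| ≤ ∑ _k : Fin d, E :=
        Finset.sum_le_sum fun k _ => h k
    _ = d * E := by simp

end Coef

lemma log_one_add_sq_sub_le (x x' : Vec d) :
    Real.log (1 + ‖x'‖ ^ 2) - Real.log (1 + ‖x‖ ^ 2)
      ≤ (2 * ⟪x, x' - x⟫ + ‖x' - x‖ ^ 2) / (1 + ‖x‖ ^ 2) := by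
  have h1 : 0 < 1 + ‖x‖ ^ 2 := by positivity
  have h2 : 0 < 1 + ‖x'‖ ^ 2 := by positivity
  rw [← Real.log_div h2.ne' h1.ne']
  refine (Real.log_le_sub_one_of_pos (div_pos h2 h1)).trans (le_of_eq ?_)
  have h3 : ‖x'‖ ^ 2 = ‖x‖ ^ 2 + 2 * ⟪x, x' - x⟫ + ‖x' - x‖ ^ 2 := by
    rw [← norm_add_sq_real]; simp
  rw [h3]; field_simp; ring

/-- The gradient correction produced by the penalization `l * log (1 + ‖x‖ ^ 2)`. -/
def logCoef (l : ℝ) (x : Vec d) : ℝ := 2 * l / (1 + ‖x‖ ^ 2)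

lemma logCoef_nonneg {l : ℝ} (hl : 0 ≤ l) (x : Vec d) : 0 ≤ logCoef l x := by
  unfold logCoef; positivity

lemma logCoef_mul_le {l : ℝ} (hl : 0 ≤ l) (x : Vec d) :
    logCoef l x * (1 + ‖x‖) ^ 2 ≤ 4 * l := by
  unfold logCoef
  rw [div_mul_eq_mul_div, div_le_iff₀ (by positivity)]
  nlinarith [mul_nonneg hl (sq_nonneg (1 - ‖x‖))]

lemma abs_inner_sub_inner_le {L l τ R : ℝ} (hL : 1 ≤ L) (hl : 0 ≤ l) (hR : 0 ≤ R)
    {x y p q B B' : Vec d} (hy : ‖y‖ ≤ R) (hB : ‖B‖ ≤ L * (1 + ‖x‖))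
    (hB' : ‖B'‖ ≤ L * (1 + ‖y‖)) (hBB : ‖B - B'‖ ≤ L * ‖x - y‖) (hp : ‖x - y‖ * ‖p‖ ≤ τ)
    (hpq : ‖p - q‖ ≤ τ) :
    |⟪B, p + logCoef l x • x⟫ - ⟪B', q⟫| ≤ 8 * L ^ 2 * l + 8 * L ^ 2 * (1 + R) ^ 2 * τ := by
  have hτ : 0 ≤ τ := (norm_nonneg _).trans hpq
  have e : ⟪B, p + logCoef l x • x⟫ - ⟪B', q⟫
      = ⟪B - B', p⟫ + ⟪B', p - q⟫ + logCoef l x * ⟪B, x⟫ := by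
    rw [inner_add_right, inner_sub_left, inner_sub_right, real_inner_smul_right]; ring
  have h1 : |⟪B - B', p⟫| ≤ L * τ :=
    calc |⟪B - B', p⟫| ≤ ‖B - B'‖ * ‖p‖ := abs_real_inner_le_norm _ _
      _ ≤ L * ‖x - y‖ * ‖p‖ := mul_le_mul_of_nonneg_right hBB (norm_nonneg _)
      _ = L * (‖x - y‖ * ‖p‖) := by ring
      _ ≤ L * τ := mul_le_mul_of_nonneg_left hp (by linarith)
  have h2 : |⟪B', p - q⟫| ≤ L * (1 + R) * τ :=
    (abs_real_inner_le_norm _ _).trans (mul_le_mul (hB'.trans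
      (mul_le_mul_of_nonneg_left (by linarith) (by linarith))) hpq (norm_nonneg _)
      (by positivity))
  have h3 : |logCoef l x * ⟪B, x⟫| ≤ L * (4 * l) := by
    rw [abs_mul, abs_of_nonneg (logCoef_nonneg hl x)]
    have : |⟪B, x⟫| ≤ L * (1 + ‖x‖) ^ 2 :=
      calc |⟪B, x⟫| ≤ ‖B‖ * ‖x‖ := abs_real_inner_le_norm _ _
        _ ≤ L * (1 + ‖x‖) * (1 + ‖x‖) :=
          mul_le_mul hB (by linarith) (norm_nonneg _) (by positivity)
        _ = L * (1 + ‖x‖) ^ 2 := by ring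
    calc logCoef l x * |⟪B, x⟫| ≤ logCoef l x * (L * (1 + ‖x‖) ^ 2) :=
          mul_le_mul_of_nonneg_left this (logCoef_nonneg hl x)
      _ = L * (logCoef l x * (1 + ‖x‖) ^ 2) := by ring
      _ ≤ L * (4 * l) := mul_le_mul_of_nonneg_left (logCoef_mul_le hl x) (by linarith)
  rw [e]
  refine (abs_add_three _ _ _).trans ?_
  have hLL : L ≤ L ^ 2 := by nlinarith
  have hRR : 1 + R ≤ (1 + R) ^ 2 := by nlinarith
  have h4 : L * (4 * l) ≤ 8 * L ^ 2 * l := by nlinarith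
  have h5 : L * τ ≤ L ^ 2 * (1 + R) ^ 2 * τ := by
    refine mul_le_mul_of_nonneg_right ?_ hτ
    nlinarith
  have h6 : L * (1 + R) * τ ≤ L ^ 2 * (1 + R) ^ 2 * τ := by
    refine mul_le_mul_of_nonneg_right (mul_le_mul hLL hRR (by positivity) (by positivity)) hτ
  nlinarith [mul_nonneg (mul_nonneg (sq_nonneg L) (sq_nonneg (1 + R))) hτ]

lemma quad_sub_quad_le {L l τ R δ : ℝ} (hL : 1 ≤ L) (hl : 0 ≤ l) (hR : 0 ≤ R) (hδ : 0 < δ)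
    (hτ : 0 ≤ τ) {x y S S' : Vec d} {X Y : Vec d →L[ℝ] Vec d}
    (hx : ‖x‖ ≤ R) (hy : ‖y‖ ≤ R) (hS : ‖S‖ ≤ L * (1 + ‖x‖))
    (hS' : ‖S'‖ ≤ L * (1 + ‖y‖)) (hSS : ‖S - S'‖ ≤ L * ‖x - y‖) (hxy : ‖x - y‖ ^ 2 / δ ≤ τ)
    (hXY : ∀ ξ ξ', ⟪X ξ, ξ⟫ - ⟪Y ξ', ξ'⟫ ≤ ‖ξ - ξ'‖ ^ 2 / δ + τ * (‖ξ‖ ^ 2 + ‖ξ'‖ ^ 2)) :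
    ⟪(X + logCoef l x • ContinuousLinearMap.id ℝ (Vec d)) S, S⟫ - ⟪Y S', S'⟫
      ≤ 8 * L ^ 2 * l + 8 * L ^ 2 * (1 + R) ^ 2 * τ := by
  have e : ⟪(X + logCoef l x • ContinuousLinearMap.id ℝ (Vec d)) S, S⟫
      = ⟪X S, S⟫ + logCoef l x * ‖S‖ ^ 2 := by
    rw [_root_.add_apply, inner_add_left, _root_.smul_apply, ContinuousLinearMap.id_apply,
      real_inner_smul_left, real_inner_self_eq_norm_sq]
  have h0 := hXY S S'
  have h1 : ‖S - S'‖ ^ 2 / δ ≤ L ^ 2 * τ := by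
    calc ‖S - S'‖ ^ 2 / δ ≤ (L * ‖x - y‖) ^ 2 / δ := by gcongr
      _ = L ^ 2 * (‖x - y‖ ^ 2 / δ) := by ring
      _ ≤ L ^ 2 * τ := by gcongr
  have h2 : ‖S‖ ^ 2 ≤ L ^ 2 * (1 + R) ^ 2 := by
    rw [← mul_pow]; exact pow_le_pow_left₀ (norm_nonneg _) (hS.trans (by gcongr)) 2
  have h3 : ‖S'‖ ^ 2 ≤ L ^ 2 * (1 + R) ^ 2 := by
    rw [← mul_pow]; exact pow_le_pow_left₀ (norm_nonneg _) (hS'.trans (by gcongr)) 2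
  have h4 : logCoef l x * ‖S‖ ^ 2 ≤ L ^ 2 * (4 * l) := by
    calc logCoef l x * ‖S‖ ^ 2 ≤ logCoef l x * (L * (1 + ‖x‖)) ^ 2 :=
          mul_le_mul_of_nonneg_left (pow_le_pow_left₀ (norm_nonneg _) hS 2) (logCoef_nonneg hl x)
      _ = L ^ 2 * (logCoef l x * (1 + ‖x‖) ^ 2) := by ring
      _ ≤ L ^ 2 * (4 * l) := mul_le_mul_of_nonneg_left (logCoef_mul_le hl x) (by positivity)
  have h5 : τ * (‖S‖ ^ 2 + ‖S'‖ ^ 2) ≤ τ * (2 * (L ^ 2 * (1 + R) ^ 2)) :=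
    mul_le_mul_of_nonneg_left (by linarith) hτ
  have h6 : L ^ 2 * τ ≤ L ^ 2 * (1 + R) ^ 2 * τ := by
    refine mul_le_mul_of_nonneg_right ?_ hτ
    exact le_mul_of_one_le_right (sq_nonneg L) (one_le_pow₀ (by linarith))
  rw [e]
  nlinarith [mul_nonneg (mul_nonneg (sq_nonneg L) (sq_nonneg (1 + R))) hτ,
    mul_nonneg (sq_nonneg L) hl]

lemma jump_sub_jump_le {L l τ R δ : ℝ} (hL : 1 ≤ L) (hl : 0 ≤ l) (hR : 0 ≤ R) (hδ : 0 < δ)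
    (hτ : 0 ≤ τ) {v w : Vec d → ℝ} {x y H H' : Vec d}
    (hH : ‖H‖ ≤ L) (hHH : ‖H - H'‖ ≤ L * ‖x - y‖) (hxy : ‖x - y‖ ^ 2 / δ ≤ τ)
    (hmax : ∀ x' y', v x' - l * Real.log (1 + ‖x'‖ ^ 2) - w y' - ‖x' - y'‖ ^ 2 / (6 * δ)
      ≤ v x - l * Real.log (1 + ‖x‖ ^ 2) - w y - ‖x - y‖ ^ 2 / (6 * δ) + τ) :
    (v (x + H) - v x) - (w (y + H') - w y) ≤ 8 * L ^ 2 * l + 8 * L ^ 2 * (1 + R) ^ 2 * τ := by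
  have h0 := hmax (x + H) (y + H')
  have h1 : l * (Real.log (1 + ‖x + H‖ ^ 2) - Real.log (1 + ‖x‖ ^ 2)) ≤ l * (2 * L ^ 2) := by
    refine mul_le_mul_of_nonneg_left ((log_one_add_sq_sub_le x (x + H)).trans ?_) hl
    rw [div_le_iff₀ (by positivity), add_sub_cancel_left]
    have e1 : ⟪x, H⟫ ≤ ‖x‖ * L :=
      (real_inner_le_norm _ _).trans (mul_le_mul_of_nonneg_left hH (norm_nonneg _))
    have e2 : ‖H‖ ^ 2 ≤ L ^ 2 := pow_le_pow_left₀ (norm_nonneg _) hH 2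
    nlinarith [sq_nonneg (‖x‖ - 1), sq_nonneg ‖x‖, mul_nonneg (sq_nonneg L) (sq_nonneg ‖x‖),
      sq_nonneg (‖x‖ - L)]
  have h2 : ‖x + H - (y + H')‖ ^ 2 / (6 * δ) ≤ (1 + L) ^ 2 * τ / 6 := by
    have e1 : ‖x + H - (y + H')‖ ≤ (1 + L) * ‖x - y‖ := by
      have : x + H - (y + H') = (x - y) + (H - H') := by abel
      rw [this]
      refine (norm_add_le _ _).trans ?_
      linarith
    calc ‖x + H - (y + H')‖ ^ 2 / (6 * δ) ≤ ((1 + L) * ‖x - y‖) ^ 2 / (6 * δ) := by gcongr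
      _ = (1 + L) ^ 2 * (‖x - y‖ ^ 2 / δ) / 6 := by field_simp
      _ ≤ (1 + L) ^ 2 * τ / 6 := by gcongr
  have h3 : 0 ≤ ‖x - y‖ ^ 2 / (6 * δ) := by positivity
  have h4 : (1 + L) ^ 2 * τ / 6 + τ ≤ 2 * L ^ 2 * τ := by
    have : (1 + L) ^ 2 / 6 + 1 ≤ 2 * L ^ 2 := by nlinarith
    nlinarith
  have h5 : L ^ 2 * τ ≤ L ^ 2 * (1 + R) ^ 2 * τ := by
    refine mul_le_mul_of_nonneg_right ?_ hτ
    exact le_mul_of_one_le_right (sq_nonneg L) (one_le_pow₀ (by linarith))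
  nlinarith [mul_nonneg (sq_nonneg L) hl, mul_nonneg (sq_nonneg L) hτ]

namespace Coef

variable {ι : Type} (𝒞 : Coef n d ι)

/-- The doubling-of-variables estimate. -/
lemma doubling_estimate (j : ι) {v w : Vec d → ℝ} (hvm : Measurable v) (hwm : Measurable w)
    {M : ℝ} (hv : ∀ x, |v x| ≤ M) (hw : ∀ x, |w x| ≤ M)
    {l τ R δ : ℝ} (hl : 0 ≤ l) (hR : 0 ≤ R) (hδ : 0 < δ) {t s a₁ a₂ : ℝ} {x y p q : Vec d}
    (ht : t ∈ Icc 0 𝒞.T) (hle : w y ≤ v x)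
    {X Y : Vec d →L[ℝ] Vec d} (hx : ‖x‖ ≤ R) (hy : ‖y‖ ≤ R) (hxyτ : ‖x - y‖ ≤ τ)
    (hxy : ‖x - y‖ ^ 2 / δ ≤ τ) (hp : ‖x - y‖ * ‖p‖ ≤ τ) (hpq : ‖p - q‖ ≤ τ)
    (ha : |a₁ - a₂| ≤ τ)
    (hXY : ∀ ξ ξ', ⟪X ξ, ξ⟫ - ⟪Y ξ', ξ'⟫ ≤ ‖ξ - ξ'‖ ^ 2 / δ + τ * (‖ξ‖ ^ 2 + ‖ξ'‖ ^ 2))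
    (hmax : ∀ x' y', v x' - l * Real.log (1 + ‖x'‖ ^ 2) - w y' - ‖x' - y'‖ ^ 2 / (6 * δ)
      ≤ v x - l * Real.log (1 + ‖x‖ ^ 2) - w y - ‖x - y‖ ^ 2 / (6 * δ) + τ)
    (hsub : 𝒞.Ham j (v x) v t x a₁ (p + logCoef l x • x)
      (X + logCoef l x • ContinuousLinearMap.id ℝ (Vec d)) ≤ 0)
    (hsup : 0 ≤ 𝒞.Ham j (w y) w s y a₂ q Y) :
    𝒞.c₀ * (v x - w y) ≤
      (d + 1 + 2 * 𝒞.L + 𝒞.L ^ 3 + 𝒞.L * d) *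
        (8 * 𝒞.L ^ 2 * l + 8 * 𝒞.L ^ 2 * (1 + R) ^ 2 * τ)
      + (2 * M * 𝒞.L ^ 3 + 1) * τ
      + (𝒞.f j t x (w y) (𝒞.St j y q) (𝒞.Bw j w y) -
          𝒞.f j s y (w y) (𝒞.St j y q) (𝒞.Bw j w y)) := by
  set L := 𝒞.L with hLdef
  have hL : 1 ≤ L := 𝒞.hL
  have hL0 : 0 < L := 𝒞.L_pos
  have hτ : 0 ≤ τ := (norm_nonneg _).trans hpq
  have hM : 0 ≤ M := (abs_nonneg _).trans (hv x)
  set E := 8 * L ^ 2 * l + 8 * L ^ 2 * (1 + R) ^ 2 * τ with hE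
  have hE0 : 0 ≤ E := by positivity
  -- local terms
  have h1 : ∀ k, ⟪(X + logCoef l x • ContinuousLinearMap.id ℝ (Vec d)) (𝒞.s j x k), 𝒞.s j x k⟫
      - ⟪Y (𝒞.s j y k), 𝒞.s j y k⟫ ≤ E := fun k =>
    quad_sub_quad_le hL hl hR hδ hτ hx hy (𝒞.hs0 j x k) (𝒞.hs0 j y k) (𝒞.hs j x y k) hxy hXY
  have h1' : ∑ k, ⟪(X + logCoef l x • ContinuousLinearMap.id ℝ (Vec d)) (𝒞.s j x k), 𝒞.s j x k⟫
      - ∑ k, ⟪Y (𝒞.s j y k), 𝒞.s j y k⟫ ≤ d * E := by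
    rw [← Finset.sum_sub_distrib]
    calc _ ≤ ∑ _k : Fin d, E := Finset.sum_le_sum fun k _ => h1 k
      _ = d * E := by simp
  have h2 : |⟪𝒞.b j x, p + logCoef l x • x⟫ - ⟪𝒞.b j y, q⟫| ≤ E :=
    abs_inner_sub_inner_le hL hl hR hy (𝒞.hb0 j x) (𝒞.hb0 j y) (𝒞.hb j x y) hp hpq
  have hSt : ‖𝒞.St j x (p + logCoef l x • x) - 𝒞.St j y q‖ ≤ d * E :=
    𝒞.norm_St_sub_le j x y _ _ fun k =>
      abs_inner_sub_inner_le hL hl hR hy (𝒞.hs0 j x k) (𝒞.hs0 j y k) (𝒞.hs j x y k) hp hpq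
  -- nonlocal terms
  have hη1 : ∀ z e, ‖𝒞.η j z e‖ ≤ L * (1 + ‖z‖) := fun z e =>
    (𝒞.hη0 j z e).trans (le_mul_of_one_le_right hL0.le (by linarith [norm_nonneg z]))
  have hjump : ∀ᵐ e ∂𝒞.μ, (v (x + 𝒞.η j x e) - v x) - (w (y + 𝒞.η j y e) - w y) ≤ E := by
    filter_upwards [𝒞.hη j x y] with e he
    exact jump_sub_jump_le hL hl hR hδ hτ (𝒞.hη0 j x e) he hxy hmax
  have h3 : 𝒞.Kw j v x (p + logCoef l x • x) - 𝒞.Kw j w y q ≤ L * (2 * E) := by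
    have i1 := 𝒞.integrable_K hvm hv j x (p + logCoef l x • x)
    have i2 := 𝒞.integrable_K hwm hw j y q
    unfold Kw
    rw [← integral_sub i1 i2]
    refine 𝒞.integral_le_of_le (by positivity) (i1.sub i2) ?_
    filter_upwards [hjump, 𝒞.hη j x y] with e he he'
    have := abs_le.1 (abs_inner_sub_inner_le hL hl hR hy (hη1 x e) (hη1 y e) he' hp hpq)
    linarith
  have h4 : 𝒞.Bw j v x - 𝒞.Bw j w y ≤ L * (L * E + 2 * M * L * τ) := by
    have i1 := 𝒞.integrable_B hvm hv j x x
    have i2 := 𝒞.integrable_B hwm hw j y y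
    unfold Bw
    rw [← integral_sub i1 i2]
    refine 𝒞.integral_le_of_le (by positivity) (i1.sub i2) ?_
    filter_upwards [hjump] with e he
    have e1 : ((v (x + 𝒞.η j x e) - v x) - (w (y + 𝒞.η j y e) - w y)) * 𝒞.γ x e ≤ L * E := by
      rw [mul_comm]
      exact (mul_le_mul_of_nonneg_left he (𝒞.hγ0 x e)).trans
        (mul_le_mul_of_nonneg_right (𝒞.hγ1 x e) hE0)
    have e2 : (w (y + 𝒞.η j y e) - w y) * (𝒞.γ x e - 𝒞.γ y e) ≤ 2 * M * (L * τ) := by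
      refine (le_abs_self _).trans ?_
      rw [abs_mul]
      exact mul_le_mul (abs_jump_le hw _ _) ((𝒞.hγ x y e).trans
        (mul_le_mul_of_nonneg_left hxyτ hL0.le)) (abs_nonneg _) (by positivity)
    linarith
  -- the driver
  have f1 := 𝒞.hf_mono j t ht x (𝒞.St j x (p + logCoef l x • x)) (𝒞.Bw j v x) (v x) (w y) hle
  have f2 : 𝒞.f j t x (w y) (𝒞.St j x (p + logCoef l x • x)) (𝒞.Bw j v x)
      ≤ 𝒞.f j t x (w y) (𝒞.St j x (p + logCoef l x • x)) (𝒞.Bw j w y)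
        + L * (L * (L * E + 2 * M * L * τ)) := by
    rcases le_total (𝒞.Bw j v x) (𝒞.Bw j w y) with h | h
    · have := 𝒞.hf_k j t ht x (w y) (𝒞.St j x (p + logCoef l x • x)) h
      simp only at this
      have : 0 ≤ L * (L * (L * E + 2 * M * L * τ)) := by positivity
      linarith
    · have e1 := (abs_le.1 (𝒞.hf_lip j t ht x (w y) (w y) (𝒞.St j x (p + logCoef l x • x))
        (𝒞.St j x (p + logCoef l x • x)) (𝒞.Bw j v x) (𝒞.Bw j w y))).2
      rw [sub_self, sub_self, abs_zero, norm_zero, abs_of_nonneg (sub_nonneg.2 h)] at e1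
      have e2 := mul_le_mul_of_nonneg_left h4 hL0.le
      simp only [zero_add] at e1
      linarith
  have f3 : 𝒞.f j t x (w y) (𝒞.St j x (p + logCoef l x • x)) (𝒞.Bw j w y)
      ≤ 𝒞.f j t x (w y) (𝒞.St j y q) (𝒞.Bw j w y) + L * (d * E) := by
    have e1 := (abs_le.1 (𝒞.hf_lip j t ht x (w y) (w y) (𝒞.St j x (p + logCoef l x • x))
        (𝒞.St j y q) (𝒞.Bw j w y) (𝒞.Bw j w y))).2
    rw [sub_self, sub_self, abs_zero, add_zero, zero_add] at e1
    have e2 := mul_le_mul_of_nonneg_left hSt hL0.le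
    linarith
  unfold Ham at hsub hsup
  have h2' := abs_le.1 h2
  have ha' := abs_le.1 ha
  have : (0 : ℝ) ≤ d * E := by positivity
  nlinarith

end Coef

/-- A function with values in a bounded interval cannot increase by more than `τ` at every
dyadic scale. -/
lemma exists_small_increment {S : ℝ → ℝ → ℝ} {lo hi : ℝ}
    (hlo : ∀ δ > 0, ∀ κ > 0, lo ≤ S δ κ) (hhi : ∀ δ > 0, ∀ κ > 0, S δ κ ≤ hi)
    {τ : ℝ} (hτ : 0 < τ) {k : ℝ → ℝ} (hk : ∀ δ > 0, 0 < k δ) :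
    ∃ δ > 0, δ ≤ 1 ∧ ∃ κ > 0, κ ≤ k δ ∧ S (2 * δ) κ - S δ κ ≤ τ := by
  by_contra! hcon
  obtain ⟨N, hN⟩ := exists_nat_gt ((hi - lo) / τ)
  set D : ℕ → ℝ := fun i => (1 / 2) ^ i with hD
  have hD0 : ∀ i, 0 < D i := fun i => by positivity
  have hD1 : ∀ i, D i ≤ 1 := fun i => pow_le_one₀ (by norm_num) (by norm_num)
  have hD2 : ∀ i, 2 * D (i + 1) = D i := fun i => by simp only [hD, pow_succ]; ring
  have hκ : ∀ N : ℕ, ∃ κ > 0, ∀ i < N, κ ≤ k (D (i + 1)) := by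
    intro N
    induction N with
    | zero => exact ⟨1, one_pos, fun i hi => by omega⟩
    | succ N ih =>
      obtain ⟨κ, h0, h1⟩ := ih
      refine ⟨min κ (k (D (N + 1))), lt_min h0 (hk _ (hD0 _)), fun i hi => ?_⟩
      rcases Nat.lt_succ_iff_lt_or_eq.1 hi with h | rfl
      · exact (min_le_left _ _).trans (h1 i h)
      · exact min_le_right _ _
  obtain ⟨κ, hκ0, hκ1⟩ := hκ N
  have hsum : ∑ i ∈ Finset.range N, (S (D i) κ - S (D (i + 1)) κ) = S (D 0) κ - S (D N) κ :=
    Finset.sum_range_sub' (fun i => S (D i) κ) N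
  have hge : N * τ ≤ ∑ i ∈ Finset.range N, (S (D i) κ - S (D (i + 1)) κ) := by
    have : ∑ i ∈ Finset.range N, τ ≤ ∑ i ∈ Finset.range N, (S (D i) κ - S (D (i + 1)) κ) := by
      refine Finset.sum_le_sum fun i hi => ?_
      have := hcon (D (i + 1)) (hD0 _) (hD1 _) κ hκ0 (hκ1 i (Finset.mem_range.1 hi))
      rw [hD2] at this
      exact this.le
    simpa using this
  rw [div_lt_iff₀ hτ] at hN
  linarith [hlo (D N) (hD0 N) κ hκ0, hhi (D 0) (hD0 0) κ hκ0]

/-- Space-time with its Euclidean structure. -/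
abbrev SpaceTime (d : ℕ) := WithLp 2 (ℝ × Vec d)

lemma SpaceTime.inner_eq (z w : SpaceTime d) : ⟪z, w⟫ = z.fst * w.fst + ⟪z.snd, w.snd⟫ := by
  rw [WithLp.prod_inner_apply]; simp [mul_comm]

lemma SpaceTime.norm_sq_eq (z : SpaceTime d) : ‖z‖ ^ 2 = z.fst ^ 2 + ‖z.snd‖ ^ 2 := by
  rw [WithLp.prod_norm_sq_eq_of_L2]; simp

/-- The inclusion of space into space-time. -/
def spaceIncl (d : ℕ) : Vec d →L[ℝ] SpaceTime d :=
  (WithLp.prodContinuousLinearEquiv 2 ℝ ℝ (Vec d)).symm.toContinuousLinearMap.comp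
    (ContinuousLinearMap.inr ℝ ℝ (Vec d))

/-- The projection of space-time onto space. -/
def spaceProj (d : ℕ) : SpaceTime d →L[ℝ] Vec d :=
  (ContinuousLinearMap.snd ℝ ℝ (Vec d)).comp
    (WithLp.prodContinuousLinearEquiv 2 ℝ ℝ (Vec d)).toContinuousLinearMap

lemma spaceIncl_fst (v : Vec d) : (spaceIncl d v).fst = 0 := rfl

lemma spaceIncl_snd (v : Vec d) : (spaceIncl d v).snd = v := rfl

/-- The spatial block of a space-time operator. -/
def spaceBlock (X : SpaceTime d →L[ℝ] SpaceTime d) : Vec d →L[ℝ] Vec d :=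
  (spaceProj d).comp (X.comp (spaceIncl d))

lemma inner_spaceBlock (X : SpaceTime d →L[ℝ] SpaceTime d) (v w : Vec d) :
    ⟪spaceBlock X v, w⟫ = ⟪X (spaceIncl d v), spaceIncl d w⟫ := by
  rw [SpaceTime.inner_eq, spaceIncl_fst, mul_zero, zero_add, spaceIncl_snd]; rfl

lemma norm_spaceIncl (v : Vec d) : ‖spaceIncl d v‖ = ‖v‖ := by
  have := SpaceTime.norm_sq_eq (spaceIncl d v)
  rw [spaceIncl_fst, spaceIncl_snd] at this
  have h2 : ‖spaceIncl d v‖ ^ 2 = ‖v‖ ^ 2 := by rw [this]; ring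
  exact (sq_eq_sq₀ (norm_nonneg _) (norm_nonneg _)).1 h2

lemma inner_le_spaceBlock (X : SpaceTime d →L[ℝ] SpaceTime d)
    (hX : ∀ u v, ⟪X u, v⟫ = ⟪u, X v⟫) {ω : ℝ} (hω : 0 < ω) (z : SpaceTime d) :
    ⟪X z, z⟫ ≤ ⟪spaceBlock X z.snd, z.snd⟫ + (‖X‖ + ‖X‖ ^ 2 / ω) * z.fst ^ 2
      + ω * ‖z.snd‖ ^ 2 := by
  set u : SpaceTime d := z - spaceIncl d z.snd with hu
  have hu1 : ‖u‖ ^ 2 = z.fst ^ 2 := by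
    rw [SpaceTime.norm_sq_eq]
    simp [hu, WithLp.sub_fst, WithLp.sub_snd, spaceIncl_fst, spaceIncl_snd]
  have hz : z = u + spaceIncl d z.snd := by simp [hu]
  have e : ⟪X z, z⟫ = ⟪X u, u⟫ + 2 * ⟪X u, spaceIncl d z.snd⟫ + ⟪spaceBlock X z.snd, z.snd⟫ := by
    rw [inner_spaceBlock]
    conv_lhs => rw [hz]
    simp only [map_add, inner_add_left, inner_add_right]
    rw [hX (spaceIncl d z.snd) u, real_inner_comm (X u) (spaceIncl d z.snd)]
    ring
  have h1 : ⟪X u, u⟫ ≤ ‖X‖ * z.fst ^ 2 := by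
    rw [← hu1]
    calc ⟪X u, u⟫ ≤ ‖X u‖ * ‖u‖ := real_inner_le_norm _ _
      _ ≤ ‖X‖ * ‖u‖ * ‖u‖ := mul_le_mul_of_nonneg_right (X.le_opNorm u) (norm_nonneg _)
      _ = ‖X‖ * ‖u‖ ^ 2 := by ring
  have h2 : 2 * ⟪X u, spaceIncl d z.snd⟫ ≤ ‖X‖ ^ 2 / ω * z.fst ^ 2 + ω * ‖z.snd‖ ^ 2 := by
    rw [← hu1]
    have e1 : ⟪X u, spaceIncl d z.snd⟫ ≤ ‖X‖ * ‖u‖ * ‖z.snd‖ := by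
      refine (real_inner_le_norm _ _).trans ?_
      rw [norm_spaceIncl]
      exact mul_le_mul_of_nonneg_right (X.le_opNorm u) (norm_nonneg _)
    have e2 : 2 * (‖X‖ * ‖u‖ * ‖z.snd‖) ≤ ‖X‖ ^ 2 / ω * ‖u‖ ^ 2 + ω * ‖z.snd‖ ^ 2 := by
      have e3 : ‖X‖ ^ 2 / ω * ‖u‖ ^ 2 = (‖X‖ * ‖u‖) ^ 2 / ω := by ring
      rw [e3, div_add' _ _ _ hω.ne', le_div_iff₀ hω]
      nlinarith [sq_nonneg (‖X‖ * ‖u‖ - ω * ‖z.snd‖)]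
    linarith
  rw [e]; linarith

/-- From a second order expansion in rescaled space-time to a quadratic test function. -/
lemma exists_quadForm_of_expansion {T c : ℝ} (hc : 0 < c) {V : ℝ → Vec d → ℝ}
    {z P : SpaceTime d} {X : SpaceTime d →L[ℝ] SpaceTime d} (hX : ∀ u v, ⟪X u, v⟫ = ⟪u, X v⟫)
    (h : ∀ ω > 0, ∃ r > 0, ∀ z' : SpaceTime d, c * z'.fst ∈ Icc 0 T → ‖z' - z‖ < r →
      V (c * z'.fst) z'.snd ≤ V (c * z.fst) z.snd + ⟪P, z' - z⟫ + 1 / 2 * ⟪X (z' - z), z' - z⟫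
        + ω * ‖z' - z‖ ^ 2) {ω : ℝ} (hω : 0 < ω) :
    ∃ κ : ℝ, ∃ r > 0, ∀ t ∈ Icc 0 T, ∀ x, |t - c * z.fst| < r → ‖x - z.snd‖ < r →
      V t x + ω * ((t - c * z.fst) ^ 2 + ‖x - z.snd‖ ^ 2) ≤ V (c * z.fst) z.snd
        + quadForm (c * z.fst) z.snd (P.fst / c) κ P.snd
          (spaceBlock X + (5 * ω) • ContinuousLinearMap.id ℝ (Vec d)) t x := by
  obtain ⟨r, hr, h⟩ := h ω hω
  refine ⟨((‖X‖ + ‖X‖ ^ 2 / ω) / 2 + ω) / c ^ 2 + ω, min (r * c / 2) (r / 2), by positivity, ?_⟩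
  intro t ht x ht' hx'
  set z' : SpaceTime d := WithLp.toLp 2 (t / c, x) with hz'
  have hzf : z'.fst = t / c := rfl
  have hzs : z'.snd = x := rfl
  have hf : (z' - z).fst = (t - c * z.fst) / c := by
    rw [WithLp.sub_fst]; rw [hzf]; field_simp
  have hs : (z' - z).snd = x - z.snd := by rw [WithLp.sub_snd, hzs]
  have hct : c * z'.fst = t := by rw [hzf]; field_simp
  have hnorm : ‖z' - z‖ < r := by
    have h1 : |(t - c * z.fst) / c| < r / 2 := by
      rw [abs_div, abs_of_pos hc, div_lt_iff₀ hc]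
      linarith [min_le_left (r * c / 2) (r / 2)]
    have h2 : ‖x - z.snd‖ < r / 2 := hx'.trans_le (min_le_right _ _)
    refine lt_of_pow_lt_pow_left₀ 2 hr.le ?_
    rw [SpaceTime.norm_sq_eq, hf, hs, ← sq_abs]
    have := pow_lt_pow_left₀ h1 (abs_nonneg _) two_ne_zero
    have := pow_lt_pow_left₀ h2 (norm_nonneg _) two_ne_zero
    nlinarith
  have h1 := h z' (by rw [hct]; exact ht) hnorm
  have h2 := inner_le_spaceBlock X hX hω (z' - z)
  rw [hct, hzs, SpaceTime.norm_sq_eq, SpaceTime.inner_eq] at h1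
  rw [hf, hs] at h1 h2
  have e : ⟪(spaceBlock X + (5 * ω) • ContinuousLinearMap.id ℝ (Vec d)) (x - z.snd), x - z.snd⟫
      = ⟪spaceBlock X (x - z.snd), x - z.snd⟫ + 5 * ω * ‖x - z.snd‖ ^ 2 := by
    rw [_root_.add_apply, inner_add_left, _root_.smul_apply, ContinuousLinearMap.id_apply,
      real_inner_smul_left, real_inner_self_eq_norm_sq]
  unfold quadForm
  rw [e]
  have e1 : P.fst * ((t - c * z.fst) / c) = P.fst / c * (t - c * z.fst) := by ring
  have e2 : ((t - c * z.fst) / c) ^ 2 = (t - c * z.fst) ^ 2 / c ^ 2 := by rw [div_pow]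
  rw [e1, e2] at h1
  rw [e2] at h2
  have e3 : (((‖X‖ + ‖X‖ ^ 2 / ω) / 2 + ω) / c ^ 2 + ω) * (t - c * z.fst) ^ 2
      = (‖X‖ + ‖X‖ ^ 2 / ω) * ((t - c * z.fst) ^ 2 / c ^ 2) / 2
        + ω * ((t - c * z.fst) ^ 2 / c ^ 2) + ω * (t - c * z.fst) ^ 2 := by ring
  rw [e3]
  nlinarith [mul_nonneg hω.le (sq_nonneg ‖x - z.snd‖)]

/-- Near the initial time, ordered semicontinuous functions stay almost ordered. -/
lemma exists_initial_layer {T : ℝ} (hT : 0 < T) {V W : ℝ → Vec d → ℝ}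
    (hV : UpperSemicontinuousOn (fun z : ℝ × Vec d => V z.1 z.2) (Icc 0 T ×ˢ univ))
    (hW : LowerSemicontinuousOn (fun z : ℝ × Vec d => W z.1 z.2) (Icc 0 T ×ˢ univ))
    {M R θ : ℝ} (hθ : 0 < θ) (hWM : ∀ t ∈ Icc 0 T, ∀ x, -M ≤ W t x)
    (hVR : ∀ t ∈ Icc 0 T, ∀ x, R < ‖x‖ → V t x ≤ -M) (h0 : ∀ x, V 0 x ≤ W 0 x) :
    ∃ η > 0, ∀ t ∈ Icc 0 T, ∀ s ∈ Icc 0 T, ∀ x y, |t - s| ≤ η → ‖x - y‖ ≤ η →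
      (t = 0 ∨ s = 0) → V t x - W s y < θ := by
  by_contra! hcon
  choose t ht s hs x y hts hxy hz hge using fun i : ℕ =>
    hcon (1 / (i + 1)) (by positivity)
  have hxR : ∀ i, x i ∈ closedBall (0 : Vec d) R := by
    intro i
    rw [mem_closedBall_zero_iff]
    by_contra! hx
    linarith [hVR (t i) (ht i) (x i) hx, hWM (s i) (hs i) (y i), hge i]
  obtain ⟨x₀, -, φ, hφ, hlim⟩ := (isCompact_closedBall (0 : Vec d) R).tendsto_subseq hxR
  have hone : Tendsto (fun i : ℕ => (1 : ℝ) / (i + 1)) atTop (𝓝 0) :=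
    tendsto_one_div_add_atTop_nhds_zero_nat
  have hone' := hone.comp hφ.tendsto_atTop
  have habs : ∀ i, |t i| ≤ 1 / (i + 1 : ℝ) ∧ |s i| ≤ 1 / (i + 1 : ℝ) := by
    intro i
    have hp : (0 : ℝ) ≤ 1 / (i + 1) := by positivity
    have := hts i
    rcases hz i with h | h
    · rw [h, zero_sub, abs_neg] at this
      exact ⟨by rw [h, abs_zero]; exact hp, this⟩
    · rw [h, sub_zero] at this
      exact ⟨this, by rw [h, abs_zero]; exact hp⟩
  have ht0 : Tendsto (fun i => t (φ i)) atTop (𝓝 0) :=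
    squeeze_zero_norm (fun i => (habs (φ i)).1) hone'
  have hs0 : Tendsto (fun i => s (φ i)) atTop (𝓝 0) :=
    squeeze_zero_norm (fun i => (habs (φ i)).2) hone'
  have hy0 : Tendsto (fun i => y (φ i)) atTop (𝓝 x₀) := by
    have h1 : Tendsto (fun i => x (φ i) - y (φ i)) atTop (𝓝 0) :=
      squeeze_zero_norm (fun i => hxy (φ i)) hone'
    have h2 := hlim.sub h1
    simpa using h2
  have hmem : ((0 : ℝ), x₀) ∈ Icc 0 T ×ˢ (univ : Set (Vec d)) := ⟨⟨le_rfl, hT.le⟩, mem_univ _⟩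
  have hl1 : Tendsto (fun i => (t (φ i), x (φ i))) atTop
      (𝓝[Icc 0 T ×ˢ (univ : Set (Vec d))] (0, x₀)) :=
    tendsto_nhdsWithin_iff.2 ⟨ht0.prodMk_nhds hlim, Eventually.of_forall
      fun i => ⟨ht _, mem_univ _⟩⟩
  have hl2 : Tendsto (fun i => (s (φ i), y (φ i))) atTop
      (𝓝[Icc 0 T ×ˢ (univ : Set (Vec d))] (0, x₀)) :=
    tendsto_nhdsWithin_iff.2 ⟨hs0.prodMk_nhds hy0, Eventually.of_forall
      fun i => ⟨hs _, mem_univ _⟩⟩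
  have e1 := hl1.eventually (hV (0, x₀) hmem (V 0 x₀ + θ / 2) (by simp; linarith))
  have e2 := hl2.eventually (hW (0, x₀) hmem (W 0 x₀ - θ / 2) (by simp; linarith))
  obtain ⟨i, h1, h2⟩ := (e1.and e2).exists
  have := hge (φ i)
  simp only at h1 h2
  linarith [h0 x₀]

/-- The parabolic form of the theorem on sums: the jets are those of quadratic test functions. -/
lemma parabolic_theorem_on_sums {T : ℝ} (hT : 0 < T) {V W : ℝ → Vec d → ℝ}
    (hV : UpperSemicontinuousOn (fun z : ℝ × Vec d => V z.1 z.2) (Icc 0 T ×ˢ univ))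
    (hW : LowerSemicontinuousOn (fun z : ℝ × Vec d => W z.1 z.2) (Icc 0 T ×ˢ univ))
    {M : ℝ} (hVM : ∀ t ∈ Icc 0 T, ∀ x, V t x ≤ M) (hWM : ∀ t ∈ Icc 0 T, ∀ x, -M ≤ W t x)
    {δ κ ω c : ℝ} (hδ : 0 < δ) (hκ : 0 < κ) (hω : 0 < ω) (hcpos : 0 < c) (hcsq : c ^ 2 = κ / δ)
    {ρ : ℝ} (hρ : 0 < ρ) :
    ∃ t ∈ Icc 0 T, ∃ s ∈ Icc 0 T, ∃ (x y : Vec d) (a₁ a₂ : ℝ) (p q : Vec d)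
      (X Y : Vec d →L[ℝ] Vec d),
      (∀ t' ∈ Icc 0 T, ∀ s' ∈ Icc 0 T, ∀ x' y',
        V t' x' - W s' y' - ‖x' - y'‖ ^ 2 / (6 * δ) - (t' - s') ^ 2 / (6 * κ)
          ≤ V t x - W s y - ‖x - y‖ ^ 2 / (6 * δ) - (t - s) ^ 2 / (6 * κ) + ρ) ∧
      ‖p - (1 / (3 * δ)) • (x - y)‖ ≤ ρ ∧ ‖q - (1 / (3 * δ)) • (x - y)‖ ≤ ρ ∧
      |a₁ - a₂| ≤ 2 * ρ / c ∧
      (∀ u v, ⟪X u, v⟫ = ⟪u, X v⟫) ∧ (∀ u v, ⟪Y u, v⟫ = ⟪u, Y v⟫) ∧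
      (∀ ξ ξ', ⟪X ξ, ξ⟫ - ⟪Y ξ', ξ'⟫
        ≤ ‖ξ - ξ'‖ ^ 2 / δ + (ρ + 5 * ω) * (‖ξ‖ ^ 2 + ‖ξ'‖ ^ 2)) ∧
      (∃ κ, ∃ r > 0, ∀ t' ∈ Icc 0 T, ∀ x', |t' - t| < r → ‖x' - x‖ < r →
        V t' x' ≤ V t x + quadForm t x a₁ κ p X t' x') ∧
      (∃ κ, ∃ r > 0, ∀ s' ∈ Icc 0 T, ∀ y', |s' - s| < r → ‖y' - y‖ < r →
        W s y + quadForm s y a₂ κ q Y s' y' + ω * ((s' - s) ^ 2 + ‖y' - y‖ ^ 2) ≤ W s' y') := by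
  set D : Set (SpaceTime d) := {z | c * z.fst ∈ Icc 0 T} with hD
  have hfst : Continuous fun z : SpaceTime d => z.fst := ((ContinuousLinearMap.fst ℝ ℝ (Vec d)).comp
    (WithLp.prodContinuousLinearEquiv 2 ℝ ℝ (Vec d)).toContinuousLinearMap).continuous
  have hsnd : Continuous fun z : SpaceTime d => z.snd := (spaceProj d).continuous
  have hDc : IsClosed D := isClosed_Icc.preimage (continuous_const.mul hfst)
  have hDne : D.Nonempty := ⟨0, by simp [hD, hT.le]⟩
  have hmap : Continuous fun z : SpaceTime d => (c * z.fst, z.snd) :=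
    (continuous_const.mul hfst).prodMk hsnd
  have hmaps : MapsTo (fun z : SpaceTime d => (c * z.fst, z.snd)) D (Icc 0 T ×ˢ univ) :=
    fun z hz => ⟨hz, mem_univ _⟩
  have hV' : UpperSemicontinuousOn (fun z : SpaceTime d => V (c * z.fst) z.snd) D :=
    hV.comp hmap.continuousOn hmaps
  have hW' : LowerSemicontinuousOn (fun z : SpaceTime d => W (c * z.fst) z.snd) D :=
    hW.comp hmap.continuousOn hmaps
  obtain ⟨z, hz, z', hz', P, Q, X, Y, hmax, hP, hQ, hX, hY, hXY, hVexp, hWexp⟩ :=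
    theorem_on_sums hDc hDne hV' hW' (M := 2 * M)
      (fun z hz z' hz' => by linarith [hVM _ hz z.snd, hWM _ hz' z'.snd]) hδ hρ
  have hval : ∀ z z' : SpaceTime d, ‖z - z'‖ ^ 2 / (6 * δ)
      = ‖z.snd - z'.snd‖ ^ 2 / (6 * δ) + (c * z.fst - c * z'.fst) ^ 2 / (6 * κ) := by
    intro z z'
    rw [SpaceTime.norm_sq_eq, WithLp.sub_fst, WithLp.sub_snd]
    have : (c * z.fst - c * z'.fst) ^ 2 = κ / δ * (z.fst - z'.fst) ^ 2 := by
      rw [← hcsq]; ring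
    rw [this]; field_simp; ring
  have hmax' : ∀ t' ∈ Icc 0 T, ∀ s' ∈ Icc 0 T, ∀ x' y',
      V t' x' - W s' y' - ‖x' - y'‖ ^ 2 / (6 * δ) - (t' - s') ^ 2 / (6 * κ)
        ≤ V (c * z.fst) z.snd - W (c * z'.fst) z'.snd - ‖z.snd - z'.snd‖ ^ 2 / (6 * δ)
          - (c * z.fst - c * z'.fst) ^ 2 / (6 * κ) + ρ := by
    intro t' ht' s' hs' x' y'
    have e1 : c * (WithLp.toLp 2 (t' / c, x') : SpaceTime d).fst = t' := by
      change c * (t' / c) = t'; field_simp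
    have e2 : c * (WithLp.toLp 2 (s' / c, y') : SpaceTime d).fst = s' := by
      change c * (s' / c) = s'; field_simp
    have := hmax (WithLp.toLp 2 (t' / c, x')) (by rw [hD, mem_ofPred_eq, e1]; exact ht')
      (WithLp.toLp 2 (s' / c, y')) (by rw [hD, mem_ofPred_eq, e2]; exact hs')
    rw [hval, hval, e1, e2] at this
    change V t' x' - W s' y' - (‖x' - y'‖ ^ 2 / (6 * δ) + (t' - s') ^ 2 / (6 * κ)) ≤
      V (c * z.fst) z.snd - W (c * z'.fst) z'.snd - (‖z.snd - z'.snd‖ ^ 2 / (6 * δ)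
        + (c * z.fst - c * z'.fst) ^ 2 / (6 * κ)) + ρ at this
    linarith
  have hPs : ‖P.snd - (1 / (3 * δ)) • (z.snd - z'.snd)‖ ≤ ρ := by
    have := SpaceTime.norm_sq_eq (P - (1 / (3 * δ)) • (z - z'))
    refine ((sq_le_sq₀ (norm_nonneg _) (norm_nonneg _)).1 ?_).trans hP
    rw [this, WithLp.sub_snd, WithLp.smul_snd, WithLp.sub_snd]
    exact le_add_of_nonneg_left (sq_nonneg _)
  have hQs : ‖Q.snd - (1 / (3 * δ)) • (z.snd - z'.snd)‖ ≤ ρ := by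
    have := SpaceTime.norm_sq_eq (Q - (1 / (3 * δ)) • (z - z'))
    refine ((sq_le_sq₀ (norm_nonneg _) (norm_nonneg _)).1 ?_).trans hQ
    rw [this, WithLp.sub_snd, WithLp.smul_snd, WithLp.sub_snd]
    exact le_add_of_nonneg_left (sq_nonneg _)
  have hPQ : ‖P - Q‖ ≤ 2 * ρ := by
    have : P - Q = (P - (1 / (3 * δ)) • (z - z')) - (Q - (1 / (3 * δ)) • (z - z')) := by abel
    rw [this]
    exact (norm_sub_le _ _).trans (by linarith)
  obtain ⟨κ₁, r₁, hr₁, hq₁⟩ := exists_quadForm_of_expansion hcpos hX (T := T) (V := V) (z := z)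
    (P := P) hVexp hω
  obtain ⟨κ₂, r₂, hr₂, hq₂⟩ := exists_quadForm_of_expansion hcpos (X := -Y)
    (fun u v => by simp [hY u v]) (T := T) (V := fun t x => -W t x) (z := z')
    (P := -Q) (fun ω hω => by
      obtain ⟨r, hr, h⟩ := hWexp ω hω
      refine ⟨r, hr, fun y' hy' hy'' => ?_⟩
      have := h y' hy' hy''
      simp only [inner_neg_left, _root_.neg_apply]
      linarith) hω
  have hidX : ∀ ξ : Vec d, ∀ X : SpaceTime d →L[ℝ] SpaceTime d, ∀ a : ℝ,
      ⟪(spaceBlock X + a • ContinuousLinearMap.id ℝ (Vec d)) ξ, ξ⟫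
        = ⟪X (spaceIncl d ξ), spaceIncl d ξ⟫ + a * ‖ξ‖ ^ 2 := by
    intro ξ X a
    rw [_root_.add_apply, inner_add_left, inner_spaceBlock, _root_.smul_apply,
      ContinuousLinearMap.id_apply, real_inner_smul_left, real_inner_self_eq_norm_sq]
  have hsym : ∀ X : SpaceTime d →L[ℝ] SpaceTime d, (∀ u v, ⟪X u, v⟫ = ⟪u, X v⟫) → ∀ a : ℝ,
      ∀ u v, ⟪(spaceBlock X + a • ContinuousLinearMap.id ℝ (Vec d)) u, v⟫
        = ⟪u, (spaceBlock X + a • ContinuousLinearMap.id ℝ (Vec d)) v⟫ := by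
    intro X hX a u v
    simp only [_root_.add_apply, inner_add_left, inner_add_right, _root_.smul_apply,
      ContinuousLinearMap.id_apply, real_inner_smul_left, real_inner_smul_right]
    rw [inner_spaceBlock, real_inner_comm (spaceBlock X v) u, inner_spaceBlock, hX,
      real_inner_comm (X (spaceIncl d v))]
  refine ⟨c * z.fst, hz, c * z'.fst, hz', z.snd, z'.snd, P.fst / c, Q.fst / c, P.snd, Q.snd,
    spaceBlock X + (5 * ω) • ContinuousLinearMap.id ℝ (Vec d),
    spaceBlock Y + (-(5 * ω)) • ContinuousLinearMap.id ℝ (Vec d), hmax', hPs, hQs, ?_,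
    hsym X hX _, hsym Y hY _, ?_, ⟨κ₁, r₁, hr₁, ?_⟩, ⟨-κ₂, r₂, hr₂, ?_⟩⟩
  · rw [← sub_div, abs_div, abs_of_pos hcpos]
    refine div_le_div_of_nonneg_right ?_ hcpos.le
    have : |P.fst - Q.fst| ≤ 2 * ρ := by
      refine le_trans (abs_le_of_sq_le_sq ?_ (norm_nonneg _)) hPQ
      rw [SpaceTime.norm_sq_eq, WithLp.sub_fst]
      exact le_add_of_nonneg_right (sq_nonneg _)
    exact this
  · intro ξ ξ'
    rw [hidX, hidX]
    have := hXY (spaceIncl d ξ) (spaceIncl d ξ')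
    rw [← map_sub, norm_spaceIncl, norm_spaceIncl, norm_spaceIncl] at this
    nlinarith [sq_nonneg ‖ξ‖, sq_nonneg ‖ξ'‖]
  · intro t' ht' x' h1 h2
    have := hq₁ t' ht' x' h1 h2
    have e : 0 ≤ ω * ((t' - c * z.fst) ^ 2 + ‖x' - z.snd‖ ^ 2) := by positivity
    linarith
  · intro s' hs' y' h1 h2
    have := hq₂ s' hs' y' h1 h2
    have e : quadForm (c * z'.fst) z'.snd (Q.fst / c) (-κ₂) Q.snd
        (spaceBlock Y + (-(5 * (ω))) • ContinuousLinearMap.id ℝ (Vec d)) s' y'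
        = -quadForm (c * z'.fst) z'.snd ((-Q).fst / c) κ₂ (-Q).snd
          (spaceBlock (-Y) + (5 * (ω)) • ContinuousLinearMap.id ℝ (Vec d)) s' y' := by
      have e1 : spaceBlock (-Y) = -spaceBlock Y := by ext v; simp [spaceBlock]
      rw [e1]
      simp only [quadForm, WithLp.neg_fst, WithLp.neg_snd, _root_.add_apply, _root_.neg_apply,
        inner_add_left, inner_neg_left, _root_.smul_apply, ContinuousLinearMap.id_apply,
        real_inner_smul_left]
      ring
    rw [e]
    linarith

set_option maxHeartbeats 1000000 in
/-- Doubling of the variables: almost maximum points, with second order test functions. -/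
lemma exists_doubling_points {T : ℝ} (hT : 0 < T) {V W : ℝ → Vec d → ℝ}
    (hV : UpperSemicontinuousOn (fun z : ℝ × Vec d => V z.1 z.2) (Icc 0 T ×ˢ univ))
    (hW : LowerSemicontinuousOn (fun z : ℝ × Vec d => W z.1 z.2) (Icc 0 T ×ˢ univ))
    {M R θ : ℝ} (hθ : 0 < θ) (hVM : ∀ t ∈ Icc 0 T, ∀ x, V t x ≤ M)
    (hWM : ∀ t ∈ Icc 0 T, ∀ x, -M ≤ W t x)
    (hVR : ∀ t ∈ Icc 0 T, ∀ x, R < ‖x‖ → V t x ≤ -M) (h0 : ∀ x, V 0 x ≤ W 0 x)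
    (hex : ∃ t ∈ Icc 0 T, ∃ x, θ ≤ V t x - W t x) {τ : ℝ} (hτ : 0 < τ) {h : ℝ → ℝ}
    (hh : ∀ δ > 0, 0 < h δ) :
    ∃ δ > 0, ∃ t ∈ Ioc 0 T, ∃ s ∈ Ioc 0 T, ∃ (x y : Vec d) (a₁ a₂ : ℝ) (p q : Vec d)
      (X Y : Vec d →L[ℝ] Vec d), θ / 2 ≤ V t x - W s y ∧ ‖x - y‖ ≤ τ ∧ ‖x - y‖ ^ 2 / δ ≤ τ ∧
      |t - s| ≤ h δ ∧ |t - s| ≤ τ ∧ ‖x - y‖ * ‖p‖ ≤ τ ∧ ‖x - y‖ * ‖q‖ ≤ τ ∧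
      ‖q‖ ≤ τ / δ + τ ∧ ‖p - q‖ ≤ τ ∧ |a₁ - a₂| ≤ τ ∧
      (∀ u v, ⟪X u, v⟫ = ⟪u, X v⟫) ∧ (∀ u v, ⟪Y u, v⟫ = ⟪u, Y v⟫) ∧
      (∀ ξ ξ', ⟪X ξ, ξ⟫ - ⟪Y ξ', ξ'⟫ ≤ ‖ξ - ξ'‖ ^ 2 / δ + τ * (‖ξ‖ ^ 2 + ‖ξ'‖ ^ 2)) ∧
      (∀ x' y', V t x' - W s y' - ‖x' - y'‖ ^ 2 / (6 * δ)
        ≤ V t x - W s y - ‖x - y‖ ^ 2 / (6 * δ) + τ) ∧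
      (∃ κ, ∃ r > 0, ∀ t' ∈ Icc 0 T, ∀ x', |t' - t| < r → ‖x' - x‖ < r →
        V t' x' ≤ V t x + quadForm t x a₁ κ p X t' x') ∧
      (∃ κ, ∃ ω > 0, ∃ r > 0, ∀ s' ∈ Icc 0 T, ∀ y', |s' - s| < r → ‖y' - y‖ < r →
        W s y + quadForm s y a₂ κ q Y s' y' + ω * ((s' - s) ^ 2 + ‖y' - y‖ ^ 2) ≤ W s' y') := by
  obtain ⟨η, hη, hlayer⟩ := exists_initial_layer hT hV hW (half_pos hθ) hWM hVR h0
  obtain ⟨td, htd, xd, hxd⟩ := hex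
  have hM0 : 0 < M := by linarith [hVM td htd xd, hWM td htd xd]
  set τ₀ := min τ (min 1 η) with hτ₀
  have hτ₀pos : 0 < τ₀ := lt_min hτ (lt_min one_pos hη)
  have hτ₀τ : τ₀ ≤ τ := min_le_left _ _
  have hτ₀1 : τ₀ ≤ 1 := (min_le_right _ _).trans (min_le_left _ _)
  have hτ₀η : τ₀ ≤ η := (min_le_right _ _).trans (min_le_right _ _)
  set B : ℝ → ℝ → Set ℝ := fun δ κ => {v | ∃ t ∈ Icc 0 T, ∃ s ∈ Icc 0 T, ∃ x y : Vec d,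
    v = V t x - W s y - ‖x - y‖ ^ 2 / (6 * δ) - (t - s) ^ 2 / (6 * κ)} with hB
  have hBle : ∀ δ > 0, ∀ κ > 0, ∀ v ∈ B δ κ, v ≤ 2 * M := by
    rintro δ hδ κ hκ v ⟨t, ht, s, hs, x, y, rfl⟩
    have e1 : 0 ≤ ‖x - y‖ ^ 2 / (6 * δ) := by positivity
    have e2 : 0 ≤ (t - s) ^ 2 / (6 * κ) := by positivity
    linarith [hVM t ht x, hWM s hs y]
  have hBbdd : ∀ δ > 0, ∀ κ > 0, BddAbove (B δ κ) := fun δ hδ κ hκ => ⟨_, hBle δ hδ κ hκ⟩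
  have hBne : ∀ δ κ, V td xd - W td xd ∈ B δ κ := fun δ κ =>
    ⟨td, htd, td, htd, xd, xd, by simp⟩
  have hSlo : ∀ δ > 0, ∀ κ > 0, θ ≤ sSup (B δ κ) := fun δ hδ κ hκ =>
    hxd.trans (le_csSup (hBbdd δ hδ κ hκ) (hBne δ κ))
  have hShi : ∀ δ > 0, ∀ κ > 0, sSup (B δ κ) ≤ 2 * M := fun δ hδ κ hκ =>
    csSup_le ⟨_, hBne δ κ⟩ (hBle δ hδ κ hκ)
  obtain ⟨δ, hδ, hδ1, κ, hκ, hκk, hinc⟩ := exists_small_increment (S := fun δ κ => sSup (B δ κ))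
    hSlo hShi (τ := τ₀ ^ 2 / 48) (by positivity)
    (k := fun δ => min (h δ) τ₀ ^ 2 / (12 * (M + 1)))
    (fun δ hδ => by have := lt_min (hh δ hδ) hτ₀pos; positivity)
  set c := Real.sqrt (κ / δ) with hc
  have hcpos : 0 < c := Real.sqrt_pos.2 (div_pos hκ hδ)
  have hcsq : c ^ 2 = κ / δ := Real.sq_sqrt (div_pos hκ hδ).le
  obtain ⟨ρ, hρ, hρ1, hρ2, hρ3, hρ4⟩ : ∃ ρ > 0, ρ ≤ τ₀ ^ 2 / 48 ∧ ρ ≤ τ * c / 4 ∧ ρ ≤ τ / 4 ∧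
      ρ ≤ θ / 2 := by
    refine ⟨min (min (τ₀ ^ 2 / 48) (τ * c / 4)) (min (τ / 4) (θ / 2)), by positivity, ?_, ?_, ?_, ?_⟩
    · exact (min_le_left _ _).trans (min_le_left _ _)
    · exact (min_le_left _ _).trans (min_le_right _ _)
    · exact (min_le_right _ _).trans (min_le_left _ _)
    · exact (min_le_right _ _).trans (min_le_right _ _)
  obtain ⟨t, hz, s, hz', x, y, a₁, a₂, p, q, X, Y, hmax', hPs, hQs, ha, hX, hY, hXY, hq₁, hq₂⟩ :=
    parabolic_theorem_on_sums hT hV hW hVM hWM hδ hκ (ω := τ / 20) (by positivity) hcpos hcsq hρ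
  have hn1 : 0 ≤ ‖x - y‖ ^ 2 / (6 * δ) := by positivity
  have hn2 : 0 ≤ (t - s) ^ 2 / (6 * κ) := by positivity
  have hSle : sSup (B δ κ) ≤ V t x - W s y - ‖x - y‖ ^ 2 / (6 * δ) - (t - s) ^ 2 / (6 * κ) + ρ := by
    refine csSup_le ⟨_, hBne δ κ⟩ ?_
    rintro v ⟨t', ht', s', hs', x', y', rfl⟩
    exact hmax' t' ht' s' hs' x' y'
  have hSge : V t x - W s y - ‖x - y‖ ^ 2 / (6 * (2 * δ)) - (t - s) ^ 2 / (6 * κ)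
      ≤ sSup (B (2 * δ) κ) :=
    le_csSup (hBbdd _ (by positivity) κ hκ) ⟨t, hz, s, hz', x, y, rfl⟩
  have hθle := hSlo δ hδ κ hκ
  have hVW : θ / 2 ≤ V t x - W s y := by linarith
  have hxyδ : ‖x - y‖ ^ 2 / δ ≤ τ₀ ^ 2 / 2 := by
    have e1 : ‖x - y‖ ^ 2 / (6 * δ) = ‖x - y‖ ^ 2 / δ / 6 := by field_simp
    have e2 : ‖x - y‖ ^ 2 / (6 * (2 * δ)) = ‖x - y‖ ^ 2 / δ / 12 := by field_simp; ring
    rw [e1] at hSle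
    rw [e2] at hSge
    linarith
  have hxysq : ‖x - y‖ ^ 2 ≤ τ₀ ^ 2 / 2 := by
    rw [div_le_iff₀ hδ] at hxyδ
    nlinarith
  have hxy : ‖x - y‖ ≤ τ₀ := by
    refine (sq_le_sq₀ (norm_nonneg _) hτ₀pos.le).1 ?_
    nlinarith
  have hts : |t - s| ≤ min (h δ) τ₀ := by
    have hm := lt_min (hh δ hδ) hτ₀pos
    refine abs_le_of_sq_le_sq ?_ hm.le
    have e1 : (t - s) ^ 2 / (6 * κ) ≤ 2 * M := by linarith [hVM t hz x, hWM s hz' y]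
    rw [div_le_iff₀ (by positivity)] at e1
    rw [le_div_iff₀ (by positivity)] at hκk
    nlinarith
  have hnorm : ∀ p : Vec d, ‖p - (1 / (3 * δ)) • (x - y)‖ ≤ ρ →
      ‖p‖ ≤ ‖x - y‖ / (3 * δ) + ρ := by
    intro p hp
    have e1 : ‖(1 / (3 * δ)) • (x - y)‖ = ‖x - y‖ / (3 * δ) := by
      rw [norm_smul, Real.norm_of_nonneg (by positivity)]; ring
    have := norm_sub_norm_le p ((1 / (3 * δ)) • (x - y))
    linarith
  have hmulp : ∀ p : Vec d, ‖p - (1 / (3 * δ)) • (x - y)‖ ≤ ρ → ‖x - y‖ * ‖p‖ ≤ τ := by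
    intro p hp
    have e1 : ‖x - y‖ * (‖x - y‖ / (3 * δ)) = ‖x - y‖ ^ 2 / δ / 3 := by field_simp
    calc ‖x - y‖ * ‖p‖ ≤ ‖x - y‖ * (‖x - y‖ / (3 * δ) + ρ) :=
          mul_le_mul_of_nonneg_left (hnorm p hp) (norm_nonneg _)
      _ = ‖x - y‖ ^ 2 / δ / 3 + ‖x - y‖ * ρ := by rw [mul_add, e1]
      _ ≤ τ₀ ^ 2 / 2 / 3 + 1 * (τ / 4) := by
          gcongr
          exact hxy.trans hτ₀1
      _ ≤ τ := by nlinarith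
  have htpos : t ≠ 0 ∧ s ≠ 0 := by
    by_contra hcon
    have : t = 0 ∨ s = 0 := by tauto
    linarith [hlayer t hz s hz' x y ((hts.trans (min_le_right _ _)).trans hτ₀η)
      (hxy.trans hτ₀η) this]
  refine ⟨δ, hδ, t, ⟨lt_of_le_of_ne hz.1 (Ne.symm htpos.1), hz.2⟩, s,
    ⟨lt_of_le_of_ne hz'.1 (Ne.symm htpos.2), hz'.2⟩, x, y, a₁, a₂, p, q, X, Y, hVW,
    hxy.trans hτ₀τ, hxyδ.trans (by nlinarith), hts.trans (min_le_left _ _),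
    (hts.trans (min_le_right _ _)).trans hτ₀τ, hmulp _ hPs, hmulp _ hQs, ?_, ?_, ?_,
    hX, hY, ?_, ?_, hq₁, ?_⟩
  · refine (hnorm _ hQs).trans (add_le_add ?_ (by linarith))
    gcongr
    · exact hxy.trans hτ₀τ
    · linarith
  · have : p - q = (p - (1 / (3 * δ)) • (x - y)) - (q - (1 / (3 * δ)) • (x - y)) := by
      abel
    rw [this]
    exact (norm_sub_le _ _).trans (by linarith)
  · refine ha.trans ?_
    rw [div_le_iff₀ hcpos]
    linarith [mul_pos hτ hcpos]
  · intro ξ ξ'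
    refine (hXY ξ ξ').trans ?_
    gcongr
    linarith
  · intro x' y'
    have := hmax' t hz s hz' x' y'
    linarith
  · obtain ⟨κ', r', hr', h'⟩ := hq₂
    exact ⟨κ', τ / 20, by positivity, r', hr', h'⟩

namespace Coef

variable {ι : Type} (𝒞 : Coef n d ι)

lemma norm_St_le (j : ι) (x p : Vec d) : ‖𝒞.St j x p‖ ≤ d * (𝒞.L * (1 + ‖x‖) * ‖p‖) := by
  have h := 𝒞.norm_St_sub_le j x x p 0 (E := 𝒞.L * (1 + ‖x‖) * ‖p‖) fun k => by
    rw [inner_zero_right, sub_zero]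
    exact (abs_real_inner_le_norm _ _).trans
      (mul_le_mul_of_nonneg_right (𝒞.hs0 j x k) (norm_nonneg _))
  have e : 𝒞.St j x 0 = 0 := by ext k; simp [St]
  rwa [e, sub_zero] at h

lemma abs_Bw_le {w : Vec d → ℝ} {M : ℝ} (hM : ∀ x, |w x| ≤ M) (j : ι) (x : Vec d) :
    |𝒞.Bw j w x| ≤ 𝒞.L * (2 * M * 𝒞.L) := by
  have := 𝒞.hμ
  have hM0 : 0 ≤ M := (abs_nonneg _).trans (hM x)
  have h := norm_integral_le_of_norm_le_const (μ := 𝒞.μ) (C := 2 * M * 𝒞.L)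
    (f := fun e => (w (x + 𝒞.η j x e) - w x) * 𝒞.γ x e) (Eventually.of_forall fun e => by
      rw [Real.norm_eq_abs, abs_mul, abs_of_nonneg (𝒞.hγ0 x e)]
      exact mul_le_mul (abs_jump_le hM _ _) (𝒞.hγ1 x e) (𝒞.hγ0 x e) (by positivity))
  refine h.trans ?_
  rw [mul_comm]
  exact mul_le_mul_of_nonneg_right 𝒞.hμL (mul_nonneg (by positivity) 𝒞.L_pos.le)

lemma continuousOn_f (j : ι) :
    ContinuousOn (fun z : ℝ × Vec d × ℝ × Vec d × ℝ => 𝒞.f j z.1 z.2.1 z.2.2.1 z.2.2.2.1 z.2.2.2.2)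
      (Icc 0 𝒞.T ×ˢ univ) := by
  rintro ⟨t₀, x₀, u₀, p₀, k₀⟩ h₀
  set R := ‖x₀‖ + |u₀| + 1 with hR
  obtain ⟨m, hm, hm0, hmR⟩ := 𝒞.hf_x j R (by positivity)
  rw [ContinuousWithinAt, tendsto_iff_dist_tendsto_zero]
  set G : ℝ × Vec d × ℝ × Vec d × ℝ → ℝ := fun z =>
    m (‖z.2.1 - x₀‖ * (1 + ‖z.2.2.2.1‖))
      + 𝒞.L * (|z.2.2.1 - u₀| + ‖z.2.2.2.1 - p₀‖ + |z.2.2.2.2 - k₀|)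
      + |𝒞.f j z.1 x₀ u₀ p₀ k₀ - 𝒞.f j t₀ x₀ u₀ p₀ k₀| with hG
  have hft := 𝒞.hf_t j x₀ u₀ p₀ k₀
  have hGc : Continuous G := by
    have h1 : Continuous fun z : ℝ × Vec d × ℝ × Vec d × ℝ => 𝒞.f j z.1 x₀ u₀ p₀ k₀ :=
      hft.comp continuous_fst
    have h2 : Continuous fun z : ℝ × Vec d × ℝ × Vec d × ℝ =>
        m (‖z.2.1 - x₀‖ * (1 + ‖z.2.2.2.1‖)) := hm.comp (by fun_prop)
    simp only [hG]
    fun_prop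
  have hG0 : Tendsto G (𝓝[Icc 0 𝒞.T ×ˢ univ] (t₀, x₀, u₀, p₀, k₀)) (𝓝 0) := by
    have := hGc.continuousAt (x := (t₀, x₀, u₀, p₀, k₀))
    have e : G (t₀, x₀, u₀, p₀, k₀) = 0 := by simp [hG, hm0]
    rw [ContinuousAt, e] at this
    exact this.mono_left nhdsWithin_le_nhds
  have hc1 : Continuous fun z : ℝ × Vec d × ℝ × Vec d × ℝ => ‖z.2.1‖ := by fun_prop
  have hc2 : Continuous fun z : ℝ × Vec d × ℝ × Vec d × ℝ => |z.2.2.1| := by fun_prop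
  have hx : ∀ᶠ z : ℝ × Vec d × ℝ × Vec d × ℝ in 𝓝[Icc 0 𝒞.T ×ˢ univ] (t₀, x₀, u₀, p₀, k₀),
      ‖z.2.1‖ < R := (nhdsWithin_le_nhds : _ ≤ 𝓝 (t₀, x₀, u₀, p₀, k₀))
    (hc1.continuousAt.eventually_lt_const (by simp only [hR]; linarith [abs_nonneg u₀]))
  have hu : ∀ᶠ z : ℝ × Vec d × ℝ × Vec d × ℝ in 𝓝[Icc 0 𝒞.T ×ˢ univ] (t₀, x₀, u₀, p₀, k₀),
      |z.2.2.1| < R := (nhdsWithin_le_nhds : _ ≤ 𝓝 (t₀, x₀, u₀, p₀, k₀))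
    (hc2.continuousAt.eventually_lt_const (by simp only [hR]; linarith [norm_nonneg x₀]))
  refine tendsto_of_tendsto_of_tendsto_of_le_of_le' tendsto_const_nhds hG0
    (Eventually.of_forall fun _ => dist_nonneg) ?_
  filter_upwards [hx, hu, self_mem_nhdsWithin] with z hx hu hz
  obtain ⟨t, x, u, p, k⟩ := z
  have ht : t ∈ Icc 0 𝒞.T := hz.1
  have h1 := hmR t ht x x₀ u p k hx.le (by simp only [hR]; linarith [abs_nonneg u₀]) hu.le
  have h2 := 𝒞.hf_lip j t ht x₀ u u₀ p p₀ k k₀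
  rw [Real.dist_eq]
  simp only [hG]
  have := abs_sub_le (𝒞.f j t x u p k) (𝒞.f j t x₀ u p k) (𝒞.f j t₀ x₀ u₀ p₀ k₀)
  have := abs_sub_le (𝒞.f j t x₀ u p k) (𝒞.f j t x₀ u₀ p₀ k₀) (𝒞.f j t₀ x₀ u₀ p₀ k₀)
  linarith

lemma exists_time_modulus [Finite ι] (K : ℝ) {c : ℝ} (hc : 0 < c) :
    ∃ h > 0, ∀ j, ∀ t ∈ Icc 0 𝒞.T, ∀ s ∈ Icc 0 𝒞.T, |t - s| ≤ h → ∀ x u p k,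
      ‖x‖ ≤ K → |u| ≤ K → ‖p‖ ≤ K → |k| ≤ K → |𝒞.f j t x u p k - 𝒞.f j s x u p k| ≤ c := by
  have hj : ∀ j, ∀ᶠ h in 𝓝[>] (0 : ℝ), ∀ t ∈ Icc 0 𝒞.T, ∀ s ∈ Icc 0 𝒞.T, |t - s| ≤ h →
      ∀ x u p k, ‖x‖ ≤ K → |u| ≤ K → ‖p‖ ≤ K → |k| ≤ K →
        |𝒞.f j t x u p k - 𝒞.f j s x u p k| ≤ c := by
    intro j
    set S : Set (ℝ × Vec d × ℝ × Vec d × ℝ) := Icc 0 𝒞.T ×ˢ (closedBall 0 K ×ˢ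
      (closedBall 0 K ×ˢ (closedBall 0 K ×ˢ closedBall 0 K))) with hS
    have hSc : IsCompact S := isCompact_Icc.prod ((isCompact_closedBall _ _).prod
      ((isCompact_closedBall _ _).prod ((isCompact_closedBall _ _).prod
        (isCompact_closedBall _ _))))
    have huc := hSc.uniformContinuousOn_of_continuous ((𝒞.continuousOn_f j).mono
      (prod_mono_right (subset_univ _)))
    obtain ⟨ρ, hρ, h⟩ := Metric.uniformContinuousOn_iff.1 huc c hc
    filter_upwards [Ioo_mem_nhdsGT hρ] with h' hh' t ht s hs hts x u p k hx hu hp hk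
    have hm : ∀ t ∈ Icc 0 𝒞.T, (t, x, u, p, k) ∈ S := fun t ht =>
      ⟨ht, by simpa using hx, by simpa using hu, by simpa using hp, by simpa using hk⟩
    have := h _ (hm t ht) _ (hm s hs) (by
      rw [Prod.dist_eq, dist_self, Real.dist_eq]
      exact max_lt (hts.trans_lt hh'.2) hρ)
    rw [Real.dist_eq] at this
    exact this.le
  obtain ⟨h, h1, h2⟩ := ((eventually_all.2 hj).and self_mem_nhdsWithin).exists
  exact ⟨h, h2, h1⟩

/-- Viscosity subsolutions of the obstacle problem with finitely many controls, in terms of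
quadratic test functions touching locally. -/
def IsSub (v : ℝ → Vec d → ℝ) : Prop :=
  ∀ t₀ ∈ Ioc 0 𝒞.T, ∀ x₀ a κ p, ∀ X : Vec d →L[ℝ] Vec d, (∀ u v, ⟪X u, v⟫ = ⟪u, X v⟫) →
    ∀ r > 0, (∀ t ∈ Icc 0 𝒞.T, ∀ x, |t - t₀| < r → ‖x - x₀‖ < r →
      v t x ≤ v t₀ x₀ + quadForm t₀ x₀ a κ p X t x) →
    v t₀ x₀ ≤ 𝒞.ζ t₀ x₀ ∨ ∃ j, 𝒞.Ham j (v t₀ x₀) (v t₀) t₀ x₀ a p X ≤ 0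

/-- Viscosity supersolutions of the obstacle problem, in terms of quadratic test functions
touching locally and strictly. -/
def IsSuper (w : ℝ → Vec d → ℝ) : Prop :=
  (∀ t ∈ Ioc 0 𝒞.T, ∀ x, 𝒞.ζ t x ≤ w t x) ∧
  ∀ t₀ ∈ Ioc 0 𝒞.T, ∀ x₀ a κ p, ∀ X : Vec d →L[ℝ] Vec d, (∀ u v, ⟪X u, v⟫ = ⟪u, X v⟫) →
    ∀ ω > 0, ∀ r > 0, (∀ t ∈ Icc 0 𝒞.T, ∀ x, |t - t₀| < r → ‖x - x₀‖ < r →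
      w t₀ x₀ + quadForm t₀ x₀ a κ p X t x + ω * ((t - t₀) ^ 2 + ‖x - x₀‖ ^ 2) ≤ w t x) →
    ∀ j, 0 ≤ 𝒞.Ham j (w t₀ x₀) (w t₀) t₀ x₀ a p X

/-- Adding back the logarithmic penalization to a quadratic upper bound. -/
lemma le_quadForm_of_sub_log_le {l t₀ a κ t : ℝ} (hl : 0 ≤ l) {x₀ p x : Vec d}
    {X : Vec d →L[ℝ] Vec d} {v : ℝ → Vec d → ℝ}
    (h : v t x - l * Real.log (1 + ‖x‖ ^ 2)
      ≤ v t₀ x₀ - l * Real.log (1 + ‖x₀‖ ^ 2) + quadForm t₀ x₀ a κ p X t x) :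
    v t x ≤ v t₀ x₀ + quadForm t₀ x₀ a κ (p + logCoef l x₀ • x₀)
      (X + logCoef l x₀ • ContinuousLinearMap.id ℝ (Vec d)) t x := by
  have h1 := mul_le_mul_of_nonneg_left (log_one_add_sq_sub_le x₀ x) hl
  have e : quadForm t₀ x₀ a κ (p + logCoef l x₀ • x₀)
      (X + logCoef l x₀ • ContinuousLinearMap.id ℝ (Vec d)) t x
      = quadForm t₀ x₀ a κ p X t x
        + l * ((2 * ⟪x₀, x - x₀⟫ + ‖x - x₀‖ ^ 2) / (1 + ‖x₀‖ ^ 2)) := by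
    simp only [quadForm, _root_.add_apply, _root_.smul_apply, ContinuousLinearMap.id_apply,
      inner_add_left, real_inner_smul_left, real_inner_self_eq_norm_sq, logCoef]
    ring
  rw [e]
  linarith

/-- Comparison principle for the obstacle problem with finitely many controls. -/
theorem comparison [Finite ι] {v w : ℝ → Vec d → ℝ}
    (hv : UpperSemicontinuousOn (fun z : ℝ × Vec d => v z.1 z.2) (Icc 0 𝒞.T ×ˢ univ))
    (hw : LowerSemicontinuousOn (fun z : ℝ × Vec d => w z.1 z.2) (Icc 0 𝒞.T ×ˢ univ))
    (hvm : ∀ t ∈ Icc 0 𝒞.T, Measurable (v t)) (hwm : ∀ t ∈ Icc 0 𝒞.T, Measurable (w t))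
    {M : ℝ} (hvM : ∀ t ∈ Icc 0 𝒞.T, ∀ x, |v t x| ≤ M) (hwM : ∀ t ∈ Icc 0 𝒞.T, ∀ x, |w t x| ≤ M)
    (h0 : ∀ x, v 0 x ≤ w 0 x) (hsub : 𝒞.IsSub v) (hsup : 𝒞.IsSuper w) :
    ∀ t ∈ Icc 0 𝒞.T, ∀ x, v t x ≤ w t x := by
  by_contra! hcon
  obtain ⟨td, htd, xd, hd⟩ := hcon
  obtain ⟨θ, hθ, hdθ⟩ : ∃ θ > 0, v td xd - w td xd = 2 * θ :=
    ⟨(v td xd - w td xd) / 2, by linarith, by ring⟩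
  have hM0 : 0 ≤ M := (abs_nonneg _).trans (hvM td htd xd)
  obtain ⟨L, hLe⟩ : ∃ L, L = 𝒞.L := ⟨_, rfl⟩
  obtain ⟨c, hce⟩ : ∃ c, c = 𝒞.c₀ := ⟨_, rfl⟩
  have hL : 1 ≤ L := hLe ▸ 𝒞.hL
  have hL0 : 0 < L := by linarith
  have hc : 0 < c := hce ▸ 𝒞.hc₀
  obtain ⟨K, hK⟩ : ∃ K : ℝ, K = (d + 1 + 2 * L + L ^ 3 + L * d) * (8 * L ^ 2) := ⟨_, rfl⟩
  have hK0 : 0 < K := by rw [hK]; positivity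
  have hcθ : 0 < c * θ / 16 := by positivity
  have hlogd : 0 ≤ Real.log (1 + ‖xd‖ ^ 2) := Real.log_nonneg (by linarith [sq_nonneg ‖xd‖])
  obtain ⟨l, hl, hl1, hl2⟩ : ∃ l > 0, l * Real.log (1 + ‖xd‖ ^ 2) ≤ θ ∧ K * l ≤ c * θ / 16 := by
    refine ⟨min (θ / (1 + Real.log (1 + ‖xd‖ ^ 2))) (c * θ / 16 / K),
      lt_min (by positivity) (by positivity), ?_, ?_⟩
    · refine (mul_le_mul_of_nonneg_right (min_le_left _ _) hlogd).trans ?_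
      rw [div_mul_eq_mul_div, div_le_iff₀ (by positivity)]
      nlinarith
    · refine (mul_le_mul_of_nonneg_left (min_le_right _ _) hK0.le).trans (le_of_eq ?_)
      field_simp
  obtain ⟨R, hR, hlogR⟩ : ∃ R : ℝ, 0 ≤ R ∧ ∀ x : Vec d, R < ‖x‖ →
      2 * M ≤ l * Real.log (1 + ‖x‖ ^ 2) := by
    refine ⟨Real.sqrt (Real.exp (2 * M / l)), Real.sqrt_nonneg _, fun x hx => ?_⟩
    rw [← div_le_iff₀' hl, Real.le_log_iff_exp_le (by positivity)]
    have := (Real.sqrt_lt' ((Real.sqrt_nonneg _).trans_lt hx)).1 hx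
    linarith
  have hR2 : 0 < 2 + R := by linarith
  choose mR hmRc hmR0 hmR using fun j => 𝒞.hf_x j (R + 1 + M) (by positivity)
  obtain ⟨ρ, hρ, hmρ⟩ : ∃ ρ > 0, ∀ j, ∀ r, 0 ≤ r → r < ρ → mR j r ≤ c * θ / 16 := by
    have hev : ∀ j, ∀ᶠ r in 𝓝 (0 : ℝ), mR j r < c * θ / 16 := fun j =>
      (hmRc j).continuousAt.eventually_lt_const (by rw [hmR0]; exact hcθ)
    obtain ⟨ρ, hρ, h⟩ := Metric.eventually_nhds_iff.1 (eventually_all.2 hev)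
    exact ⟨ρ, hρ, fun j r h0 hr => (h (by simpa [abs_of_nonneg h0] using hr) j).le⟩
  obtain ⟨ρ', hρ', hζρ⟩ : ∃ ρ' > 0, ∀ t ∈ Icc 0 𝒞.T, ∀ s ∈ Icc 0 𝒞.T, ∀ x y : Vec d,
      ‖x‖ ≤ R + 1 → ‖y‖ ≤ R + 1 → |t - s| < ρ' → ‖x - y‖ < ρ' →
      𝒞.ζ t x - 𝒞.ζ s y < θ / 2 := by
    have huc := (isCompact_Icc.prod (isCompact_closedBall (0 : Vec d) (R + 1))
      : IsCompact (Icc 0 𝒞.T ×ˢ closedBall (0 : Vec d) (R + 1))).uniformContinuousOn_of_continuous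
      𝒞.hζ.continuousOn
    obtain ⟨ρ', hρ', h⟩ := Metric.uniformContinuousOn_iff.1 huc (θ / 2) (half_pos hθ)
    refine ⟨ρ', hρ', fun t ht s hs x y hx hy hts hxy => ?_⟩
    have := h (t, x) ⟨ht, by simpa using hx⟩ (s, y) ⟨hs, by simpa using hy⟩ (by
      rw [Prod.dist_eq, Real.dist_eq, dist_eq_norm]
      exact max_lt hts hxy)
    rw [Real.dist_eq] at this
    exact (le_abs_self _).trans_lt this
  have hA : 0 < K * (2 + R) ^ 2 + 2 * M * L ^ 3 + 1 := by positivity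
  have hB : 0 < 1 + d * (L * (2 + R)) := by positivity
  obtain ⟨τ, hτ, hτ1, hτ2, hτ3, hτ4⟩ : ∃ τ > 0, τ ≤ 1 ∧
      (K * (2 + R) ^ 2 + 2 * M * L ^ 3 + 1) * τ ≤ c * θ / 16 ∧
      (1 + d * (L * (2 + R))) * τ < ρ ∧ τ < ρ' := by
    have h2 : Tendsto (fun τ => (K * (2 + R) ^ 2 + 2 * M * L ^ 3 + 1) * τ) (𝓝[>] 0) (𝓝 0) := by
      have : Continuous fun τ => (K * (2 + R) ^ 2 + 2 * M * L ^ 3 + 1) * τ := by fun_prop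
      simpa using (this.tendsto 0).mono_left nhdsWithin_le_nhds
    have h3 : Tendsto (fun τ => (1 + d * (L * (2 + R))) * τ) (𝓝[>] 0) (𝓝 0) := by
      have : Continuous fun τ => (1 + d * (L * (2 + R))) * τ := by fun_prop
      simpa using (this.tendsto 0).mono_left nhdsWithin_le_nhds
    obtain ⟨τ, ⟨⟨a1, a2⟩, a3⟩, a4⟩ := (((h2.eventually_le_const hcθ).and
      (h3.eventually_lt_const hρ)).and (Ioo_mem_nhdsGT (lt_min one_pos hρ'))).and
      self_mem_nhdsWithin |>.exists
    exact ⟨τ, a4, (a3.2.trans_le (min_le_left _ _)).le, a1, a2, a3.2.trans_le (min_le_right _ _)⟩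
  choose h hh hmod using fun δ : ℝ => 𝒞.exists_time_modulus
    (R + 1 + M + d * (L * (2 + R) * (τ / |δ| + τ)) + L * (2 * M * L)) hcθ
  have hvlog : UpperSemicontinuousOn
      (fun z : ℝ × Vec d => v z.1 z.2 - l * Real.log (1 + ‖z.2‖ ^ 2)) (Icc 0 𝒞.T ×ˢ univ) := by
    have hcont : Continuous fun z : ℝ × Vec d => -(l * Real.log (1 + ‖z.2‖ ^ 2)) :=
      (continuous_const.mul (Continuous.log (by fun_prop) fun z => by positivity)).neg
    simpa only [sub_eq_add_neg] using hv.add hcont.continuousOn.upperSemicontinuousOn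
  have hlog0 : ∀ x : Vec d, 0 ≤ l * Real.log (1 + ‖x‖ ^ 2) := fun x =>
    mul_nonneg hl.le (Real.log_nonneg (by linarith [sq_nonneg ‖x‖]))
  have hVR : ∀ t ∈ Icc 0 𝒞.T, ∀ x, R < ‖x‖ → v t x - l * Real.log (1 + ‖x‖ ^ 2) ≤ -M :=
    fun t ht x hx => by linarith [hlogR x hx, (abs_le.1 (hvM t ht x)).2]
  obtain ⟨δ, hδ, t, ht, s, hs, x, y, a₁, a₂, p, q, X, Y, hvw, hxy, hxyδ, htsh, htsτ, hxp, hxq, hq,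
    hpq, ha, hX, hY, hXY, hmax, ⟨κ₁, r₁, hr₁, hup⟩, ⟨κ₂, ω, hω, r₂, hr₂, hlo⟩⟩ :=
    exists_doubling_points 𝒞.hT (V := fun t x => v t x - l * Real.log (1 + ‖x‖ ^ 2)) hvlog hw
      (M := M) (R := R) hθ (fun t ht x => by linarith [hlog0 x, (abs_le.1 (hvM t ht x)).2])
      (fun t ht x => (abs_le.1 (hwM t ht x)).1) hVR (fun x => by linarith [hlog0 x, h0 x])
      ⟨td, htd, xd, by linarith⟩ hτ (fun δ _ => hh δ)
  have ht' : t ∈ Icc 0 𝒞.T := ⟨ht.1.le, ht.2⟩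
  have hs' : s ∈ Icc 0 𝒞.T := ⟨hs.1.le, hs.2⟩
  have hx : ‖x‖ ≤ R := by
    by_contra! hx
    linarith [hVR t ht' x hx, (abs_le.1 (hwM s hs' y)).1]
  have hy : ‖y‖ ≤ R + 1 := by
    have := norm_sub_norm_le y x
    rw [norm_sub_rev] at this
    linarith
  have hvw' : θ / 2 ≤ v t x - w s y := by linarith [hlog0 x]
  rcases hsub t ht x a₁ κ₁ _ _ (fun u v => by
    simp only [_root_.add_apply, inner_add_left, inner_add_right, _root_.smul_apply,
      ContinuousLinearMap.id_apply, real_inner_smul_left, real_inner_smul_right, hX u v])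
    r₁ hr₁ (fun t' ht' x' h1 h2 => le_quadForm_of_sub_log_le hl.le (hup t' ht' x' h1 h2))
    with hobs | ⟨j, hj⟩
  · linarith [hsup.1 s hs y, hζρ t ht' s hs' x y (by linarith) hy (htsτ.trans_lt hτ4)
      (hxy.trans_lt hτ4)]
  · have hj' := hsup.2 s hs y a₂ κ₂ q Y hY ω hω r₂ hr₂ hlo j
    have hmain := 𝒞.doubling_estimate j (hvm t ht') (hwm s hs') (hvM t ht') (hwM s hs') hl.le
      (R := R + 1) (by linarith) hδ ht' (by linarith) (by linarith) hy hxy hxyδ hxp hpq ha hXY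
      hmax hj hj'
    have hSt := 𝒞.norm_St_le j y q
    have hSt1 : ‖𝒞.St j y q‖ ≤ d * (L * (2 + R) * ‖q‖) := by
      rw [← hLe] at hSt
      exact hSt.trans (mul_le_mul_of_nonneg_left (mul_le_mul_of_nonneg_right
        (mul_le_mul_of_nonneg_left (by linarith) hL0.le) (norm_nonneg _)) d.cast_nonneg)
    have hSt2 : ‖𝒞.St j y q‖ ≤ d * (L * (2 + R) * (τ / |δ| + τ)) := by
      rw [abs_of_pos hδ]
      refine hSt1.trans ?_
      gcongr
    have hBw := 𝒞.abs_Bw_le (hwM s hs') j y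
    rw [← hLe] at hBw hmain
    rw [← hce] at hmain
    have hp1 : 0 ≤ d * (L * (2 + R) * (τ / |δ| + τ)) := (norm_nonneg _).trans hSt2
    have hp2 : 0 ≤ L * (2 * M * L) := (abs_nonneg _).trans hBw
    have hwy := hwM s hs' y
    have ht1 := hmod δ j t ht' s hs' htsh y (w s y) (𝒞.St j y q) (𝒞.Bw j (w s) y)
      (by linarith) (by linarith) (by linarith) (by linarith)
    have hx1 := hmR j t ht' x y (w s y) (𝒞.St j y q) (𝒞.Bw j (w s) y)
      (by linarith) (by linarith) (by linarith)
    have hx2 : ‖x - y‖ * (1 + ‖𝒞.St j y q‖) ≤ (1 + d * (L * (2 + R))) * τ :=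
      calc ‖x - y‖ * (1 + ‖𝒞.St j y q‖) ≤ ‖x - y‖ * (1 + d * (L * (2 + R) * ‖q‖)) := by gcongr
        _ = ‖x - y‖ + d * (L * (2 + R)) * (‖x - y‖ * ‖q‖) := by ring
        _ ≤ τ + d * (L * (2 + R)) * τ := by gcongr
        _ = (1 + d * (L * (2 + R))) * τ := by ring
    have hx3 := hmρ j _ (by positivity) (hx2.trans_lt hτ3)
    have e : (d + 1 + 2 * L + L ^ 3 + L * d) * (8 * L ^ 2 * l + 8 * L ^ 2 * (1 + (R + 1)) ^ 2 * τ)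
        = K * l + K * (2 + R) ^ 2 * τ := by rw [hK]; ring
    rw [e] at hmain
    have e1 := (abs_le.1 ht1).2
    have e2 := (abs_le.1 hx1).2
    have e3 : c * (θ / 2) ≤ c * (v t x - w s y) := mul_le_mul_of_nonneg_left hvw' hc.le
    have e4 : c * (θ / 2) = 8 * (c * θ / 16) := by ring
    have e5 : (K * (2 + R) ^ 2 + 2 * M * L ^ 3 + 1) * τ
      = K * (2 + R) ^ 2 * τ + (2 * M * L ^ 3 + 1) * τ := by ring
    linarith

end Coef

/-- The norm `(a, h) ↦ (a² + ∫ h²)^{1/2}` is subadditive. -/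
lemma sqrt_sq_add_integral_sub_le {X : Type*} [MeasurableSpace X] {μ : Measure X} (a a' : ℝ)
    {h h' : X → ℝ} (h1 : Integrable (fun e => h e ^ 2) μ) (h2 : Integrable (fun e => h' e ^ 2) μ)
    (h3 : Integrable (fun e => h e * h' e) μ) :
    √(a ^ 2 + ∫ e, h e ^ 2 ∂μ) - √(a' ^ 2 + ∫ e, h' e ^ 2 ∂μ)
      ≤ √((a - a') ^ 2 + ∫ e, (h e - h' e) ^ 2 ∂μ) := by
  set P := ∫ e, h e ^ 2 ∂μ with hP
  set Q := ∫ e, h' e ^ 2 ∂μ with hQ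
  set B := ∫ e, h e * h' e ∂μ with hB
  have hlin : ∀ s t : ℝ, ∫ e, (s * h e + t * h' e) ^ 2 ∂μ = s ^ 2 * P + 2 * s * t * B + t ^ 2 * Q := by
    intro s t
    have e : (fun e => (s * h e + t * h' e) ^ 2)
        = fun e => s ^ 2 * h e ^ 2 + 2 * s * t * (h e * h' e) + t ^ 2 * h' e ^ 2 := by
      ext e; ring
    have i12 : Integrable (fun e => s ^ 2 * h e ^ 2 + 2 * s * t * (h e * h' e)) μ :=
      (h1.const_mul _).add (h3.const_mul _)
    rw [e, integral_add i12 (h2.const_mul _),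
      integral_add (h1.const_mul _) (h3.const_mul _), integral_const_mul, integral_const_mul,
      integral_const_mul]
  have hS : ∫ e, (h e - h' e) ^ 2 ∂μ = P - 2 * B + Q := by
    have := hlin 1 (-1)
    simp only [one_mul, neg_mul, ← sub_eq_add_neg] at this
    rw [this]; ring
  have hP0 : 0 ≤ P := integral_nonneg fun e => sq_nonneg _
  have hQ0 : 0 ≤ Q := integral_nonneg fun e => sq_nonneg _
  have hCS : (a * a' + B) ^ 2 ≤ (a ^ 2 + P) * (a' ^ 2 + Q) := by
    have hq : ∀ s : ℝ, 0 ≤ (a ^ 2 + P) * (s * s) + (2 * (a * a' + B)) * s + (a' ^ 2 + Q) := by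
      intro s
      have h4 : 0 ≤ ∫ e, (s * h e + 1 * h' e) ^ 2 ∂μ := integral_nonneg fun e => sq_nonneg _
      rw [hlin] at h4
      nlinarith [sq_nonneg (s * a + a')]
    have := discrim_le_zero hq
    unfold discrim at this
    nlinarith
  rw [hS, sub_le_iff_le_add]
  refine Real.sqrt_le_iff.2 ⟨by positivity, ?_⟩
  have hS0 : 0 ≤ (a - a') ^ 2 + (P - 2 * B + Q) := by
    rw [← hS]
    have : 0 ≤ ∫ e, (h e - h' e) ^ 2 ∂μ := integral_nonneg fun e => sq_nonneg _
    positivity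
  set N := √(a' ^ 2 + Q) with hN
  set E := √((a - a') ^ 2 + (P - 2 * B + Q)) with hE
  have hN2 : N ^ 2 = a' ^ 2 + Q := Real.sq_sqrt (by positivity)
  have hE2 : E ^ 2 = (a - a') ^ 2 + (P - 2 * B + Q) := Real.sq_sqrt hS0
  have hkey : (a * a' + B) - N ^ 2 ≤ E * N := by
    have hsq : ((a * a' + B) - N ^ 2) ^ 2 ≤ (E * N) ^ 2 := by
      rw [mul_pow, hE2, hN2]
      nlinarith
    exact (le_abs_self _).trans (abs_le_of_sq_le_sq hsq (by positivity))
  nlinarith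

namespace AssumptionA

variable {ν : Measure (Vec n)} {A : Set (Vec m)} {T : ℝ}
  {b : Vec m → Vec d → Vec d} {σ : Vec m → Vec d → Matrix (Fin d) (Fin d) ℝ}
  {η : Vec m → Vec d → Vec n → Vec d} {γ : Vec d → Vec n → ℝ}
  {f : Vec m → ℝ → Vec d → ℝ → Vec d → ℝ → ℝ}
  {ζ : ℝ → Vec d → ℝ} {g : Vec d → ℝ} {C : ℝ}

/-- The large jumps have finite intensity. -/
lemma isFiniteMeasure_restrict (hA : AssumptionA ν A T b σ η γ f ζ g C) {ε : ℝ}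
    (hε : ε ∈ Ioo (0 : ℝ) 1) : IsFiniteMeasure (ν.restrict {e : Vec n | ε < ‖e‖}) := by
  refine ⟨?_⟩
  rw [Measure.restrict_apply_univ]
  refine lt_of_le_of_lt (measure_mono ?_) (hA.hν_int.measure_norm_ge_lt_top (pow_pos hε.1 2))
  intro e he
  have he' : ε < ‖e‖ := he
  have h1 : ε ^ 2 ≤ ‖e‖ ^ 2 := pow_le_pow_left₀ hε.1.le he'.le 2
  have h2 : ε ^ 2 ≤ 1 := pow_le_one₀ hε.1.le hε.2.le
  rw [mem_ofPred_eq, Real.norm_of_nonneg (le_min zero_le_one (sq_nonneg _))]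
  exact le_min h2 h1

lemma min_one_norm_sq (e : Vec n) : (min 1 ‖e‖) ^ 2 = min 1 (‖e‖ ^ 2) := by
  rcases le_total 1 ‖e‖ with h | h
  · rw [min_eq_left h, min_eq_left (one_le_pow₀ h), one_pow]
  · rw [min_eq_right h, min_eq_right (pow_le_one₀ (norm_nonneg _) h)]

/-- Products of functions which are `O(1 ∧ |e|)` are integrable. -/
lemma integrable_mul (hA : AssumptionA ν A T b σ η γ f ζ g C) {h h' : Vec n → ℝ}
    (hm : Measurable h) (hm' : Measurable h') {K K' : ℝ} (hK : ∀ e, |h e| ≤ K * min 1 ‖e‖)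
    (hK' : ∀ e, |h' e| ≤ K' * min 1 ‖e‖) : Integrable (fun e => h e * h' e) ν := by
  refine (hA.hν_int.const_mul (K * K')).mono' (hm.mul hm').aestronglyMeasurable
    (Eventually.of_forall fun e => ?_)
  rw [Real.norm_eq_abs, abs_mul, ← min_one_norm_sq]
  calc |h e| * |h' e| ≤ (K * min 1 ‖e‖) * (K' * min 1 ‖e‖) :=
        mul_le_mul (hK e) (hK' e) (abs_nonneg _) ((abs_nonneg _).trans (hK e))
    _ = K * K' * (min 1 ‖e‖) ^ 2 := by ring

lemma measurable_coord (hA : AssumptionA ν A T b σ η γ f ζ g C) (α : Vec m) (x : Vec d)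
    (i : Fin d) : Measurable fun e => η α x e i :=
  (EuclideanSpace.proj (𝕜 := ℝ) i).continuous.measurable.comp (hA.hη_meas α x)

lemma abs_coord_le (v : Vec d) (i : Fin d) : |v i| ≤ ‖v‖ := by
  simpa using PiLp.norm_apply_le v i

/-- Lipschitz constant of the entries of the modified diffusion matrix. -/
def sigmaLip (ν : Measure (Vec n)) (C : ℝ) : ℝ := C * (1 + √(∫ e, min 1 (‖e‖ ^ 2) ∂ν))

lemma integral_min_nonneg (ν : Measure (Vec n)) : 0 ≤ ∫ e, min 1 (‖e‖ ^ 2) ∂ν :=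
  integral_nonneg fun _ => le_min zero_le_one (sq_nonneg _)

lemma sigmaTilde_sub_le (hA : AssumptionA ν A T b σ η γ f ζ g C) (ε : ℝ) {α : Vec m} (hα : α ∈ A)
    (x y : Vec d) (i k : Fin d) :
    sigmaTilde ν σ η ε α x i k - sigmaTilde ν σ η ε α y i k ≤ sigmaLip ν C * ‖x - y‖ := by
  have hC := hA.hC
  have hσ : ∀ i k, |σ α x i k - σ α y i k| ≤ C * ‖x - y‖ := by
    intro i k
    have h1 := hA.hb α hα α hα x y
    rw [sub_self α, norm_zero, add_zero] at h1
    have h2 : ‖(σ α x - σ α y) i k‖ ≤ ‖σ α x - σ α y‖ := Matrix.norm_entry_le_entrywise_sup_norm _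
    rw [Matrix.sub_apply, Real.norm_eq_abs] at h2
    linarith [norm_nonneg (b α x - b α y)]
  set I := ∫ e, min 1 (‖e‖ ^ 2) ∂ν with hI
  have hI0 : 0 ≤ I := integral_min_nonneg ν
  have hle : C * ‖x - y‖ ≤ sigmaLip ν C * ‖x - y‖ := by
    unfold sigmaLip
    refine mul_le_mul_of_nonneg_right ?_ (norm_nonneg _)
    exact le_mul_of_one_le_right hC.le (by linarith [Real.sqrt_nonneg I])
  unfold sigmaTilde
  simp only [Matrix.of_apply]
  split_ifs with hik
  swap
  · exact ((le_abs_self _).trans (hσ i k)).trans hle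
  have hb1 : ∀ z e, |η α z e i| ≤ C * min 1 ‖e‖ := fun z e =>
    (abs_coord_le _ _).trans (hA.hη_bdd α hα z e)
  have hb2 : ∀ e, |η α x e i - η α y e i| ≤ C * ‖x - y‖ * min 1 ‖e‖ := by
    intro e
    have h1 := hA.hη_lip α hα α hα x y e
    rw [sub_self α, norm_zero, add_zero] at h1
    refine le_trans ?_ h1
    simpa using abs_coord_le (η α x e - η α y e) i
  have hm := hA.measurable_coord (α := α)
  have hi := fun z => (hA.integrable_mul (hm z i) (hm z i) (hb1 z) (hb1 z)).integrableOn
    (s := {e : Vec n | ‖e‖ < ε})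
  have hi' := (hA.integrable_mul (hm x i) (hm y i) (hb1 x) (hb1 y)).integrableOn
    (s := {e : Vec n | ‖e‖ < ε})
  have hid := (hA.integrable_mul ((hm x i).sub (hm y i)) ((hm x i).sub (hm y i)) hb2 hb2)
  simp only [← sq] at hi
  have h_int : ∫ e in {e : Vec n | ‖e‖ < ε}, (η α x e i - η α y e i) ^ 2 ∂ν
      ≤ (C * ‖x - y‖) ^ 2 * I := by
    have h1 : ∫ e in {e : Vec n | ‖e‖ < ε}, (η α x e i - η α y e i) ^ 2 ∂ν
        ≤ ∫ e, (η α x e i - η α y e i) ^ 2 ∂ν :=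
      setIntegral_le_integral (by simpa only [Pi.sub_apply, ← sq] using hid)
        (Eventually.of_forall fun e => sq_nonneg _)
    refine h1.trans ?_
    rw [hI, ← integral_const_mul]
    refine integral_mono (by simpa only [Pi.sub_apply, ← sq] using hid)
      (hA.hν_int.const_mul _) fun e => ?_
    have h2 := sq_le_sq' (by linarith [neg_abs_le (η α x e i - η α y e i), hb2 e])
      ((le_abs_self _).trans (hb2 e))
    rwa [mul_pow _ (min 1 ‖e‖), min_one_norm_sq] at h2
  refine (sqrt_sq_add_integral_sub_le _ _ (hi x) (hi y) hi').trans ?_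
  refine Real.sqrt_le_iff.2 ⟨by unfold sigmaLip; positivity, ?_⟩
  have h1 := sq_le_sq' (neg_le_of_abs_le (hσ i i)) (le_of_abs_le (hσ i i))
  have h2 : √I ^ 2 = I := Real.sq_sqrt hI0
  have h3 : (sigmaLip ν C * ‖x - y‖) ^ 2
      = (C * ‖x - y‖) ^ 2 + 2 * (C * ‖x - y‖) ^ 2 * √I + (C * ‖x - y‖) ^ 2 * I := by
    unfold sigmaLip
    rw [← hI, ← h2]
    rw [h2]
    nth_rewrite 3 [← h2]
    ring
  have h4 : 0 ≤ 2 * (C * ‖x - y‖) ^ 2 * √I := by positivity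
  linarith

/-- The columns of the modified diffusion matrix. -/
def sigmaCol (ν : Measure (Vec n)) (σ : Vec m → Vec d → Matrix (Fin d) (Fin d) ℝ)
    (η : Vec m → Vec d → Vec n → Vec d) (ε : ℝ) (α : Vec m) (x : Vec d) (k : Fin d) : Vec d :=
  WithLp.toLp 2 fun i => sigmaTilde ν σ η ε α x i k

lemma norm_le_of_abs_le (v : Vec d) {K : ℝ} (hK : ∀ i, |v i| ≤ K) : ‖v‖ ≤ d * K := by
  have h1 : ‖v‖ ≤ ∑ k, |v k| := by
    rw [EuclideanSpace.norm_eq]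
    refine Real.sqrt_le_iff.2 ⟨Finset.sum_nonneg fun _ _ => abs_nonneg _, ?_⟩
    simp only [Real.norm_eq_abs]
    exact Finset.sum_sq_le_sq_sum_of_nonneg fun _ _ => abs_nonneg _
  refine h1.trans ?_
  calc ∑ k, |v k| ≤ ∑ _k : Fin d, K := Finset.sum_le_sum fun k _ => hK k
    _ = d * K := by simp

lemma norm_sigmaCol_sub_le (hA : AssumptionA ν A T b σ η γ f ζ g C) (ε : ℝ) {α : Vec m}
    (hα : α ∈ A) (x y : Vec d) (k : Fin d) :
    ‖sigmaCol ν σ η ε α x k - sigmaCol ν σ η ε α y k‖ ≤ d * sigmaLip ν C * ‖x - y‖ := by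
  rw [mul_assoc]
  refine norm_le_of_abs_le _ fun i => ?_
  change |sigmaTilde ν σ η ε α x i k - sigmaTilde ν σ η ε α y i k| ≤ _
  have h1 := hA.sigmaTilde_sub_le ε hα x y i k
  have h2 := hA.sigmaTilde_sub_le ε hα y x i k
  rw [norm_sub_rev] at h2
  exact abs_le.2 ⟨by linarith, h1⟩

lemma continuous_obstacle (hA : AssumptionA ν A T b σ η γ f ζ g C) :
    Continuous fun z : ℝ × Vec d => ζ z.1 z.2 := by
  rw [continuous_iff_continuousAt]
  rintro ⟨t₀, x₀⟩
  rw [ContinuousAt, tendsto_iff_dist_tendsto_zero]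
  have hc := hA.hζ_t_cont x₀
  have hG : Continuous fun z : ℝ × Vec d => C * ‖z.2 - x₀‖ + |ζ z.1 x₀ - ζ t₀ x₀| := by fun_prop
  refine squeeze_zero (fun _ => dist_nonneg) (g := fun z => C * ‖z.2 - x₀‖ + |ζ z.1 x₀ - ζ t₀ x₀|)
    (fun z => ?_) (by simpa using hG.tendsto (t₀, x₀))
  rw [Real.dist_eq]
  have h1 := hA.hζg_lip z.1 z.2 x₀
  have h2 := abs_sub_le (ζ z.1 z.2) (ζ z.1 x₀) (ζ t₀ x₀)
  linarith [abs_nonneg (g z.2 - g x₀)]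

variable {J : ℕ}

/-- A common bound for the constants of the truncated problem. -/
def coefBound (ν : Measure (Vec n)) (b : Vec m → Vec d → Vec d)
    (σ : Vec m → Vec d → Matrix (Fin d) (Fin d) ℝ) (η : Vec m → Vec d → Vec n → Vec d) (C ε : ℝ)
    (αs : Fin J → Vec m) : ℝ :=
  1 + (ν.restrict {e : Vec n | ε < ‖e‖}).real univ + C + d * sigmaLip ν C
    + ∑ j, ‖b (αs j) 0‖ + ∑ j, ∑ k, ‖sigmaCol ν σ η ε (αs j) 0 k‖

/-- The truncated problem with finitely many controls. -/
def toCoef (hA : AssumptionA ν A T b σ η γ f ζ g C) {ε : ℝ} (hε : ε ∈ Ioo (0 : ℝ) 1)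
    {αs : Fin J → Vec m} (hαs : ∀ j, αs j ∈ A) : Coef n d (Fin J) := by
  have hC := hA.hC
  have h0 : 0 ≤ (ν.restrict {e : Vec n | ε < ‖e‖}).real univ := measureReal_nonneg
  have hSL : 0 ≤ d * sigmaLip ν C := by unfold sigmaLip; positivity
  have hb0 : 0 ≤ ∑ j, ‖b (αs j) 0‖ := Finset.sum_nonneg fun _ _ => norm_nonneg _
  have hs0 : 0 ≤ ∑ j, ∑ k, ‖sigmaCol ν σ η ε (αs j) 0 k‖ :=
    Finset.sum_nonneg fun _ _ => Finset.sum_nonneg fun _ _ => norm_nonneg _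
  have hCL : C ≤ coefBound ν b σ η C ε αs := by unfold coefBound; linarith
  have hSLL : d * sigmaLip ν C ≤ coefBound ν b σ η C ε αs := by unfold coefBound; linarith
  have hm1 : ∀ e : Vec n, min 1 ‖e‖ ≤ 1 := fun e => min_le_left _ _
  have hblip : ∀ j x y, ‖b (αs j) x - b (αs j) y‖ ≤ C * ‖x - y‖ := by
    intro j x y
    have h1 := hA.hb _ (hαs j) _ (hαs j) x y
    rw [sub_self (αs j), norm_zero, add_zero] at h1
    linarith [norm_nonneg (σ (αs j) x - σ (αs j) y)]
  exact
  { T := T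
    μ := ν.restrict {e : Vec n | ε < ‖e‖}
    b := fun j => b (αs j)
    s := fun j => sigmaCol ν σ η ε (αs j)
    η := fun j => η (αs j)
    γ := γ
    f := fun j => f (αs j)
    ζ := ζ
    L := coefBound ν b σ η C ε αs
    c₀ := C
    hT := hA.hT
    hc₀ := hC
    hL := by unfold coefBound; linarith
    hμ := hA.isFiniteMeasure_restrict hε
    hμL := by unfold coefBound; linarith
    hb := fun j x y => (hblip j x y).trans (mul_le_mul_of_nonneg_right hCL (norm_nonneg _))
    hb0 := fun j x => by
      have h1 := hblip j x 0
      have h2 := norm_sub_norm_le (b (αs j) x) (b (αs j) 0)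
      have h3 : ‖b (αs j) 0‖ ≤ ∑ j, ‖b (αs j) 0‖ :=
        Finset.single_le_sum (f := fun j => ‖b (αs j) 0‖) (fun _ _ => norm_nonneg _)
          (Finset.mem_univ j)
      have h4 : C * ‖x‖ ≤ coefBound ν b σ η C ε αs * ‖x‖ :=
        mul_le_mul_of_nonneg_right hCL (norm_nonneg _)
      have h5 : ∑ j, ‖b (αs j) 0‖ ≤ coefBound ν b σ η C ε αs := by unfold coefBound; linarith
      rw [sub_zero] at h1
      linarith
    hs := fun j x y k => (hA.norm_sigmaCol_sub_le ε (hαs j) x y k).trans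
      (mul_le_mul_of_nonneg_right hSLL (norm_nonneg _))
    hs0 := fun j x k => by
      have h1 := hA.norm_sigmaCol_sub_le ε (hαs j) x 0 k
      have h2 := norm_sub_norm_le (sigmaCol ν σ η ε (αs j) x k) (sigmaCol ν σ η ε (αs j) 0 k)
      have h3 : ‖sigmaCol ν σ η ε (αs j) 0 k‖ ≤ ∑ j, ∑ k, ‖sigmaCol ν σ η ε (αs j) 0 k‖ :=
        (Finset.single_le_sum (f := fun k => ‖sigmaCol ν σ η ε (αs j) 0 k‖)
          (fun _ _ => norm_nonneg _) (Finset.mem_univ k)).trans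
        (Finset.single_le_sum (f := fun j => ∑ k, ‖sigmaCol ν σ η ε (αs j) 0 k‖)
          (fun _ _ => Finset.sum_nonneg fun _ _ => norm_nonneg _) (Finset.mem_univ j))
      have h4 : d * sigmaLip ν C * ‖x‖ ≤ coefBound ν b σ η C ε αs * ‖x‖ :=
        mul_le_mul_of_nonneg_right hSLL (norm_nonneg _)
      have h5 : ∑ j, ∑ k, ‖sigmaCol ν σ η ε (αs j) 0 k‖ ≤ coefBound ν b σ η C ε αs := by
        unfold coefBound; linarith
      rw [sub_zero] at h1
      linarith
    hηm := fun j => hA.hη_meas (αs j)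
    hη := fun j x y => Eventually.of_forall fun e => by
      have h1 := hA.hη_lip _ (hαs j) _ (hαs j) x y e
      rw [sub_self (αs j), norm_zero, add_zero] at h1
      have h2 : 0 ≤ C * ‖x - y‖ := by positivity
      have h3 : C * ‖x - y‖ ≤ coefBound ν b σ η C ε αs * ‖x - y‖ :=
        mul_le_mul_of_nonneg_right hCL (norm_nonneg _)
      nlinarith [hm1 e]
    hη0 := fun j x e => (hA.hη_bdd _ (hαs j) x e).trans
      ((mul_le_of_le_one_right hC.le (hm1 e)).trans hCL)
    hγm := hA.hγ_meas
    hγ := fun x y e => (hA.hγ_lip x y e).trans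
      ((mul_le_of_le_one_right (by positivity) (min_le_left _ _)).trans
        (mul_le_mul_of_nonneg_right hCL (norm_nonneg _)))
    hγ0 := hA.hγ_nonneg
    hγ1 := fun x e => (hA.hγ_bdd x e).trans
      ((mul_le_of_le_one_right hC.le (hm1 e)).trans hCL)
    hf_t := fun j => hA.hf_t_cont (αs j)
    hf_mono := fun j t ht x p k u v => hA.hf_mono _ (hαs j) t ht x p k u v
    hf_k := fun j t ht x u p => hA.hf_k_mono _ (hαs j) t ht x u p
    hf_lip := fun j t ht x u v p q k k' => by
      have h1 := hA.hf_lip _ (hαs j) _ (hαs j) t ht x u v p q k k'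
      rw [sub_self (αs j), norm_zero, zero_add] at h1
      exact h1.trans (mul_le_mul_of_nonneg_right hCL (by positivity))
    hf_x := fun j R hR => by
      obtain ⟨mR, h1, h2, -, h3⟩ := hA.hf_x R hR
      exact ⟨mR, h1, h2, fun t ht x y u p k => h3 _ (hαs j) t ht x y u p k⟩
    hζ := hA.continuous_obstacle }

end AssumptionA

lemma neg_quadForm (t₀ : ℝ) (x₀ : Vec d) (a κ : ℝ) (p : Vec d) (X : Vec d →L[ℝ] Vec d)
    (t : ℝ) (x : Vec d) :
    quadForm t₀ x₀ (-a) (-κ) (-p) (-X) t x = -quadForm t₀ x₀ a κ p X t x := by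
  simp only [quadForm, inner_neg_left, _root_.neg_apply]
  ring

/-- The opposite of a test function. -/
def C12.neg (φ : C12 d) : C12 d where
  toFun := fun t x => -φ.toFun t x
  dt := fun t x => -φ.dt t x
  grad := fun t x => -φ.grad t x
  hess := fun t x => -φ.hess t x
  hasDt := fun t x => (φ.hasDt t x).neg
  hasGrad := fun t x => by
    have h := φ.hasGrad t x
    rw [hasGradientAt_iff_hasFDerivAt] at h ⊢
    rw [map_neg]
    exact h.neg
  hasHess := fun t x => by
    have h := (φ.hasHess t x).neg
    rw [map_neg]
    exact h
  cont := φ.cont.neg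
  cont_dt := φ.cont_dt.neg
  cont_grad := φ.cont_grad.neg
  cont_hess := φ.cont_hess.neg

namespace Coef

variable {ι : Type} (𝒞 : Coef n d ι)

/-- Stability of the operator under perturbations of the nonlocal argument. -/
lemma abs_Ham_sub_le {w w' : Vec d → ℝ} (hw : Measurable w) (hw' : Measurable w') {M ρ : ℝ}
    (hM : ∀ x, |w x| ≤ M) (hM' : ∀ x, |w' x| ≤ M) (hρ : ∀ x, |w x - w' x| ≤ ρ) {x : Vec d}
    (hx : w x = w' x) {t : ℝ} (ht : t ∈ Icc 0 𝒞.T) (j : ι) (u₀ a : ℝ) (p : Vec d)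
    (X : Vec d →L[ℝ] Vec d) :
    |𝒞.Ham j u₀ w t x a p X - 𝒞.Ham j u₀ w' t x a p X| ≤ (𝒞.L + 𝒞.L ^ 3) * ρ := by
  have := 𝒞.hμ
  have hL := 𝒞.L_pos
  have hρ0 : 0 ≤ ρ := (abs_nonneg _).trans (hρ x)
  have hK : |𝒞.Kw j w x p - 𝒞.Kw j w' x p| ≤ 𝒞.L * ρ := by
    unfold Kw
    rw [← integral_sub (𝒞.integrable_K hw hM j x p) (𝒞.integrable_K hw' hM' j x p)]
    have h := norm_integral_le_of_norm_le_const (μ := 𝒞.μ) (C := ρ)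
      (f := fun e => (w (x + 𝒞.η j x e) - w x - ⟪𝒞.η j x e, p⟫)
        - (w' (x + 𝒞.η j x e) - w' x - ⟪𝒞.η j x e, p⟫)) (Eventually.of_forall fun e => by
        rw [Real.norm_eq_abs]
        convert hρ (x + 𝒞.η j x e) using 2
        rw [hx]; ring)
    rw [Real.norm_eq_abs, mul_comm] at h
    exact h.trans (mul_le_mul_of_nonneg_right 𝒞.hμL hρ0)
  have hB : |𝒞.Bw j w x - 𝒞.Bw j w' x| ≤ 𝒞.L * (ρ * 𝒞.L) := by
    unfold Bw
    rw [← integral_sub (𝒞.integrable_B hw hM j x x) (𝒞.integrable_B hw' hM' j x x)]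
    have h := norm_integral_le_of_norm_le_const (μ := 𝒞.μ) (C := ρ * 𝒞.L)
      (f := fun e => (w (x + 𝒞.η j x e) - w x) * 𝒞.γ x e
        - (w' (x + 𝒞.η j x e) - w' x) * 𝒞.γ x e) (Eventually.of_forall fun e => by
        have e1 : (w (x + 𝒞.η j x e) - w x) * 𝒞.γ x e - (w' (x + 𝒞.η j x e) - w' x) * 𝒞.γ x e
          = (w (x + 𝒞.η j x e) - w' (x + 𝒞.η j x e)) * 𝒞.γ x e := by rw [hx]; ring
        rw [Real.norm_eq_abs, e1, abs_mul, abs_of_nonneg (𝒞.hγ0 x e)]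
        exact mul_le_mul (hρ _) (𝒞.hγ1 x e) (𝒞.hγ0 x e) hρ0)
    rw [Real.norm_eq_abs, mul_comm] at h
    exact h.trans (mul_le_mul_of_nonneg_right 𝒞.hμL (by positivity))
  have hf := 𝒞.hf_lip j t ht x u₀ u₀ (𝒞.St j x p) (𝒞.St j x p) (𝒞.Bw j w x) (𝒞.Bw j w' x)
  rw [sub_self, sub_self, abs_zero, norm_zero, zero_add, zero_add] at hf
  have hf' := hf.trans (mul_le_mul_of_nonneg_left hB hL.le)
  have e : 𝒞.Ham j u₀ w t x a p X - 𝒞.Ham j u₀ w' t x a p X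
      = -(𝒞.Kw j w x p - 𝒞.Kw j w' x p) - (𝒞.f j t x u₀ (𝒞.St j x p) (𝒞.Bw j w x)
        - 𝒞.f j t x u₀ (𝒞.St j x p) (𝒞.Bw j w' x)) := by
    unfold Ham; ring
  rw [e]
  have h1 := abs_sub (-(𝒞.Kw j w x p - 𝒞.Kw j w' x p)) (𝒞.f j t x u₀ (𝒞.St j x p) (𝒞.Bw j w x)
        - 𝒞.f j t x u₀ (𝒞.St j x p) (𝒞.Bw j w' x))
  rw [abs_neg] at h1
  have h2 : 𝒞.L * (𝒞.L * (ρ * 𝒞.L)) = 𝒞.L ^ 3 * ρ := by ring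
  rw [add_mul]
  linarith

/-- The operator evaluated at a test function. -/
def HamC (j : ι) (u₀ : ℝ) (φ : C12 d) (t : ℝ) (x : Vec d) : ℝ :=
  𝒞.Ham j u₀ (φ.toFun t) t x (φ.dt t x) (φ.grad t x)
    (Matrix.toEuclideanLin (φ.hess t x)).toContinuousLinearMap

lemma continuous_slice {U : ℝ → Vec d → ℝ} {T : ℝ}
    (hU : ContinuousOn (fun z : ℝ × Vec d => U z.1 z.2) (Icc 0 T ×ˢ univ)) {t : ℝ}
    (ht : t ∈ Icc 0 T) : Continuous (U t) :=
  hU.comp_continuous (Continuous.prodMk_right t) fun _ => ⟨ht, mem_univ _⟩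

/-- Local touching from above by a quadratic form may be tested with global test functions. -/
lemma exists_test_above {U : ℝ → Vec d → ℝ}
    (hU : ContinuousOn (fun z : ℝ × Vec d => U z.1 z.2) (Icc 0 𝒞.T ×ˢ univ)) {M : ℝ}
    (hM : ∀ t x, |U t x| ≤ M) {t₀ : ℝ} (ht₀ : t₀ ∈ Icc 0 𝒞.T) {x₀ : Vec d} {a κ : ℝ} {p : Vec d}
    {X : Vec d →L[ℝ] Vec d} (hX : ∀ u v, ⟪X u, v⟫ = ⟪u, X v⟫) {r : ℝ} (hr : 0 < r)
    (htouch : ∀ t ∈ Icc 0 𝒞.T, ∀ x, |t - t₀| < r → ‖x - x₀‖ < r →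
      U t x ≤ U t₀ x₀ + quadForm t₀ x₀ a κ p X t x) {δ : ℝ} (hδ : 0 < δ) :
    ∃ φ : C12 d, (∀ t ∈ Icc 0 𝒞.T, ∀ x, U t x - φ.toFun t x ≤ U t₀ x₀ - φ.toFun t₀ x₀) ∧
      ∀ j, |𝒞.HamC j (U t₀ x₀) φ t₀ x₀ - 𝒞.Ham j (U t₀ x₀) (U t₀) t₀ x₀ a p X| ≤ δ := by
  have hL := 𝒞.L_pos
  set ρ := δ / (𝒞.L + 𝒞.L ^ 3) with hρ
  have hρ0 : 0 < ρ := by positivity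
  obtain ⟨φ, h1, h2, h3, h4, h5⟩ := exists_C12_touching 𝒞.hT.le hU ht₀ hX hr htouch hρ0
  refine ⟨φ, fun t ht x => ?_, fun j => ?_⟩
  · have := (h5 t ht x).1
    rw [h1]; linarith
  · unfold HamC
    rw [h2, h3, h4]
    have hb : ∀ x, |φ.toFun t₀ x - U t₀ x| ≤ ρ := fun x => by
      have := h5 t₀ ht₀ x
      rw [abs_le]; constructor <;> linarith
    refine (𝒞.abs_Ham_sub_le (M := M + ρ) (ρ := ρ) ?_ (continuous_slice hU ht₀).measurable
      (fun x => ?_) (fun x => (hM t₀ x).trans (by linarith)) hb h1 ht₀ j _ a p X).trans_eq ?_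
    · exact (φ.cont.comp (Continuous.prodMk_right t₀)).measurable
    · have e1 := abs_le.1 (hM t₀ x)
      have e2 := abs_le.1 (hb x)
      rw [abs_le]; constructor <;> linarith
    · rw [hρ]; field_simp

/-- Local touching from below by a quadratic form may be tested with global test functions. -/
lemma exists_test_below {U : ℝ → Vec d → ℝ}
    (hU : ContinuousOn (fun z : ℝ × Vec d => U z.1 z.2) (Icc 0 𝒞.T ×ˢ univ)) {M : ℝ}
    (hM : ∀ t x, |U t x| ≤ M) {t₀ : ℝ} (ht₀ : t₀ ∈ Icc 0 𝒞.T) {x₀ : Vec d} {a κ : ℝ} {p : Vec d}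
    {X : Vec d →L[ℝ] Vec d} (hX : ∀ u v, ⟪X u, v⟫ = ⟪u, X v⟫) {r : ℝ} (hr : 0 < r)
    (htouch : ∀ t ∈ Icc 0 𝒞.T, ∀ x, |t - t₀| < r → ‖x - x₀‖ < r →
      U t₀ x₀ + quadForm t₀ x₀ a κ p X t x ≤ U t x) {δ : ℝ} (hδ : 0 < δ) :
    ∃ φ : C12 d, (∀ t ∈ Icc 0 𝒞.T, ∀ x, U t₀ x₀ - φ.toFun t₀ x₀ ≤ U t x - φ.toFun t x) ∧
      ∀ j, |𝒞.HamC j (U t₀ x₀) φ t₀ x₀ - 𝒞.Ham j (U t₀ x₀) (U t₀) t₀ x₀ a p X| ≤ δ := by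
  have hL := 𝒞.L_pos
  set ρ := δ / (𝒞.L + 𝒞.L ^ 3) with hρ
  have hρ0 : 0 < ρ := by positivity
  obtain ⟨φ, h1, h2, h3, h4, h5⟩ := exists_C12_touching (U := fun t x => -U t x) (a := -a)
    (κ := -κ) (p := -p) (X := -X) 𝒞.hT.le hU.neg ht₀
    (fun u v => by simp only [_root_.neg_apply, inner_neg_left, inner_neg_right, hX u v]) hr
    (fun t ht x h6 h7 => by
      have := htouch t ht x h6 h7
      rw [neg_quadForm]; linarith) hρ0
  refine ⟨φ.neg, fun t ht x => ?_, fun j => ?_⟩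
  · have := (h5 t ht x).1
    simp only [C12.neg]
    rw [h1]; linarith
  · unfold HamC
    simp only [C12.neg, map_neg]
    rw [h2, h3, h4, neg_neg, neg_neg, neg_neg]
    have hb : ∀ x, |-φ.toFun t₀ x - U t₀ x| ≤ ρ := fun x => by
      have := h5 t₀ ht₀ x
      rw [abs_le]; constructor <;> linarith
    refine (𝒞.abs_Ham_sub_le (M := M + ρ) (ρ := ρ) ?_ (continuous_slice hU ht₀).measurable
      (fun x => ?_) (fun x => (hM t₀ x).trans (by linarith)) hb (by rw [h1, neg_neg]) ht₀ j _ a p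
        X).trans_eq ?_
    · exact (φ.cont.comp (Continuous.prodMk_right t₀)).neg.measurable
    · have e1 := abs_le.1 (hM t₀ x)
      have e2 := abs_le.1 (hb x)
      rw [abs_le]; constructor <;> linarith
    · rw [hρ]; field_simp

end Coef

/-- Points where a continuous function is touched from below by quadratic forms are dense enough
to propagate closed inequalities. -/
lemma nonneg_of_touching {T : ℝ} {U G : ℝ → Vec d → ℝ}
    (hU : ContinuousOn (fun z : ℝ × Vec d => U z.1 z.2) (Icc 0 T ×ˢ univ))
    (hG : ContinuousOn (fun z : ℝ × Vec d => G z.1 z.2) (Icc 0 T ×ˢ univ)) {M : ℝ}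
    (hM : ∀ t x, |U t x| ≤ M)
    (h : ∀ t₀ ∈ Ioc 0 T, ∀ x₀ a κ p, ∀ X : Vec d →L[ℝ] Vec d, (∀ u v, ⟪X u, v⟫ = ⟪u, X v⟫) →
      ∀ r > 0, (∀ t ∈ Icc 0 T, ∀ x, |t - t₀| < r → ‖x - x₀‖ < r →
        U t₀ x₀ + quadForm t₀ x₀ a κ p X t x ≤ U t x) → 0 ≤ G t₀ x₀)
    {t : ℝ} (ht : t ∈ Ioc 0 T) (x : Vec d) : 0 ≤ G t x := by
  by_contra! hneg
  have hM0 : 0 ≤ M := (abs_nonneg _).trans (hM t x)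
  have htT : t ∈ Icc 0 T := Ioc_subset_Icc_self ht
  have hnear : ∀ᶠ z in 𝓝[Icc 0 T ×ˢ univ] (t, x), G z.1 z.2 < 0 :=
    (hG (t, x) ⟨htT, mem_univ _⟩).eventually_lt_const hneg
  obtain ⟨r₀, hr₀, hr₀G⟩ := Metric.mem_nhdsWithin_iff.1 hnear
  obtain ⟨r, hr, hrr₀, hrt⟩ : ∃ r > 0, r < r₀ ∧ r < t :=
    ⟨min r₀ t / 2, by have := lt_min hr₀ ht.1; positivity,
      by have := min_le_left r₀ t; have := lt_min hr₀ ht.1; linarith,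
      by have := min_le_right r₀ t; have := lt_min hr₀ ht.1; linarith [ht.1]⟩
  set N := (4 * M + 1) / r ^ 2 with hN
  set S : Set (ℝ × Vec d) := (Icc 0 T ∩ Icc (t - r) (t + r)) ×ˢ closedBall x r with hS
  have hSc : IsCompact S := (isCompact_Icc.inter_right isClosed_Icc).prod (isCompact_closedBall _ _)
  have hSz : (t, x) ∈ S := ⟨⟨htT, by constructor <;> linarith⟩, mem_closedBall_self hr.le⟩
  set F : ℝ × Vec d → ℝ := fun z => U z.1 z.2 + N * ((z.1 - t) ^ 2 + ‖z.2 - x‖ ^ 2) with hF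
  have hFc : ContinuousOn F S := by
    refine (hU.mono (prod_mono inter_subset_left (subset_univ _))).add (Continuous.continuousOn ?_)
    fun_prop
  obtain ⟨⟨t₁, x₁⟩, hz₁, hmin⟩ := hSc.exists_isMinOn ⟨_, hSz⟩ hFc
  have hmin' : ∀ z ∈ S, F (t₁, x₁) ≤ F z := fun z hz => hmin hz
  have hN0 : 0 < N := by positivity
  have hsum : (t₁ - t) ^ 2 + ‖x₁ - x‖ ^ 2 < r ^ 2 := by
    have h1 := hmin' _ hSz
    simp only [hF, sub_self, norm_zero] at h1
    have h2 := abs_le.1 (hM t₁ x₁)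
    have h3 := abs_le.1 (hM t x)
    have h4 : N * ((t₁ - t) ^ 2 + ‖x₁ - x‖ ^ 2) < N * r ^ 2 := by
      have : N * r ^ 2 = 4 * M + 1 := by rw [hN]; field_simp
      rw [this]; nlinarith
    exact lt_of_mul_lt_mul_left h4 hN0.le
  have ht₁ : |t₁ - t| < r := abs_lt_of_sq_lt_sq (by nlinarith [sq_nonneg ‖x₁ - x‖]) hr.le
  have hx₁ : ‖x₁ - x‖ < r := by
    have := abs_lt_of_sq_lt_sq (a := ‖x₁ - x‖) (by nlinarith [sq_nonneg (t₁ - t)]) hr.le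
    rwa [abs_norm] at this
  have ht₁T : t₁ ∈ Ioc 0 T := ⟨by have := (abs_lt.1 ht₁).1; linarith, hz₁.1.1.2⟩
  have hGneg : G t₁ x₁ < 0 := by
    refine hr₀G ⟨?_, hz₁.1.1, mem_univ _⟩
    rw [mem_ball, Prod.dist_eq, max_lt_iff, Real.dist_eq, dist_eq_norm]
    exact ⟨ht₁.trans hrr₀, hx₁.trans hrr₀⟩
  refine absurd (h t₁ ht₁T x₁ (-(2 * N * (t₁ - t))) (-N) (-(2 * N) • (x₁ - x))
    (-(2 * N) • ContinuousLinearMap.id ℝ (Vec d)) (fun u v => ?_)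
    (min (r - |t₁ - t|) (r - ‖x₁ - x‖)) (lt_min (by linarith) (by linarith)) ?_)
    (not_le.2 hGneg)
  · simp [real_inner_smul_left, real_inner_smul_right]
  · intro s hs y hsy hyy
    rw [lt_min_iff] at hsy hyy
    have hzS : (s, y) ∈ S := by
      refine ⟨⟨hs, ?_⟩, ?_⟩
      · have h1 := abs_le.1 ((abs_sub_le s t₁ t).trans (by linarith [hsy.1] : _ ≤ r))
        constructor <;> linarith
      · rw [mem_closedBall, dist_eq_norm]
        linarith [norm_sub_le_norm_sub_add_norm_sub y x₁ x, hyy.2]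
    have h1 := hmin' _ hzS
    simp only [hF] at h1
    have h2 : ‖y - x‖ ^ 2 = ‖y - x₁‖ ^ 2 + 2 * ⟪x₁ - x, y - x₁⟫ + ‖x₁ - x‖ ^ 2 := by
      rw [show y - x = (y - x₁) + (x₁ - x) by abel, norm_add_sq_real, real_inner_comm]
    simp only [quadForm, _root_.smul_apply, ContinuousLinearMap.id_apply, real_inner_smul_left,
      real_inner_self_eq_norm_sq]
    rw [h2] at h1
    nlinarith

lemma trace_mul_transpose_mul (S H : Matrix (Fin d) (Fin d) ℝ) :
    Matrix.trace (S * Sᵀ * H) = ∑ k, ⟪Matrix.toEuclideanLin H (WithLp.toLp 2 fun i => S i k),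
      (WithLp.toLp 2 fun i => S i k : Vec d)⟫ := by
  rw [Matrix.mul_assoc, Matrix.trace_mul_comm, Matrix.mul_assoc]
  refine Finset.sum_congr rfl fun k _ => ?_
  rw [Matrix.diag_apply, Matrix.mul_apply, PiLp.inner_apply]
  refine Finset.sum_congr rfl fun l _ => ?_
  simp [Matrix.mul_apply, Matrix.mulVec, dotProduct, Matrix.toLpLin_apply]

namespace AssumptionA

variable {ν : Measure (Vec n)} {A : Set (Vec m)} {T : ℝ}
  {b : Vec m → Vec d → Vec d} {σ : Vec m → Vec d → Matrix (Fin d) (Fin d) ℝ}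
  {η : Vec m → Vec d → Vec n → Vec d} {γ : Vec d → Vec n → ℝ}
  {f : Vec m → ℝ → Vec d → ℝ → Vec d → ℝ → ℝ}
  {ζ : ℝ → Vec d → ℝ} {g : Vec d → ℝ} {C : ℝ} {J : ℕ} {ε : ℝ} {αs : Fin J → Vec m}

lemma HamC_eq (hA : AssumptionA ν A T b σ η γ f ζ g C) (hε : ε ∈ Ioo (0 : ℝ) 1)
    (hαs : ∀ j, αs j ∈ A) (j : Fin J) (u₀ : ℝ) (φ : C12 d) (t : ℝ) (x : Vec d) :
    (hA.toCoef hε hαs).HamC j u₀ φ t x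
      = φ.dt t x - Ltr ν b σ η ε φ (αs j) t x - f (αs j) t x u₀
          (mvE ((sigmaTilde ν σ η ε (αs j) x)ᵀ) (φ.grad t x)) (Btr ν η γ ε φ (αs j) t x) := by
  have e1 : mvE ((sigmaTilde ν σ η ε (αs j) x)ᵀ) (φ.grad t x)
      = (hA.toCoef hε hαs).St j x (φ.grad t x) := by
    ext k
    change ((sigmaTilde ν σ η ε (αs j) x)ᵀ.mulVec (φ.grad t x).ofLp) k
      = ⟪sigmaCol ν σ η ε (αs j) x k, φ.grad t x⟫
    rw [PiLp.inner_apply]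
    simp [Matrix.mulVec, dotProduct, sigmaCol, mul_comm]
  rw [e1]
  unfold Ltr
  rw [trace_mul_transpose_mul]
  rfl

lemma isSub_of_subsolnHJBVIe (hA : AssumptionA ν A T b σ η γ f ζ g C) (hε : ε ∈ Ioo (0 : ℝ) 1)
    (hJ : 2 ≤ J) (hαs : ∀ j, αs j ∈ A) {u : ℝ → Vec d → ℝ} {M : ℝ} (hM : ∀ t x, |u t x| ≤ M)
    (hu : ContinuousOn (fun p : ℝ × Vec d => u p.1 p.2) (Icc 0 T ×ˢ univ))
    (hsub : SubsolnHJBVIe ν (Set.range αs) T b σ η γ f ζ ε u) :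
    (hA.toCoef hε hαs).IsSub u := by
  intro t₀ ht₀ x₀ a κ p X hX r hr htouch
  by_contra! hcon
  obtain ⟨hζ, hH⟩ := hcon
  have : Nonempty (Fin J) := ⟨⟨0, by omega⟩⟩
  obtain ⟨j₀, hj₀⟩ := Finite.exists_min
    fun j => (hA.toCoef hε hαs).Ham j (u t₀ x₀) (u t₀) t₀ x₀ a p X
  set δ := (hA.toCoef hε hαs).Ham j₀ (u t₀ x₀) (u t₀) t₀ x₀ a p X with hδ
  have hδ0 : 0 < δ := hH j₀
  obtain ⟨φ, h1, h2⟩ := (hA.toCoef hε hαs).exists_test_above hu hM (Ioc_subset_Icc_self ht₀) hX hr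
    htouch (half_pos hδ0)
  have h3 := hsub φ t₀ x₀ ht₀ h1
  have hζ' : ζ t₀ x₀ < u t₀ x₀ := hζ
  rw [min_le_iff] at h3
  rcases h3 with h3 | h3
  · linarith
  · have h4 : δ / 2 - φ.dt t₀ x₀ ≤ ⨅ α : Set.range αs, (-(Ltr ν b σ η ε φ (↑α) t₀ x₀)
        - f (↑α) t₀ x₀ (u t₀ x₀) (mvE ((sigmaTilde ν σ η ε (↑α) x₀)ᵀ) (φ.grad t₀ x₀))
            (Btr ν η γ ε φ (↑α) t₀ x₀)) := by
      refine le_ciInf ?_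
      rintro ⟨_, j, rfl⟩
      have h5 := abs_le.1 (h2 j)
      rw [hA.HamC_eq] at h5
      have h6 := hj₀ j
      dsimp only at h6 ⊢
      linarith [h5.1]
    linarith

lemma isSuper_of_supersolnHJBVIe (hA : AssumptionA ν A T b σ η γ f ζ g C)
    (hε : ε ∈ Ioo (0 : ℝ) 1) (hαs : ∀ j, αs j ∈ A) {u : ℝ → Vec d → ℝ} {M : ℝ}
    (hM : ∀ t x, |u t x| ≤ M)
    (hu : ContinuousOn (fun p : ℝ × Vec d => u p.1 p.2) (Icc 0 T ×ˢ univ))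
    (hsup : SupersolnHJBVIe ν (Set.range αs) T b σ η γ f ζ ε u) :
    (hA.toCoef hε hαs).IsSuper u := by
  have key : ∀ t₀ ∈ Ioc 0 T, ∀ x₀ a κ p, ∀ X : Vec d →L[ℝ] Vec d, (∀ u v, ⟪X u, v⟫ = ⟪u, X v⟫) →
      ∀ r > 0, (∀ t ∈ Icc 0 T, ∀ x, |t - t₀| < r → ‖x - x₀‖ < r →
        u t₀ x₀ + quadForm t₀ x₀ a κ p X t x ≤ u t x) →
      0 ≤ u t₀ x₀ - ζ t₀ x₀ ∧
        ∀ j, 0 ≤ (hA.toCoef hε hαs).Ham j (u t₀ x₀) (u t₀) t₀ x₀ a p X := by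
    intro t₀ ht₀ x₀ a κ p X hX r hr htouch
    have hφ := fun δ (hδ : 0 < δ) => (hA.toCoef hε hαs).exists_test_below hu hM
      (Ioc_subset_Icc_self ht₀) hX hr htouch hδ
    constructor
    · obtain ⟨φ, h1, -⟩ := hφ 1 one_pos
      exact (le_min_iff.1 (hsup φ t₀ x₀ ht₀ h1)).1
    · intro j
      refine le_of_forall_pos_le_add fun δ hδ => ?_
      obtain ⟨φ, h1, h2⟩ := hφ δ hδ
      have h3 := (le_min_iff.1 (hsup φ t₀ x₀ ht₀ h1)).2
      have h4 := ciInf_le (Set.finite_range fun α : Set.range αs => (-(Ltr ν b σ η ε φ (↑α) t₀ x₀)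
        - f (↑α) t₀ x₀ (u t₀ x₀) (mvE ((sigmaTilde ν σ η ε (↑α) x₀)ᵀ) (φ.grad t₀ x₀))
            (Btr ν η γ ε φ (↑α) t₀ x₀))).bddBelow ⟨αs j, mem_range_self j⟩
      have h5 := abs_le.1 (h2 j)
      rw [hA.HamC_eq] at h5
      dsimp only at h4
      linarith [h5.2]
  refine ⟨fun t ht x => ?_, fun t₀ ht₀ x₀ a κ p X hX ω hω r hr htouch => ?_⟩
  · have hG : ContinuousOn (fun z : ℝ × Vec d => u z.1 z.2 - ζ z.1 z.2) (Icc 0 T ×ˢ univ) :=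
      hu.sub hA.continuous_obstacle.continuousOn
    exact sub_nonneg.1 (nonneg_of_touching (G := fun t x => u t x - ζ t x) hu hG hM
      (fun t₀ ht₀ x₀ a κ p X hX r hr ht => (key t₀ ht₀ x₀ a κ p X hX r hr ht).1) ht x)
  · refine (key t₀ ht₀ x₀ a κ p X hX r hr fun t ht x h1 h2 => ?_).2
    have h3 : 0 ≤ ω * ((t - t₀) ^ 2 + ‖x - x₀‖ ^ 2) := by positivity
    linarith [htouch t ht x h1 h2]

lemma switch_sub_touching (hA : AssumptionA ν A T b σ η γ f ζ g C) (hε : ε ∈ Ioo (0 : ℝ) 1)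
    (hαs : ∀ j, αs j ∈ A) {c : ℝ} {U : Fin J → ℝ → Vec d → ℝ} {M : ℝ}
    (hM : ∀ j t x, |U j t x| ≤ M)
    (hU : ∀ j, ContinuousOn (fun p : ℝ × Vec d => U j p.1 p.2) (Icc 0 T ×ˢ univ))
    (hsub : SubsolnSwitch ν T b σ η γ f ζ ε αs c U) (j : Fin J) {t₀ : ℝ} (ht₀ : t₀ ∈ Ioc 0 T)
    {x₀ : Vec d} {a κ : ℝ} {p : Vec d} {X : Vec d →L[ℝ] Vec d} (hX : ∀ u v, ⟪X u, v⟫ = ⟪u, X v⟫)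
    {r : ℝ} (hr : 0 < r) (htouch : ∀ t ∈ Icc 0 T, ∀ x, |t - t₀| < r → ‖x - x₀‖ < r →
      U j t x ≤ U j t₀ x₀ + quadForm t₀ x₀ a κ p X t x) :
    U j t₀ x₀ ≤ ζ t₀ x₀ ∨ (hA.toCoef hε hαs).Ham j (U j t₀ x₀) (U j t₀) t₀ x₀ a p X ≤ 0 ∨
      U j t₀ x₀ ≤ MaxSw U c j t₀ x₀ := by
  by_contra! hcon
  obtain ⟨hζ, hH, hS⟩ := hcon
  obtain ⟨φ, h1, h2⟩ := (hA.toCoef hε hαs).exists_test_above (hU j) (hM j)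
    (Ioc_subset_Icc_self ht₀) hX hr htouch (half_pos hH)
  have h3 := hsub j φ t₀ x₀ ht₀ h1
  have h5 := (abs_le.1 (h2 j)).1
  rw [hA.HamC_eq] at h5
  rw [min_le_iff, min_le_iff] at h3
  rcases h3 with h3 | h3 | h3 <;> linarith

lemma switch_super_touching (hA : AssumptionA ν A T b σ η γ f ζ g C) (hε : ε ∈ Ioo (0 : ℝ) 1)
    (hαs : ∀ j, αs j ∈ A) {c : ℝ} {U : Fin J → ℝ → Vec d → ℝ} {M : ℝ}
    (hM : ∀ j t x, |U j t x| ≤ M)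
    (hU : ∀ j, ContinuousOn (fun p : ℝ × Vec d => U j p.1 p.2) (Icc 0 T ×ˢ univ))
    (hsup : SupersolnSwitch ν T b σ η γ f ζ ε αs c U) (j : Fin J) {t₀ : ℝ} (ht₀ : t₀ ∈ Ioc 0 T)
    {x₀ : Vec d} {a κ : ℝ} {p : Vec d} {X : Vec d →L[ℝ] Vec d} (hX : ∀ u v, ⟪X u, v⟫ = ⟪u, X v⟫)
    {r : ℝ} (hr : 0 < r) (htouch : ∀ t ∈ Icc 0 T, ∀ x, |t - t₀| < r → ‖x - x₀‖ < r →
      U j t₀ x₀ + quadForm t₀ x₀ a κ p X t x ≤ U j t x) :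
    ζ t₀ x₀ ≤ U j t₀ x₀ ∧ 0 ≤ (hA.toCoef hε hαs).Ham j (U j t₀ x₀) (U j t₀) t₀ x₀ a p X ∧
      MaxSw U c j t₀ x₀ ≤ U j t₀ x₀ := by
  have hφ := fun δ (hδ : 0 < δ) => (hA.toCoef hε hαs).exists_test_below (hU j) (hM j)
    (Ioc_subset_Icc_self ht₀) hX hr htouch hδ
  obtain ⟨φ, h1, -⟩ := hφ 1 one_pos
  have h3 := hsup j φ t₀ x₀ ht₀ h1
  rw [le_min_iff, le_min_iff] at h3
  refine ⟨by linarith, ?_, by linarith⟩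
  refine le_of_forall_pos_le_add fun δ hδ => ?_
  obtain ⟨φ, h1, h2⟩ := hφ δ hδ
  have h3 := hsup j φ t₀ x₀ ht₀ h1
  have h5 := (abs_le.1 (h2 j)).2
  rw [hA.HamC_eq] at h5
  rw [le_min_iff, le_min_iff] at h3
  linarith

end AssumptionA

/-- Expanding a quadratic form around another point. -/
lemma quadForm_sub_quadForm (t₀ : ℝ) (x₀ : Vec d) (a κ : ℝ) (p : Vec d) {X : Vec d →L[ℝ] Vec d}
    (hX : ∀ u v, ⟪X u, v⟫ = ⟪u, X v⟫) (t₁ : ℝ) (x₁ : Vec d) (t : ℝ) (x : Vec d) :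
    quadForm t₀ x₀ a κ p X t x - quadForm t₀ x₀ a κ p X t₁ x₁
      = quadForm t₁ x₁ (a + 2 * κ * (t₁ - t₀)) κ (p + X (x₁ - x₀)) X t x := by
  simp only [quadForm]
  obtain ⟨y, hy⟩ : ∃ y, x = x₁ + y := ⟨x - x₁, by abel⟩
  obtain ⟨z, hz⟩ : ∃ z, x₁ = x₀ + z := ⟨x₁ - x₀, by abel⟩
  have e1 : x - x₀ = z + y := by rw [hy, hz]; abel
  have e2 : x₁ - x₀ = z := by rw [hz]; abel
  have e3 : x - x₁ = y := by rw [hy]; abel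
  have e4 : ⟪X y, z⟫ = ⟪X z, y⟫ := by rw [hX, real_inner_comm]
  rw [e1, e2, e3]
  simp only [map_add, inner_add_left, inner_add_right, e4]
  ring

namespace Coef

variable {ι : Type} (𝒞 : Coef n d ι)

/-- The operator is nonincreasing in its nonlocal argument. -/
lemma Ham_anti {w w' : Vec d → ℝ} (hw : Measurable w) (hw' : Measurable w') {M : ℝ}
    (hM : ∀ x, |w x| ≤ M) (hM' : ∀ x, |w' x| ≤ M) (hle : ∀ x, w x ≤ w' x) {x : Vec d}
    (hx : w x = w' x) {t : ℝ} (ht : t ∈ Icc 0 𝒞.T) (j : ι) (u₀ a : ℝ) (p : Vec d)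
    (X : Vec d →L[ℝ] Vec d) :
    𝒞.Ham j u₀ w' t x a p X ≤ 𝒞.Ham j u₀ w t x a p X := by
  have hK : 𝒞.Kw j w x p ≤ 𝒞.Kw j w' x p := by
    refine integral_mono (𝒞.integrable_K hw hM j x p) (𝒞.integrable_K hw' hM' j x p) fun e => ?_
    have := hle (x + 𝒞.η j x e)
    dsimp only
    linarith
  have hB : 𝒞.Bw j w x ≤ 𝒞.Bw j w' x := by
    refine integral_mono (𝒞.integrable_B hw hM j x x) (𝒞.integrable_B hw' hM' j x x) fun e => ?_
    have := hle (x + 𝒞.η j x e)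
    exact mul_le_mul_of_nonneg_right (by linarith) (𝒞.hγ0 x e)
  have hf := 𝒞.hf_k j t ht x u₀ (𝒞.St j x p) hB
  dsimp only at hf
  unfold Ham
  linarith

lemma abs_Kw_le {w : Vec d → ℝ} {M : ℝ} (hM : ∀ x, |w x| ≤ M) (j : ι) (x p : Vec d) :
    |𝒞.Kw j w x p| ≤ 𝒞.L * (2 * M + 𝒞.L * ‖p‖) := by
  have := 𝒞.hμ
  have hL := 𝒞.L_pos
  have hM0 : 0 ≤ M := (abs_nonneg _).trans (hM x)
  have h := norm_integral_le_of_norm_le_const (μ := 𝒞.μ) (C := 2 * M + 𝒞.L * ‖p‖)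
    (f := fun e => w (x + 𝒞.η j x e) - w x - ⟪𝒞.η j x e, p⟫) (Eventually.of_forall fun e => by
      rw [Real.norm_eq_abs]
      refine (abs_sub _ _).trans (add_le_add (abs_jump_le hM _ _) ?_)
      exact (abs_real_inner_le_norm _ _).trans
        (mul_le_mul_of_nonneg_right (𝒞.hη0 j x e) (norm_nonneg _)))
  rw [Real.norm_eq_abs, mul_comm] at h
  exact h.trans (mul_le_mul_of_nonneg_right 𝒞.hμL (by positivity))

/-- The operator is locally bounded. -/
lemma exists_Ham_le (j : ι) {R : ℝ} (hR : 0 ≤ R) :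
    ∃ N, ∀ t ∈ Icc 0 𝒞.T, ∀ x u₀ a p, ∀ X : Vec d →L[ℝ] Vec d, ∀ w : Vec d → ℝ, ‖x‖ ≤ R →
      |u₀| ≤ R → ‖p‖ ≤ R → ‖X‖ ≤ R → (∀ y, |w y| ≤ R) → 𝒞.Ham j u₀ w t x a p X ≤ a + N := by
  have hL := 𝒞.L_pos
  set R₁ := d * (𝒞.L * (1 + R) * R) with hR₁
  set R₂ := 𝒞.L * (2 * R * 𝒞.L) with hR₂
  set S : Set (ℝ × Vec d × ℝ × Vec d × ℝ) := Icc 0 𝒞.T ×ˢ (closedBall 0 R ×ˢ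
    (closedBall 0 R ×ˢ (closedBall 0 R₁ ×ˢ closedBall 0 R₂))) with hS
  have hSc : IsCompact S := isCompact_Icc.prod ((isCompact_closedBall _ _).prod
    ((isCompact_closedBall _ _).prod ((isCompact_closedBall _ _).prod
      (isCompact_closedBall _ _))))
  obtain ⟨Cf, hCf⟩ := hSc.exists_bound_of_continuousOn ((𝒞.continuousOn_f j).mono
    (prod_mono le_rfl (subset_univ _)))
  refine ⟨1 / 2 * (d * (R * (𝒞.L * (1 + R)) ^ 2)) + 𝒞.L * (1 + R) * R
    + 𝒞.L * (2 * R + 𝒞.L * R) + Cf, fun t ht x u₀ a p X w hx hu hp hX hw => ?_⟩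
  have hs : ∀ k, ‖𝒞.s j x k‖ ≤ 𝒞.L * (1 + R) := fun k => (𝒞.hs0 j x k).trans
    (mul_le_mul_of_nonneg_left (by linarith) hL.le)
  have h1 : |∑ k, ⟪X (𝒞.s j x k), 𝒞.s j x k⟫| ≤ d * (R * (𝒞.L * (1 + R)) ^ 2) := by
    refine (Finset.abs_sum_le_sum_abs _ _).trans ?_
    calc ∑ k, |⟪X (𝒞.s j x k), 𝒞.s j x k⟫| ≤ ∑ _k : Fin d, R * (𝒞.L * (1 + R)) ^ 2 := by
          refine Finset.sum_le_sum fun k _ => ?_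
          refine (abs_real_inner_le_norm _ _).trans ?_
          calc ‖X (𝒞.s j x k)‖ * ‖𝒞.s j x k‖ ≤ (R * (𝒞.L * (1 + R))) * (𝒞.L * (1 + R)) :=
                mul_le_mul ((X.le_opNorm _).trans (mul_le_mul hX (hs k) (norm_nonneg _) hR)) (hs k)
                  (norm_nonneg _) (by positivity)
            _ = R * (𝒞.L * (1 + R)) ^ 2 := by ring
      _ = d * (R * (𝒞.L * (1 + R)) ^ 2) := by simp
  have h2 : |⟪𝒞.b j x, p⟫| ≤ 𝒞.L * (1 + R) * R :=
    (abs_real_inner_le_norm _ _).trans (mul_le_mul ((𝒞.hb0 j x).trans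
      (mul_le_mul_of_nonneg_left (by linarith) hL.le)) hp (norm_nonneg _) (by positivity))
  have h3 : |𝒞.Kw j w x p| ≤ 𝒞.L * (2 * R + 𝒞.L * R) := (𝒞.abs_Kw_le hw j x p).trans
    (mul_le_mul_of_nonneg_left (by linarith [mul_le_mul_of_nonneg_left hp hL.le]) hL.le)
  have h4 : ‖𝒞.St j x p‖ ≤ R₁ := (𝒞.norm_St_le j x p).trans
    (mul_le_mul_of_nonneg_left (mul_le_mul (mul_le_mul_of_nonneg_left (by linarith) hL.le) hp
      (norm_nonneg _) (by positivity)) (by positivity))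
  have h5 : |𝒞.Bw j w x| ≤ R₂ := 𝒞.abs_Bw_le hw j x
  have h6 : ‖𝒞.f j t x u₀ (𝒞.St j x p) (𝒞.Bw j w x)‖ ≤ Cf :=
    hCf (t, x, u₀, 𝒞.St j x p, 𝒞.Bw j w x) ⟨ht, by simpa using hx, by simpa using hu,
      by simpa using h4, by simpa using h5⟩
  rw [Real.norm_eq_abs] at h6
  have g1 := abs_le.1 h1
  have g2 := abs_le.1 h2
  have g3 := abs_le.1 h3
  have g6 := abs_le.1 h6
  unfold Ham
  linarith

/-- Lower barriers for supersolutions near the initial time. -/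
lemma exists_barrier (j : ι) {M : ℝ} (hM0 : 0 ≤ M) {g : Vec d → ℝ} {C : ℝ}
    (hg : ∀ x y, |g x - g y| ≤ C * ‖x - y‖) (x₀ : Vec d) (hgM : |g x₀| ≤ M) {k : ℝ} (hk : 0 < k) :
    ∃ Q N, ∀ U : ℝ → Vec d → ℝ,
      ContinuousOn (fun z : ℝ × Vec d => U z.1 z.2) (Icc 0 𝒞.T ×ˢ univ) →
      (∀ t x, |U t x| ≤ M) → (∀ x, U 0 x = g x) →
      (∀ t₀ ∈ Ioc 0 𝒞.T, ∀ x₀ a κ p, ∀ X : Vec d →L[ℝ] Vec d, (∀ u v, ⟪X u, v⟫ = ⟪u, X v⟫) →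
        ∀ r > 0, (∀ t ∈ Icc 0 𝒞.T, ∀ x, |t - t₀| < r → ‖x - x₀‖ < r →
          U t₀ x₀ + quadForm t₀ x₀ a κ p X t x ≤ U t x) →
        0 ≤ 𝒞.Ham j (U t₀ x₀) (U t₀) t₀ x₀ a p X) →
      ∀ t ∈ Icc 0 𝒞.T, ∀ x, ‖x - x₀‖ ≤ 1 → g x₀ - k - Q * ‖x - x₀‖ ^ 2 - N * t ≤ U t x := by
  set Q := C ^ 2 / (4 * k) + 2 * M with hQ
  have hQ0 : 0 ≤ Q := by positivity
  obtain ⟨N, hN⟩ := 𝒞.exists_Ham_le j (R := ‖x₀‖ + 1 + M + 2 * Q) (by positivity)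
  refine ⟨Q, |N| + 1, fun U hU hUM hU0 hH t ht x hx => ?_⟩
  set S : Set (ℝ × Vec d) := Icc 0 𝒞.T ×ˢ closedBall x₀ 1 with hS
  have hSc : IsCompact S := isCompact_Icc.prod (isCompact_closedBall _ _)
  have hmemS : ∀ {s y}, s ∈ Icc 0 𝒞.T → ‖y - x₀‖ ≤ 1 → (s, y) ∈ S := fun hs hy =>
    ⟨hs, by rwa [mem_closedBall, dist_eq_norm]⟩
  set F : ℝ × Vec d → ℝ := fun z => U z.1 z.2 + (Q * ‖z.2 - x₀‖ ^ 2 + (|N| + 1) * z.1) with hF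
  have hFc : ContinuousOn F S := by
    refine (hU.mono (prod_mono le_rfl (subset_univ _))).add (Continuous.continuousOn ?_)
    fun_prop
  obtain ⟨⟨t₁, x₁⟩, hz₁, hmin⟩ := hSc.exists_isMinOn ⟨_, hmemS ht hx⟩ hFc
  have hmin' : ∀ z ∈ S, F (t₁, x₁) ≤ F z := fun z hz => hmin hz
  suffices h : g x₀ - k ≤ F (t₁, x₁) by
    have := hmin' _ (hmemS ht hx)
    simp only [hF] at this h
    linarith
  by_contra! hlt
  have hx₁ : ‖x₁ - x₀‖ ≤ 1 := by
    have := hz₁.2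
    rwa [mem_closedBall, dist_eq_norm] at this
  have ht₁0 : 0 ≤ t₁ := hz₁.1.1
  have hNt : 0 ≤ (|N| + 1) * t₁ := by positivity
  simp only [hF] at hlt
  have hkC : ∀ s : ℝ, C * s ≤ k + C ^ 2 / (4 * k) * s ^ 2 := by
    intro s
    have : k + C ^ 2 / (4 * k) * s ^ 2 - C * s = (2 * k - C * s) ^ 2 / (4 * k) := by
      field_simp; ring
    have : 0 ≤ (2 * k - C * s) ^ 2 / (4 * k) := by positivity
    linarith
  have ht₁ : 0 < t₁ := by
    rcases ht₁0.eq_or_lt with h0 | h0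
    · exfalso
      rw [← h0, hU0] at hlt
      have h1 := (abs_le.1 (hg x₁ x₀)).1
      have h2 := hkC ‖x₁ - x₀‖
      have h3 : 0 ≤ 2 * M * ‖x₁ - x₀‖ ^ 2 := by positivity
      rw [hQ, add_mul] at hlt
      linarith
    · exact h0
  have hx₁' : ‖x₁ - x₀‖ < 1 := by
    rcases hx₁.eq_or_lt with h0 | h0
    · exfalso
      rw [h0] at hlt
      have h1 := (abs_le.1 (hUM t₁ x₁)).1
      have h2 := (abs_le.1 hgM).2
      have h3 : 0 ≤ C ^ 2 / (4 * k) := by positivity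
      rw [hQ] at hlt
      linarith
    · exact h0
  have ht₁T : t₁ ∈ Ioc 0 𝒞.T := ⟨ht₁, hz₁.1.2⟩
  have h1 := hH t₁ ht₁T x₁ (-(|N| + 1)) 0 (-(2 * Q) • (x₁ - x₀))
    (-(2 * Q) • ContinuousLinearMap.id ℝ (Vec d)) (fun u v => by
      simp [real_inner_smul_left, real_inner_smul_right]) (1 - ‖x₁ - x₀‖) (by linarith)
    (fun s hs y _ hyy => by
      have hyS : ‖y - x₀‖ ≤ 1 := by linarith [norm_sub_le_norm_sub_add_norm_sub y x₁ x₀]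
      have h1 := hmin' _ (hmemS hs hyS)
      simp only [hF] at h1
      have h2 : ‖y - x₀‖ ^ 2 = ‖y - x₁‖ ^ 2 + 2 * ⟪x₁ - x₀, y - x₁⟫ + ‖x₁ - x₀‖ ^ 2 := by
        rw [show y - x₀ = (y - x₁) + (x₁ - x₀) by abel, norm_add_sq_real, real_inner_comm]
      simp only [quadForm, _root_.smul_apply, ContinuousLinearMap.id_apply, real_inner_smul_left,
        real_inner_self_eq_norm_sq]
      rw [h2] at h1
      nlinarith)
  have hx₁R : ‖x₁‖ ≤ ‖x₀‖ + 1 := by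
    have := norm_sub_norm_le x₁ x₀
    linarith
  have h0 := norm_nonneg x₀
  have h2 := hN t₁ (Ioc_subset_Icc_self ht₁T) x₁ (U t₁ x₁) (-(|N| + 1)) (-(2 * Q) • (x₁ - x₀))
    (-(2 * Q) • ContinuousLinearMap.id ℝ (Vec d)) (U t₁) (by linarith)
    ((hUM t₁ x₁).trans (by linarith)) ?_ ?_ (fun y => (hUM t₁ y).trans (by linarith))
  · linarith [le_abs_self N]
  · rw [norm_smul, Real.norm_eq_abs, abs_neg, abs_of_nonneg (by positivity)]
    nlinarith
  · rw [norm_smul, Real.norm_eq_abs, abs_neg, abs_of_nonneg (by positivity)]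
    have h3 := ContinuousLinearMap.norm_id_le (𝕜 := ℝ) (E := Vec d)
    nlinarith

/-- Stability of the supersolution inequality under lower half-relaxed limits. -/
lemma Ham_nonneg_of_tendsto (j : ι) {V : ℕ → Vec d → ℝ} {w : Vec d → ℝ} {M : ℝ}
    (hVm : ∀ i, Measurable (V i)) (hVM : ∀ i x, |V i x| ≤ M) (hwm : Measurable w)
    (hwM : ∀ x, |w x| ≤ M) {ts : ℕ → ℝ} {t₀ : ℝ} (hts : ∀ i, ts i ∈ Icc 0 𝒞.T)
    (ht : Tendsto ts atTop (𝓝 t₀)) {xs : ℕ → Vec d} {x₀ : Vec d} (hx : Tendsto xs atTop (𝓝 x₀))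
    (hVw : Tendsto (fun i => V i (xs i)) atTop (𝓝 (w x₀)))
    (hlow : ∀ y, ∀ ys : ℕ → Vec d, Tendsto ys atTop (𝓝 y) → ∀ l < w y, ∀ᶠ i in atTop, l < V i (ys i))
    {as : ℕ → ℝ} {a : ℝ} (ha : Tendsto as atTop (𝓝 a)) {ps : ℕ → Vec d} {p : Vec d}
    (hp : Tendsto ps atTop (𝓝 p)) {X : Vec d →L[ℝ] Vec d}
    (hH : ∀ i, 0 ≤ 𝒞.Ham j (V i (xs i)) (V i) (ts i) (xs i) (as i) (ps i) X) :
    0 ≤ 𝒞.Ham j (w x₀) w t₀ x₀ a p X := by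
  have := 𝒞.hμ
  have hL := 𝒞.L_pos
  have ht₀ : t₀ ∈ Icc 0 𝒞.T := isClosed_Icc.mem_of_tendsto ht (Eventually.of_forall hts)
  have hxn : Tendsto (fun i => 𝒞.L * ‖xs i - x₀‖) atTop (𝓝 0) := by
    have := ((hx.sub_const x₀).norm).const_mul 𝒞.L
    simpa using this
  have hs : ∀ k, Tendsto (fun i => 𝒞.s j (xs i) k) atTop (𝓝 (𝒞.s j x₀ k)) := fun k => by
    rw [tendsto_iff_norm_sub_tendsto_zero]
    exact squeeze_zero (fun _ => norm_nonneg _) (fun i => 𝒞.hs j (xs i) x₀ k) hxn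
  have hb : Tendsto (fun i => 𝒞.b j (xs i)) atTop (𝓝 (𝒞.b j x₀)) := by
    rw [tendsto_iff_norm_sub_tendsto_zero]
    exact squeeze_zero (fun _ => norm_nonneg _) (fun i => 𝒞.hb j (xs i) x₀) hxn
  have hη : ∀ᵐ e ∂𝒞.μ, Tendsto (fun i => 𝒞.η j (xs i) e) atTop (𝓝 (𝒞.η j x₀ e)) := by
    have h1 : ∀ᵐ e ∂𝒞.μ, ∀ i, ‖𝒞.η j (xs i) e - 𝒞.η j x₀ e‖ ≤ 𝒞.L * ‖xs i - x₀‖ :=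
      ae_all_iff.2 fun i => 𝒞.hη j (xs i) x₀
    filter_upwards [h1] with e he
    rw [tendsto_iff_norm_sub_tendsto_zero]
    exact squeeze_zero (fun _ => norm_nonneg _) he hxn
  have hγ : ∀ e, Tendsto (fun i => 𝒞.γ (xs i) e) atTop (𝓝 (𝒞.γ x₀ e)) := fun e => by
    rw [tendsto_iff_norm_sub_tendsto_zero]
    exact squeeze_zero (fun _ => norm_nonneg _) (fun i => 𝒞.hγ (xs i) x₀ e) hxn
  have hSt : Tendsto (fun i => 𝒞.St j (xs i) (ps i)) atTop (𝓝 (𝒞.St j x₀ p)) := by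
    refine ((PiLp.continuous_toLp 2 _).tendsto _).comp (tendsto_pi_nhds.2 fun k => ?_)
    exact (hs k).inner hp
  set F : ℕ → Vec n → ℝ := fun i e => V i (xs i + 𝒞.η j (xs i) e) - V i (xs i) with hF
  set F₀ : Vec n → ℝ := fun e => w (x₀ + 𝒞.η j x₀ e) - w x₀ with hF₀
  set G : ℕ → Vec n → ℝ := fun i e => min (F i e) (F₀ e) with hG
  have hFm : ∀ i, Measurable (F i) := fun i => 𝒞.measurable_jump (hVm i) j (xs i)
  have hF₀m : Measurable F₀ := 𝒞.measurable_jump hwm j x₀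
  have hGm : ∀ i, Measurable (G i) := fun i => (hFm i).min hF₀m
  have hGM : ∀ i e, |G i e| ≤ 2 * M := fun i e => by
    have h1 := abs_le.1 (abs_jump_le (hVM i) (xs i + 𝒞.η j (xs i) e) (xs i))
    have h2 := abs_le.1 (abs_jump_le hwM (x₀ + 𝒞.η j x₀ e) x₀)
    exact abs_le.2 ⟨le_min h1.1 h2.1, (min_le_left _ _).trans h1.2⟩
  have hGlim : ∀ᵐ e ∂𝒞.μ, Tendsto (fun i => G i e) atTop (𝓝 (F₀ e)) := by
    filter_upwards [hη] with e he
    rw [tendsto_order]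
    refine ⟨fun l hl => ?_, fun l hl => Eventually.of_forall fun i =>
      lt_of_le_of_lt (min_le_right _ _) hl⟩
    set δ := (F₀ e - l) / 2 with hδ
    have hδ0 : 0 < δ := by rw [hδ]; linarith
    filter_upwards [hlow _ _ (hx.add he) (w (x₀ + 𝒞.η j x₀ e) - δ) (by linarith),
      hVw.eventually_lt_const (show w x₀ < w x₀ + δ by linarith)] with i h1 h2
    refine lt_min ?_ hl
    simp only [hF, hF₀] at hδ ⊢
    linarith
  have hKlim : Tendsto (fun i => ∫ e, (G i e - ⟪𝒞.η j (xs i) e, ps i⟫) ∂𝒞.μ) atTop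
      (𝓝 (𝒞.Kw j w x₀ p)) := by
    obtain ⟨P, hP⟩ := hp.norm.bddAbove_range
    refine tendsto_integral_of_dominated_convergence (fun _ => 2 * M + 𝒞.L * P)
      (fun i => ((hGm i).sub ((𝒞.hηm j (xs i)).inner_const)).aestronglyMeasurable)
      (integrable_const _) (fun i => Eventually.of_forall fun e => ?_) ?_
    · rw [Real.norm_eq_abs]
      refine (abs_sub _ _).trans (add_le_add (hGM i e) ?_)
      exact (abs_real_inner_le_norm _ _).trans
        (mul_le_mul (𝒞.hη0 j _ e) (hP ⟨i, rfl⟩) (norm_nonneg _) hL.le)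
    · filter_upwards [hGlim, hη] with e h1 h2
      exact h1.sub (h2.inner hp)
  have hBlim : Tendsto (fun i => ∫ e, G i e * 𝒞.γ (xs i) e ∂𝒞.μ) atTop (𝓝 (𝒞.Bw j w x₀)) := by
    refine tendsto_integral_of_dominated_convergence (fun _ => 2 * M * 𝒞.L)
      (fun i => ((hGm i).mul (𝒞.hγm (xs i))).aestronglyMeasurable)
      (integrable_const _) (fun i => Eventually.of_forall fun e => ?_) ?_
    · rw [Real.norm_eq_abs, abs_mul, abs_of_nonneg (𝒞.hγ0 (xs i) e)]
      exact mul_le_mul (hGM i e) (𝒞.hγ1 (xs i) e) (𝒞.hγ0 (xs i) e)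
        ((abs_nonneg _).trans (hGM i e))
    · filter_upwards [hGlim] with e h1
      exact h1.mul (hγ e)
  have hflim : Tendsto (fun i => 𝒞.f j (ts i) (xs i) (V i (xs i)) (𝒞.St j (xs i) (ps i))
      (∫ e, G i e * 𝒞.γ (xs i) e ∂𝒞.μ)) atTop
      (𝓝 (𝒞.f j t₀ x₀ (w x₀) (𝒞.St j x₀ p) (𝒞.Bw j w x₀))) := by
    have h1 := 𝒞.continuousOn_f j (t₀, x₀, w x₀, 𝒞.St j x₀ p, 𝒞.Bw j w x₀) ⟨ht₀, mem_univ _⟩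
    have h2 : Tendsto (fun i => (ts i, xs i, V i (xs i), 𝒞.St j (xs i) (ps i),
        ∫ e, G i e * 𝒞.γ (xs i) e ∂𝒞.μ)) atTop
        (𝓝[Icc 0 𝒞.T ×ˢ univ] (t₀, x₀, w x₀, 𝒞.St j x₀ p, 𝒞.Bw j w x₀)) :=
      tendsto_nhdsWithin_iff.2
        ⟨ht.prodMk_nhds (hx.prodMk_nhds (hVw.prodMk_nhds (hSt.prodMk_nhds hBlim))),
          Eventually.of_forall fun i => ⟨hts i, mem_univ _⟩⟩
    exact h1.tendsto.comp h2
  have hsum : Tendsto (fun i => ∑ k, ⟪X (𝒞.s j (xs i) k), 𝒞.s j (xs i) k⟫) atTop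
      (𝓝 (∑ k, ⟪X (𝒞.s j x₀ k), 𝒞.s j x₀ k⟫)) :=
    tendsto_finsetSum _ fun k _ => ((X.continuous.tendsto _).comp (hs k)).inner (hs k)
  have hlim := (ha.sub (((hsum.const_mul (1 / 2)).add (hb.inner hp)).add hKlim)).sub hflim
  refine ge_of_tendsto hlim (Eventually.of_forall fun i => ?_)
  have hi := hH i
  have hK : ∫ e, (G i e - ⟪𝒞.η j (xs i) e, ps i⟫) ∂𝒞.μ ≤ 𝒞.Kw j (V i) (xs i) (ps i) := by
    have h1 : Integrable (fun e => G i e - ⟪𝒞.η j (xs i) e, ps i⟫) 𝒞.μ :=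
      (𝒞.integrable_of_bdd (hGm i) (hGM i)).sub
        (𝒞.integrable_of_bdd ((𝒞.hηm j (xs i)).inner_const) (K := 𝒞.L * ‖ps i‖) fun e =>
          (abs_real_inner_le_norm _ _).trans
            (mul_le_mul_of_nonneg_right (𝒞.hη0 j _ e) (norm_nonneg _)))
    refine integral_mono h1 (𝒞.integrable_K (hVm i) (hVM i) j (xs i) (ps i)) fun e => ?_
    exact sub_le_sub_right (min_le_left _ _) _
  have hB : ∫ e, G i e * 𝒞.γ (xs i) e ∂𝒞.μ ≤ 𝒞.Bw j (V i) (xs i) := by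
    have h1 : Integrable (fun e => G i e * 𝒞.γ (xs i) e) 𝒞.μ := by
      refine 𝒞.integrable_of_bdd ((hGm i).mul (𝒞.hγm (xs i))) (K := 2 * M * 𝒞.L) fun e => ?_
      rw [abs_mul, abs_of_nonneg (𝒞.hγ0 (xs i) e)]
      exact mul_le_mul (hGM i e) (𝒞.hγ1 (xs i) e) (𝒞.hγ0 (xs i) e)
        ((abs_nonneg _).trans (hGM i e))
    refine integral_mono h1 (𝒞.integrable_B (hVm i) (hVM i) j (xs i) (xs i)) fun e => ?_
    exact mul_le_mul_of_nonneg_right (min_le_left _ _) (𝒞.hγ0 (xs i) e)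
  have hf := 𝒞.hf_k j (ts i) (hts i) (xs i) (V i (xs i)) (𝒞.St j (xs i) (ps i)) hB
  dsimp only at hf
  unfold Ham at hi
  linarith

end Coef

/-- Pointwise eventual properties hold eventually uniformly on compact sets. -/
lemma eventually_forall_of_compact {α β : Type*} [TopologicalSpace β] {l : Filter α} {S B : Set β}
    (hS : IsCompact S) (hSB : S ⊆ B) {P : α → β → Prop}
    (h : ∀ z ∈ S, ∀ᶠ q in l ×ˢ 𝓝[B] z, P q.1 q.2) : ∀ᶠ c in l, ∀ z ∈ S, P c z := by
  refine hS.induction_on (p := fun S' => ∀ᶠ c in l, ∀ z ∈ S', P c z) (by simp) ?_ ?_ ?_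
  · intro S₁ S₂ h12 h2
    exact h2.mono fun c hc z hz => hc z (h12 hz)
  · intro S₁ S₂ h1 h2
    filter_upwards [h1, h2] with c hc1 hc2 z hz
    exact hz.elim (hc1 z) (hc2 z)
  · intro z hz
    obtain ⟨pa, ha, pb, hb, hab⟩ := eventually_prod_iff.1 (h z hz)
    exact ⟨{y | pb y}, nhdsWithin_mono z hSB hb, ha.mono fun c hc y hy => hab hc hy⟩

/-- The filter of small costs and of points of the strip near a given point. -/
def lowerFilter (T t : ℝ) (x : Vec d) : Filter (ℝ × ℝ × Vec d) :=
  𝓝[Ioc 0 1] 0 ×ˢ 𝓝[Icc 0 T ×ˢ univ] (t, x)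

/-- The lower half-relaxed limit as the cost tends to zero. -/
def lowerLimit (U : ℝ → ℝ → Vec d → ℝ) (T t : ℝ) (x : Vec d) : ℝ :=
  liminf (fun q : ℝ × ℝ × Vec d => U q.1 q.2.1 q.2.2) (lowerFilter T t x)

section LowerLimit

variable {U V : ℝ → ℝ → Vec d → ℝ} {T M t : ℝ} {x : Vec d}

lemma lowerFilter_neBot (ht : t ∈ Icc 0 T) : (lowerFilter T t x).NeBot := by
  have h1 : (𝓝[Ioc (0 : ℝ) 1] 0).NeBot := by
    rw [← mem_closure_iff_nhdsWithin_neBot, closure_Ioc zero_ne_one]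
    exact ⟨le_rfl, zero_le_one⟩
  have h2 : (𝓝[Icc 0 T ×ˢ univ] (t, x)).NeBot :=
    mem_closure_iff_nhdsWithin_neBot.1 (subset_closure ⟨ht, mem_univ _⟩)
  exact h1.prod h2

lemma eventually_lowerFilter_mem :
    ∀ᶠ q in lowerFilter T t x, q.1 ∈ Ioc (0 : ℝ) 1 ∧ q.2.1 ∈ Icc 0 T := by
  filter_upwards [prod_mem_prod (self_mem_nhdsWithin (s := Ioc (0 : ℝ) 1) (a := 0))
    (self_mem_nhdsWithin (s := Icc 0 T ×ˢ (univ : Set (Vec d))) (a := (t, x)))] with q hq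
  exact ⟨hq.1, hq.2.1⟩

lemma eventually_lowerFilter_fst {P : ℝ → Prop} (h : ∀ᶠ c in 𝓝[Ioc 0 1] 0, P c) :
    ∀ᶠ q in lowerFilter T t x, P q.1 :=
  tendsto_fst.eventually h

lemma eventually_lowerFilter_snd {P : ℝ × Vec d → Prop}
    (h : ∀ᶠ z in 𝓝[Icc 0 T ×ˢ univ] (t, x), P z) : ∀ᶠ q in lowerFilter T t x, P q.2 :=
  tendsto_snd.eventually h

lemma eventually_abs_le (hU : ∀ c ∈ Ioc (0 : ℝ) 1, ∀ t x, |U c t x| ≤ M) :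
    ∀ᶠ q in lowerFilter T t x, |U q.1 q.2.1 q.2.2| ≤ M :=
  eventually_lowerFilter_mem.mono fun q hq => hU q.1 hq.1 _ _

lemma eventually_lt_of_lt_lowerLimit (hU : ∀ c ∈ Ioc (0 : ℝ) 1, ∀ t x, |U c t x| ≤ M) {l : ℝ}
    (hl : l < lowerLimit U T t x) : ∀ᶠ q in lowerFilter T t x, l < U q.1 q.2.1 q.2.2 :=
  eventually_lt_of_lt_liminf hl (isBoundedUnder_of_eventually_ge
    ((eventually_abs_le hU).mono fun _ hq => (abs_le.1 hq).1))

lemma isCoboundedUnder_lowerFilter (hU : ∀ c ∈ Ioc (0 : ℝ) 1, ∀ t x, |U c t x| ≤ M)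
    (ht : t ∈ Icc 0 T) : IsCoboundedUnder (· ≥ ·) (lowerFilter T t x)
      fun q : ℝ × ℝ × Vec d => U q.1 q.2.1 q.2.2 := by
  have := lowerFilter_neBot (x := x) ht
  exact (isBoundedUnder_of_eventually_le
    ((eventually_abs_le hU).mono fun _ hq => (abs_le.1 hq).2)).isCoboundedUnder_ge

lemma frequently_lt_of_lowerLimit_lt (hU : ∀ c ∈ Ioc (0 : ℝ) 1, ∀ t x, |U c t x| ≤ M)
    (ht : t ∈ Icc 0 T) {l : ℝ} (hl : lowerLimit U T t x < l) :
    ∃ᶠ q in lowerFilter T t x, U q.1 q.2.1 q.2.2 < l :=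
  frequently_lt_of_liminf_lt (isCoboundedUnder_lowerFilter hU ht) hl

lemma le_lowerLimit (hU : ∀ c ∈ Ioc (0 : ℝ) 1, ∀ t x, |U c t x| ≤ M) (ht : t ∈ Icc 0 T) {l : ℝ}
    (hl : ∀ᶠ q in lowerFilter T t x, l ≤ U q.1 q.2.1 q.2.2) : l ≤ lowerLimit U T t x :=
  le_liminf_of_le (isCoboundedUnder_lowerFilter hU ht) hl

lemma abs_lowerLimit_le (hU : ∀ c ∈ Ioc (0 : ℝ) 1, ∀ t x, |U c t x| ≤ M) (ht : t ∈ Icc 0 T) :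
    |lowerLimit U T t x| ≤ M := by
  refine abs_le.2 ⟨le_lowerLimit hU ht
    ((eventually_abs_le hU).mono fun _ hq => (abs_le.1 hq).1), ?_⟩
  by_contra! h
  have := lowerFilter_neBot (x := x) ht
  obtain ⟨q, h1, h2⟩ := ((eventually_lt_of_lt_lowerLimit hU h).and (eventually_abs_le hU)).exists
  linarith [(abs_le.1 h2).2]

lemma lowerSemicontinuousOn_lowerLimit (hU : ∀ c ∈ Ioc (0 : ℝ) 1, ∀ t x, |U c t x| ≤ M) :
    LowerSemicontinuousOn (fun z : ℝ × Vec d => lowerLimit U T z.1 z.2) (Icc 0 T ×ˢ univ) := by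
  rintro ⟨t, x⟩ - l hl
  obtain ⟨l', hll', hl'⟩ := exists_between hl
  obtain ⟨pa, ha, pb, hb, hab⟩ := eventually_prod_iff.1 (eventually_lt_of_lt_lowerLimit hU hl')
  filter_upwards [eventually_eventually_nhdsWithin.2 hb, self_mem_nhdsWithin] with z hz hzT
  refine lt_of_lt_of_le hll' (le_lowerLimit hU hzT.1 ?_)
  exact (ha.prod_mk hz).mono fun q hq => (hab hq.1 hq.2).le

lemma measurable_lowerLimit (hU : ∀ c ∈ Ioc (0 : ℝ) 1, ∀ t x, |U c t x| ≤ M) (ht : t ∈ Icc 0 T) :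
    Measurable (lowerLimit U T t) := by
  refine LowerSemicontinuous.measurable fun x l hl => ?_
  have h1 := lowerSemicontinuousOn_lowerLimit hU (t, x) ⟨ht, mem_univ _⟩ l hl
  have h2 : Tendsto (fun y : Vec d => (t, y)) (𝓝 x) (𝓝[Icc 0 T ×ˢ univ] (t, x)) :=
    tendsto_nhdsWithin_iff.2 ⟨(Continuous.prodMk_right t).tendsto x,
      Eventually.of_forall fun y => ⟨ht, mem_univ _⟩⟩
  exact h2.eventually h1

lemma lowerLimit_le_lowerLimit (hU : ∀ c ∈ Ioc (0 : ℝ) 1, ∀ t x, |U c t x| ≤ M)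
    (hV : ∀ c ∈ Ioc (0 : ℝ) 1, ∀ t x, |V c t x| ≤ M)
    (hUV : ∀ c ∈ Ioc (0 : ℝ) 1, ∀ t ∈ Icc 0 T, ∀ x, U c t x - c ≤ V c t x) (ht : t ∈ Icc 0 T) :
    lowerLimit U T t x ≤ lowerLimit V T t x := by
  refine le_of_forall_lt fun l hl => ?_
  obtain ⟨l₁, hl₁, hl₁'⟩ := exists_between hl
  obtain ⟨l₂, hl₂, hl₂'⟩ := exists_between hl₁'
  have hc : ∀ᶠ c in 𝓝[Ioc (0 : ℝ) 1] 0, c < l₂ - l₁ :=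
    nhdsWithin_le_nhds (eventually_lt_nhds (by linarith))
  refine hl₁.trans_le (le_lowerLimit hV ht ?_)
  filter_upwards [eventually_lowerFilter_mem, eventually_lowerFilter_fst hc,
    eventually_lt_of_lt_lowerLimit hU hl₂'] with q h1 h2 h3
  linarith [hUV q.1 h1.1 q.2.1 h1.2 q.2.2]

/-- At a point where the lower half-relaxed limit is strictly touched from below, nearby points
exist where the approximations are touched from below by the same function. -/
lemma exists_touching_near (hU : ∀ c ∈ Ioc (0 : ℝ) 1, ∀ t x, |U c t x| ≤ M)
    (hUc : ∀ c ∈ Ioc (0 : ℝ) 1,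
      ContinuousOn (fun z : ℝ × Vec d => U c z.1 z.2) (Icc 0 T ×ˢ univ))
    {t₀ : ℝ} (ht₀ : t₀ ∈ Icc 0 T) {x₀ : Vec d} {Q : ℝ → Vec d → ℝ}
    (hQ : Continuous fun z : ℝ × Vec d => Q z.1 z.2) (hQ0 : Q t₀ x₀ = 0) {ω r : ℝ} (hω : 0 < ω)
    (hr : 0 < r) (htouch : ∀ t ∈ Icc 0 T, ∀ x, |t - t₀| < r → ‖x - x₀‖ < r →
      lowerLimit U T t₀ x₀ + Q t x + ω * ((t - t₀) ^ 2 + ‖x - x₀‖ ^ 2) ≤ lowerLimit U T t x)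
    {ρ : ℝ} (hρ : 0 < ρ) :
    ∃ c ∈ Ioc (0 : ℝ) 1, ∃ t₁ ∈ Icc 0 T, ∃ x₁, c < ρ ∧ |t₁ - t₀| < ρ ∧ ‖x₁ - x₀‖ < ρ ∧
      |U c t₁ x₁ - lowerLimit U T t₀ x₀| < ρ ∧ ∃ r' > 0, ∀ t ∈ Icc 0 T, ∀ x,
        |t - t₁| < r' → ‖x - x₁‖ < r' → U c t₁ x₁ + (Q t x - Q t₁ x₁) ≤ U c t x := by
  set w₀ := lowerLimit U T t₀ x₀ with hw₀
  obtain ⟨s, hs, hsr, hsρ, hsQ⟩ : ∃ s > 0, s < r ∧ s < ρ ∧ ∀ t x, |t - t₀| ≤ s → ‖x - x₀‖ ≤ s →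
      |Q t x| < ρ / 2 := by
    have h1 : ∀ᶠ z : ℝ × Vec d in 𝓝 (t₀, x₀), |Q z.1 z.2| < ρ / 2 := by
      have h2 := (hQ.abs).tendsto (t₀, x₀)
      simp only [hQ0, abs_zero] at h2
      exact h2.eventually_lt_const (half_pos hρ)
    obtain ⟨s, hs, hsB⟩ := Metric.eventually_nhds_iff.1 h1
    have hm : 0 < min s (min r ρ) := lt_min hs (lt_min hr hρ)
    refine ⟨min s (min r ρ) / 2, half_pos hm, ?_, ?_, fun t x h3 h4 => hsB (y := (t, x)) ?_⟩
    · linarith [(min_le_right s (min r ρ)).trans (min_le_left r ρ)]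
    · linarith [(min_le_right s (min r ρ)).trans (min_le_right r ρ)]
    · rw [Prod.dist_eq, max_lt_iff, Real.dist_eq, dist_eq_norm]
      have := min_le_left s (min r ρ)
      constructor <;> dsimp only <;> linarith
  set δ := min (ω * s ^ 2 / 8) (ρ / 8) with hδ
  have hδ0 : 0 < δ := by positivity
  have hδ1 : δ ≤ ω * s ^ 2 / 8 := min_le_left _ _
  have hδ2 : δ ≤ ρ / 8 := min_le_right _ _
  set S : Set (ℝ × Vec d) := (Icc 0 T ∩ Icc (t₀ - s) (t₀ + s)) ×ˢ closedBall x₀ s with hS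
  have hSc : IsCompact S := (isCompact_Icc.inter_right isClosed_Icc).prod (isCompact_closedBall _ _)
  have hSB : S ⊆ Icc 0 T ×ˢ univ := prod_mono inter_subset_left (subset_univ _)
  have hmemS : ∀ t x, (t, x) ∈ S ↔ t ∈ Icc 0 T ∧ |t - t₀| ≤ s ∧ ‖x - x₀‖ ≤ s := by
    intro t x
    rw [hS, mem_prod, mem_inter_iff, mem_closedBall, dist_eq_norm, abs_le, mem_Icc (a := t₀ - s)]
    constructor
    · rintro ⟨⟨h1, h2, h3⟩, h4⟩
      exact ⟨h1, ⟨by dsimp only at h2; linarith, by dsimp only at h3; linarith⟩, h4⟩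
    · rintro ⟨h1, ⟨h2, h3⟩, h4⟩
      exact ⟨⟨h1, by dsimp only; linarith, by dsimp only; linarith⟩, h4⟩
  set Φ : ℝ × Vec d → ℝ :=
    fun z => w₀ + Q z.1 z.2 + ω * ((z.1 - t₀) ^ 2 + ‖z.2 - x₀‖ ^ 2) with hΦ
  have hΦc : Continuous Φ := by fun_prop
  have hlow : ∀ᶠ c in 𝓝[Ioc (0 : ℝ) 1] 0, ∀ z ∈ S, Φ z - 2 * δ < U c z.1 z.2 := by
    refine eventually_forall_of_compact hSc hSB ?_
    rintro ⟨t, x⟩ hz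
    obtain ⟨h1, h2, h3⟩ := (hmemS t x).1 hz
    have h4 : Φ (t, x) - δ < lowerLimit U T t x := by
      have := htouch t h1 x (h2.trans_lt hsr) (h3.trans_lt hsr)
      simp only [hΦ]
      linarith
    have h5 : ∀ᶠ z in 𝓝[Icc 0 T ×ˢ univ] (t, x), Φ z < Φ (t, x) + δ :=
      nhdsWithin_le_nhds ((hΦc.tendsto (t, x)).eventually_lt_const (by linarith))
    have h6 := eventually_lt_of_lt_lowerLimit hU h4
    have h7 := eventually_lowerFilter_snd h5
    unfold lowerFilter at h6 h7
    filter_upwards [h6, h7] with q h8 h9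
    linarith
  have hcρ : ∀ᶠ c in 𝓝[Ioc (0 : ℝ) 1] 0, c < ρ := nhdsWithin_le_nhds (eventually_lt_nhds hρ)
  have hnear : ∀ᶠ z in 𝓝[Icc 0 T ×ˢ univ] (t₀, x₀),
      |z.1 - t₀| ≤ s ∧ ‖z.2 - x₀‖ ≤ s ∧ -δ < Q z.1 z.2 := by
    refine nhdsWithin_le_nhds ?_
    have h1 : ∀ᶠ z : ℝ × Vec d in 𝓝 (t₀, x₀), -δ < Q z.1 z.2 :=
      (hQ.tendsto (t₀, x₀)).eventually_const_lt (by simp only [hQ0]; linarith)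
    filter_upwards [h1, Metric.ball_mem_nhds (t₀, x₀) hs] with z h2 h3
    rw [mem_ball, Prod.dist_eq, max_lt_iff, Real.dist_eq, dist_eq_norm] at h3
    exact ⟨h3.1.le, h3.2.le, h2⟩
  obtain ⟨⟨c, t, x⟩, h1, h2, h3, h4, h5⟩ := ((frequently_lt_of_lowerLimit_lt (l := w₀ + δ) hU ht₀
    (by linarith)).and_eventually (eventually_lowerFilter_mem.and
      ((eventually_lowerFilter_fst hlow).and ((eventually_lowerFilter_fst hcρ).and
        (eventually_lowerFilter_snd hnear))))).exists
  dsimp only at h1 h2 h3 h4 h5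
  have hz : (t, x) ∈ S := (hmemS t x).2 ⟨h2.2, h5.1, h5.2.1⟩
  obtain ⟨⟨t₁, x₁⟩, hz₁, hmin⟩ := hSc.exists_isMinOn ⟨_, hz⟩
    (((hUc c h2.1).mono hSB).sub hQ.continuousOn)
  have hmin' : ∀ z ∈ S, U c t₁ x₁ - Q t₁ x₁ ≤ U c z.1 z.2 - Q z.1 z.2 := fun z hz => hmin hz
  obtain ⟨g1, g2, g3⟩ := (hmemS t₁ x₁).1 hz₁
  have g4 := h3 _ hz₁
  have g5 := hmin' _ hz
  have g6 := abs_lt.1 (hsQ t₁ x₁ g2 g3)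
  simp only [hΦ] at g4
  dsimp only at g5
  have hq : 0 ≤ ω * ((t₁ - t₀) ^ 2 + ‖x₁ - x₀‖ ^ 2) := by positivity
  have hsum : (t₁ - t₀) ^ 2 + ‖x₁ - x₀‖ ^ 2 < s ^ 2 := by
    have : ω * ((t₁ - t₀) ^ 2 + ‖x₁ - x₀‖ ^ 2) < ω * s ^ 2 := by
      have : 0 < ω * s ^ 2 := by positivity
      linarith [h5.2.2]
    exact lt_of_mul_lt_mul_left this hω.le
  have ht₁ : |t₁ - t₀| < s := abs_lt_of_sq_lt_sq (by nlinarith [sq_nonneg ‖x₁ - x₀‖]) hs.le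
  have hx₁ : ‖x₁ - x₀‖ < s := by
    have := abs_lt_of_sq_lt_sq (a := ‖x₁ - x₀‖) (by nlinarith [sq_nonneg (t₁ - t₀)]) hs.le
    rwa [abs_norm] at this
  refine ⟨c, h2.1, t₁, g1, x₁, h4, ht₁.trans hsρ, hx₁.trans hsρ, ?_,
    min (s - |t₁ - t₀|) (s - ‖x₁ - x₀‖), lt_min (by linarith) (by linarith),
    fun t' ht' x' h6 h7 => ?_⟩
  · rw [abs_lt]
    constructor <;> linarith [h5.2.2]
  · rw [lt_min_iff] at h6 h7
    have := hmin' (t', x') ((hmemS t' x').2 ⟨ht', by linarith [abs_sub_le t' t₁ t₀, h6.1],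
      by linarith [norm_sub_le_norm_sub_add_norm_sub x' x₁ x₀, h7.2]⟩)
    dsimp only at this
    linarith

end LowerLimit

namespace Coef

variable {ι : Type} (𝒞 : Coef n d ι)

/-- The lower half-relaxed limit inherits the supersolution inequality. -/
lemma Ham_lowerLimit_nonneg (j : ι) {U : ℝ → ℝ → Vec d → ℝ} {M : ℝ}
    (hU : ∀ c ∈ Ioc (0 : ℝ) 1, ∀ t x, |U c t x| ≤ M)
    (hUc : ∀ c ∈ Ioc (0 : ℝ) 1,
      ContinuousOn (fun z : ℝ × Vec d => U c z.1 z.2) (Icc 0 𝒞.T ×ˢ univ))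
    (hH : ∀ c ∈ Ioc (0 : ℝ) 1, ∀ t₀ ∈ Ioc 0 𝒞.T, ∀ x₀ a κ p, ∀ X : Vec d →L[ℝ] Vec d,
      (∀ u v, ⟪X u, v⟫ = ⟪u, X v⟫) →
      ∀ r > 0, (∀ t ∈ Icc 0 𝒞.T, ∀ x, |t - t₀| < r → ‖x - x₀‖ < r →
        U c t₀ x₀ + quadForm t₀ x₀ a κ p X t x ≤ U c t x) →
      0 ≤ 𝒞.Ham j (U c t₀ x₀) (U c t₀) t₀ x₀ a p X)
    {t₀ : ℝ} (ht₀ : t₀ ∈ Ioc 0 𝒞.T) {x₀ : Vec d} {a κ : ℝ} {p : Vec d} {X : Vec d →L[ℝ] Vec d}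
    (hX : ∀ u v, ⟪X u, v⟫ = ⟪u, X v⟫) {ω r : ℝ} (hω : 0 < ω) (hr : 0 < r)
    (htouch : ∀ t ∈ Icc 0 𝒞.T, ∀ x, |t - t₀| < r → ‖x - x₀‖ < r →
      lowerLimit U 𝒞.T t₀ x₀ + quadForm t₀ x₀ a κ p X t x
        + ω * ((t - t₀) ^ 2 + ‖x - x₀‖ ^ 2) ≤ lowerLimit U 𝒞.T t x) :
    0 ≤ 𝒞.Ham j (lowerLimit U 𝒞.T t₀ x₀) (lowerLimit U 𝒞.T t₀) t₀ x₀ a p X := by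
  have hT₀ := Ioc_subset_Icc_self ht₀
  have hρ : ∀ i : ℕ, 0 < t₀ * (1 / ((i : ℝ) + 1)) := fun i => by
    have := ht₀.1
    positivity
  have hρt : ∀ i : ℕ, t₀ * (1 / ((i : ℝ) + 1)) ≤ t₀ := fun i => by
    refine mul_le_of_le_one_right ht₀.1.le ?_
    rw [div_le_one (by positivity)]
    linarith [(Nat.cast_nonneg i : (0 : ℝ) ≤ i)]
  have hρ0 : Tendsto (fun i : ℕ => t₀ * (1 / ((i : ℝ) + 1))) atTop (𝓝 0) := by
    simpa using (tendsto_one_div_add_atTop_nhds_zero_nat (𝕜 := ℝ)).const_mul t₀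
  choose cs hcs ts hts xs hcρ htρ hxρ hUρ rs hrs hloc using fun i : ℕ =>
    exists_touching_near hU hUc hT₀ (contDiff_quadForm t₀ x₀ a κ p X).continuous
      (quadForm_self t₀ x₀ a κ p X) hω hr htouch (hρ i)
  have ht : Tendsto ts atTop (𝓝 t₀) := by
    rw [tendsto_iff_norm_sub_tendsto_zero]
    exact squeeze_zero (fun _ => norm_nonneg _) (fun i => (htρ i).le) hρ0
  have hx : Tendsto xs atTop (𝓝 x₀) := by
    rw [tendsto_iff_norm_sub_tendsto_zero]
    exact squeeze_zero (fun _ => norm_nonneg _) (fun i => (hxρ i).le) hρ0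
  have hc : Tendsto cs atTop (𝓝[Ioc (0 : ℝ) 1] 0) := tendsto_nhdsWithin_iff.2
    ⟨squeeze_zero (fun i => (hcs i).1.le) (fun i => (hcρ i).le) hρ0, Eventually.of_forall hcs⟩
  have hVw : Tendsto (fun i => U (cs i) (ts i) (xs i)) atTop (𝓝 (lowerLimit U 𝒞.T t₀ x₀)) := by
    rw [tendsto_iff_norm_sub_tendsto_zero]
    exact squeeze_zero (fun _ => norm_nonneg _) (fun i => (hUρ i).le) hρ0
  refine 𝒞.Ham_nonneg_of_tendsto j (V := fun i => U (cs i) (ts i)) (M := M)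
    (ts := ts) (xs := xs) (as := fun i => a + 2 * κ * (ts i - t₀))
    (ps := fun i => p + X (xs i - x₀))
    (fun i => (continuous_slice (hUc _ (hcs i)) (hts i)).measurable)
    (fun i x => hU _ (hcs i) _ _) (measurable_lowerLimit hU hT₀)
    (fun x => abs_lowerLimit_le hU hT₀) hts ht hx hVw ?_ ?_ ?_ ?_
  · intro y ys hys l hl
    have h1 : Tendsto (fun i => (cs i, ts i, ys i)) atTop (lowerFilter 𝒞.T t₀ y) :=
      hc.prodMk (tendsto_nhdsWithin_iff.2 ⟨ht.prodMk_nhds hys,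
        Eventually.of_forall fun i => ⟨hts i, mem_univ _⟩⟩)
    exact h1.eventually (eventually_lt_of_lt_lowerLimit hU hl)
  · simpa using ((ht.sub_const t₀).const_mul (2 * κ)).const_add a
  · have h1 : Tendsto (fun i => X (xs i - x₀)) atTop (𝓝 (X (x₀ - x₀))) :=
      (X.continuous.tendsto _).comp (hx.sub_const x₀)
    simpa using h1.const_add p
  · intro i
    have hpos : 0 < ts i := by
      have := (abs_lt.1 (htρ i)).1
      linarith [hρt i]
    refine hH (cs i) (hcs i) (ts i) ⟨hpos, (hts i).2⟩ (xs i) _ κ _ X hX (rs i) (hrs i)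
      fun t htT x h1 h2 => ?_
    rw [← quadForm_sub_quadForm t₀ x₀ a κ p hX]
    exact hloc i t htT x h1 h2

/-- The lower half-relaxed limit of weakly coupled supersolutions is a supersolution. -/
theorem isSuper_lowerLimit {U : ι → ℝ → ℝ → Vec d → ℝ} {M : ℝ}
    (hU : ∀ j, ∀ c ∈ Ioc (0 : ℝ) 1, ∀ t x, |U j c t x| ≤ M)
    (hUc : ∀ j, ∀ c ∈ Ioc (0 : ℝ) 1,
      ContinuousOn (fun z : ℝ × Vec d => U j c z.1 z.2) (Icc 0 𝒞.T ×ˢ univ))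
    (hζ : ∀ j, ∀ c ∈ Ioc (0 : ℝ) 1, ∀ t ∈ Icc 0 𝒞.T, ∀ x, 𝒞.ζ t x ≤ U j c t x)
    (hUU : ∀ j k, ∀ c ∈ Ioc (0 : ℝ) 1, ∀ t ∈ Icc 0 𝒞.T, ∀ x, U k c t x - c ≤ U j c t x)
    (hH : ∀ j, ∀ c ∈ Ioc (0 : ℝ) 1, ∀ t₀ ∈ Ioc 0 𝒞.T, ∀ x₀ a κ p, ∀ X : Vec d →L[ℝ] Vec d,
      (∀ u v, ⟪X u, v⟫ = ⟪u, X v⟫) →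
      ∀ r > 0, (∀ t ∈ Icc 0 𝒞.T, ∀ x, |t - t₀| < r → ‖x - x₀‖ < r →
        U j c t₀ x₀ + quadForm t₀ x₀ a κ p X t x ≤ U j c t x) →
      0 ≤ 𝒞.Ham j (U j c t₀ x₀) (U j c t₀) t₀ x₀ a p X) (k : ι) :
    𝒞.IsSuper (lowerLimit (U k) 𝒞.T) := by
  have heq : ∀ j, ∀ t ∈ Icc 0 𝒞.T, lowerLimit (U k) 𝒞.T t = lowerLimit (U j) 𝒞.T t :=
    fun j t ht => funext fun x => le_antisymm
      (lowerLimit_le_lowerLimit (hU k) (hU j) (hUU j k) ht)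
      (lowerLimit_le_lowerLimit (hU j) (hU k) (hUU k j) ht)
  refine ⟨fun t ht x => ?_, fun t₀ ht₀ x₀ a κ p X hX ω hω r hr htouch j => ?_⟩
  · refine le_of_forall_lt fun l hl => ?_
    obtain ⟨l', hl', hl''⟩ := exists_between hl
    refine hl'.trans_le (le_lowerLimit (hU k) (Ioc_subset_Icc_self ht) ?_)
    have h1 : ∀ᶠ z in 𝓝[Icc 0 𝒞.T ×ˢ univ] (t, x), l' < 𝒞.ζ z.1 z.2 :=
      nhdsWithin_le_nhds ((𝒞.hζ.tendsto (t, x)).eventually_const_lt hl'')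
    filter_upwards [eventually_lowerFilter_mem, eventually_lowerFilter_snd h1] with q h2 h3
    exact h3.le.trans (hζ k q.1 h2.1 q.2.1 h2.2 q.2.2)
  · have hT₀ := Ioc_subset_Icc_self ht₀
    rw [heq j t₀ hT₀] at htouch ⊢
    refine 𝒞.Ham_lowerLimit_nonneg j (hU j) (hUc j) (hH j) ht₀ hX hω hr (κ := κ)
      fun t ht x h1 h2 => ?_
    rw [← heq j t ht]
    exact htouch t ht x h1 h2

end Coef

namespace AssumptionA

variable {ν : Measure (Vec n)} {A : Set (Vec m)} {T : ℝ}
  {b : Vec m → Vec d → Vec d} {σ : Vec m → Vec d → Matrix (Fin d) (Fin d) ℝ}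
  {η : Vec m → Vec d → Vec n → Vec d} {γ : Vec d → Vec n → ℝ}
  {f : Vec m → ℝ → Vec d → ℝ → Vec d → ℝ → ℝ}
  {ζ : ℝ → Vec d → ℝ} {g : Vec d → ℝ} {C : ℝ} {J : ℕ} {ε c M : ℝ} {αs : Fin J → Vec m}
  {U : Fin J → ℝ → Vec d → ℝ} {u : ℝ → Vec d → ℝ}

/-- The largest component of a subsolution of the switching system is a subsolution of the
obstacle problem. -/
lemma isSub_of_isGreatest (hA : AssumptionA ν A T b σ η γ f ζ g C) (hε : ε ∈ Ioo (0 : ℝ) 1)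
    (hJ : 2 ≤ J) (hαs : ∀ j, αs j ∈ A) (hc : 0 < c) (hM : ∀ j t x, |U j t x| ≤ M)
    (hU : ∀ j, ContinuousOn (fun p : ℝ × Vec d => U j p.1 p.2) (Icc 0 T ×ˢ univ))
    (hsub : SubsolnSwitch ν T b σ η γ f ζ ε αs c U) {v : ℝ → Vec d → ℝ}
    (hvc : ContinuousOn (fun p : ℝ × Vec d => v p.1 p.2) (Icc 0 T ×ˢ univ))
    (hv : ∀ t x, IsGreatest (range fun j => U j t x) (v t x)) :
    (hA.toCoef hε hαs).IsSub v := by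
  have hle : ∀ j t x, U j t x ≤ v t x := fun j t x => (hv t x).2 (mem_range_self j)
  have hvM : ∀ t x, |v t x| ≤ M := fun t x => by
    obtain ⟨j, hj⟩ := (hv t x).1
    exact hj ▸ hM j t x
  intro t₀ ht₀ x₀ a κ p X hX r hr htouch
  have hT₀ : t₀ ∈ Icc 0 T := Ioc_subset_Icc_self ht₀
  obtain ⟨j, hj⟩ := (hv t₀ x₀).1
  dsimp only at hj
  rw [← hj] at htouch ⊢
  have h1 := hA.switch_sub_touching hε hαs hM hU hsub j ht₀ hX hr fun t ht x h1 h2 =>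
    (hle j t x).trans (htouch t ht x h1 h2)
  rcases h1 with h1 | h1 | h1
  · exact Or.inl h1
  · exact Or.inr ⟨j, ((hA.toCoef hε hαs).Ham_anti (Coef.continuous_slice (hU j) hT₀).measurable
      (Coef.continuous_slice hvc hT₀).measurable
      (hM j t₀) (hvM t₀) (hle j t₀) hj hT₀ j _ a p X).trans h1⟩
  · have : Nonempty {k : Fin J // k ≠ j} := by
      have : Nontrivial (Fin J) := Fin.nontrivial_iff_two_le.2 hJ
      obtain ⟨k, hk⟩ := exists_ne j
      exact ⟨⟨k, hk⟩⟩
    have h2 : MaxSw U c j t₀ x₀ ≤ U j t₀ x₀ - c := ciSup_le fun k => by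
      have := hle k t₀ x₀
      rw [← hj] at this
      linarith
    linarith

/-- Solutions of the switching system lie below solutions of the obstacle problem. -/
lemma switch_le (hA : AssumptionA ν A T b σ η γ f ζ g C) (hε : ε ∈ Ioo (0 : ℝ) 1)
    (hJ : 2 ≤ J) (hαs : ∀ j, αs j ∈ A) (hc : 0 < c) (hM : ∀ j t x, |U j t x| ≤ M)
    (hU : ∀ j, ContinuousOn (fun p : ℝ × Vec d => U j p.1 p.2) (Icc 0 T ×ˢ univ))
    (hU0 : ∀ j x, U j 0 x = g x) (hsub : SubsolnSwitch ν T b σ η γ f ζ ε αs c U)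
    (hu_bdd : ∀ t x, |u t x| ≤ M)
    (hu_cont : ContinuousOn (fun p : ℝ × Vec d => u p.1 p.2) (Icc 0 T ×ˢ univ))
    (hu_init : ∀ x, u 0 x = g x)
    (hu_super : SupersolnHJBVIe ν (Set.range αs) T b σ η γ f ζ ε u)
    (j : Fin J) {t : ℝ} (ht : t ∈ Icc 0 T) (x : Vec d) : U j t x ≤ u t x := by
  have hne : (Finset.univ : Finset (Fin J)).Nonempty := ⟨j, Finset.mem_univ j⟩
  obtain ⟨v, hv⟩ : ∃ v : ℝ → Vec d → ℝ, v = fun t x => Finset.univ.sup' hne fun j => U j t x :=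
    ⟨_, rfl⟩
  have hvc : ContinuousOn (fun p : ℝ × Vec d => v p.1 p.2) (Icc 0 T ×ˢ univ) := by
    rw [hv]
    exact ContinuousOn.finset_sup'_apply hne fun j _ => hU j
  have hvU : ∀ t x, IsGreatest (range fun j => U j t x) (v t x) := fun t x => by
    rw [hv]
    obtain ⟨j, -, hj⟩ := Finset.exists_mem_eq_sup' hne fun j => U j t x
    refine ⟨⟨j, hj.symm⟩, ?_⟩
    rintro _ ⟨k, rfl⟩
    exact Finset.le_sup' (fun j => U j t x) (Finset.mem_univ k)
  have hvM : ∀ t x, |v t x| ≤ M := fun t x => by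
    obtain ⟨j, hj⟩ := (hvU t x).1
    exact hj ▸ hM j t x
  refine ((hvU t x).2 (mem_range_self j)).trans ((hA.toCoef hε hαs).comparison
    hvc.upperSemicontinuousOn hu_cont.lowerSemicontinuousOn
    (fun t ht => (Coef.continuous_slice hvc ht).measurable)
    (fun t ht => (Coef.continuous_slice hu_cont ht).measurable) (fun t _ => hvM t)
    (fun t _ => hu_bdd t) (fun y => ?_) (hA.isSub_of_isGreatest hε hJ hαs hc hM hU hsub hvc hvU)
    (hA.isSuper_of_supersolnHJBVIe hε hαs hu_bdd hu_cont hu_super) t ht x)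
  obtain ⟨k, hk⟩ := (hvU 0 y).1
  rw [← hk, hu_init]
  exact (hU0 k y).le

/-- Components of a solution of the switching system lie above the obstacle. -/
lemma obstacle_le_switch (hA : AssumptionA ν A T b σ η γ f ζ g C) (hε : ε ∈ Ioo (0 : ℝ) 1)
    (hαs : ∀ j, αs j ∈ A) (hM : ∀ j t x, |U j t x| ≤ M)
    (hU : ∀ j, ContinuousOn (fun p : ℝ × Vec d => U j p.1 p.2) (Icc 0 T ×ˢ univ))
    (hU0 : ∀ j x, U j 0 x = g x) (hsup : SupersolnSwitch ν T b σ η γ f ζ ε αs c U)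
    (j : Fin J) {t : ℝ} (ht : t ∈ Icc 0 T) (x : Vec d) : ζ t x ≤ U j t x := by
  rcases ht.1.eq_or_lt with rfl | h0
  · rw [hU0]
    exact hA.hgζ x
  · exact sub_nonneg.1 (nonneg_of_touching (G := fun t x => U j t x - ζ t x) (hU j)
      ((hU j).sub hA.continuous_obstacle.continuousOn) (hM j)
      (fun t₀ ht₀ x₀ a κ p X hX r hr htouch => sub_nonneg.2
        (hA.switch_super_touching hε hαs hM hU hsup j ht₀ hX hr htouch).1) ⟨h0, ht.2⟩ x)

/-- Components of a solution of the switching system differ by at most the switching cost. -/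
lemma switch_sub_cost_le (hA : AssumptionA ν A T b σ η γ f ζ g C) (hε : ε ∈ Ioo (0 : ℝ) 1)
    (hαs : ∀ j, αs j ∈ A) (hc : 0 < c) (hM : ∀ j t x, |U j t x| ≤ M)
    (hU : ∀ j, ContinuousOn (fun p : ℝ × Vec d => U j p.1 p.2) (Icc 0 T ×ˢ univ))
    (hU0 : ∀ j x, U j 0 x = g x) (hsup : SupersolnSwitch ν T b σ η γ f ζ ε αs c U)
    (j k : Fin J) {t : ℝ} (ht : t ∈ Icc 0 T) (x : Vec d) : U k t x - c ≤ U j t x := by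
  by_cases hkj : k = j
  · rw [hkj]
    linarith
  rcases ht.1.eq_or_lt with rfl | h0
  · rw [hU0, hU0]
    linarith
  · exact sub_nonneg.1 (nonneg_of_touching (G := fun t x => U j t x - (U k t x - c)) (hU j)
      ((hU j).sub ((hU k).sub continuousOn_const)) (hM j)
      (fun t₀ ht₀ x₀ a κ p X hX r hr htouch => sub_nonneg.2
        ((le_ciSup (f := fun k : {k : Fin J // k ≠ j} => U k t₀ x₀ - c)
          (Set.finite_range _).bddAbove ⟨k, hkj⟩).trans
          (hA.switch_super_touching hε hαs hM hU hsup j ht₀ hX hr htouch).2.2)) ⟨h0, ht.2⟩ x)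

/-- Solutions of the obstacle problem lie below the lower half-relaxed limit of solutions of the
switching systems. -/
lemma le_lowerLimit_switch (hA : AssumptionA ν A T b σ η γ f ζ g C) (hε : ε ∈ Ioo (0 : ℝ) 1)
    (hJ : 2 ≤ J) (hαs : ∀ j, αs j ∈ A) {Uc : ℝ → Fin J → ℝ → Vec d → ℝ}
    (hUc_bdd : ∀ c ∈ Ioc (0 : ℝ) 1, ∀ j t x, |Uc c j t x| ≤ M)
    (hUc_cont : ∀ c ∈ Ioc (0 : ℝ) 1, ∀ j,
      ContinuousOn (fun p : ℝ × Vec d => Uc c j p.1 p.2) (Icc 0 T ×ˢ univ))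
    (hUc_init : ∀ c ∈ Ioc (0 : ℝ) 1, ∀ j x, Uc c j 0 x = g x)
    (hUc_super : ∀ c ∈ Ioc (0 : ℝ) 1, SupersolnSwitch ν T b σ η γ f ζ ε αs c (Uc c))
    (hu_bdd : ∀ t x, |u t x| ≤ M)
    (hu_cont : ContinuousOn (fun p : ℝ × Vec d => u p.1 p.2) (Icc 0 T ×ˢ univ))
    (hu_init : ∀ x, u 0 x = g x)
    (hu_sub : SubsolnHJBVIe ν (Set.range αs) T b σ η γ f ζ ε u)
    (j : Fin J) {t : ℝ} (ht : t ∈ Icc 0 T) (x : Vec d) :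
    u t x ≤ lowerLimit (fun c => Uc c j) T t x := by
  have hjM : ∀ j, ∀ c ∈ Ioc (0 : ℝ) 1, ∀ t x, |Uc c j t x| ≤ M := fun j c hc => hUc_bdd c hc j
  have hH : ∀ j, ∀ c ∈ Ioc (0 : ℝ) 1, ∀ t₀ ∈ Ioc 0 T, ∀ x₀ a κ p, ∀ X : Vec d →L[ℝ] Vec d,
      (∀ u v, ⟪X u, v⟫ = ⟪u, X v⟫) →
      ∀ r > 0, (∀ t ∈ Icc 0 T, ∀ x, |t - t₀| < r → ‖x - x₀‖ < r →
        Uc c j t₀ x₀ + quadForm t₀ x₀ a κ p X t x ≤ Uc c j t x) →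
      0 ≤ (hA.toCoef hε hαs).Ham j (Uc c j t₀ x₀) (Uc c j t₀) t₀ x₀ a p X :=
    fun j c hc t₀ ht₀ x₀ a κ p X hX r hr htouch => (hA.switch_super_touching hε hαs (hUc_bdd c hc)
      (hUc_cont c hc) (hUc_super c hc) j ht₀ hX hr htouch).2.1
  refine (hA.toCoef hε hαs).comparison (w := lowerLimit (fun c => Uc c j) T)
    hu_cont.upperSemicontinuousOn (lowerSemicontinuousOn_lowerLimit (hjM j))
    (fun t ht => (Coef.continuous_slice hu_cont ht).measurable)
    (fun t ht => measurable_lowerLimit (hjM j) ht) (fun t _ => hu_bdd t)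
    (fun t ht x => abs_lowerLimit_le (hjM j) ht) (fun y => ?_)
    (hA.isSub_of_subsolnHJBVIe hε hJ hαs hu_bdd hu_cont hu_sub)
    ((hA.toCoef hε hαs).isSuper_lowerLimit (U := fun j c => Uc c j) hjM
      (fun j c hc => hUc_cont c hc j)
      (fun j c hc t ht x => hA.obstacle_le_switch hε hαs (hUc_bdd c hc) (hUc_cont c hc)
        (hUc_init c hc) (hUc_super c hc) j ht x)
      (fun j k c hc t ht x => hA.switch_sub_cost_le hε hαs hc.1 (hUc_bdd c hc) (hUc_cont c hc)
        (hUc_init c hc) (hUc_super c hc) j k ht x) hH j) t ht x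
  rw [hu_init]
  have h0T : (0 : ℝ) ∈ Icc 0 T := ⟨le_rfl, hA.hT.le⟩
  have hgM : |g y| ≤ M := hu_init y ▸ hu_bdd 0 y
  refine le_of_forall_pos_le_add fun k hk => ?_
  obtain ⟨Q, N, hQN⟩ := (hA.toCoef hε hαs).exists_barrier j ((abs_nonneg _).trans hgM) (g := g)
    (C := C) (fun x y => le_trans (le_add_of_nonneg_right (abs_nonneg _)) (hA.hζg_lip 0 x y)) y hgM
    (half_pos hk)
  have hcont : Continuous fun z : ℝ × Vec d => g y - k / 2 - Q * ‖z.2 - y‖ ^ 2 - N * z.1 := by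
    fun_prop
  have h1 : ∀ᶠ z in 𝓝[Icc 0 T ×ˢ univ] ((0 : ℝ), y),
      g y - k < g y - k / 2 - Q * ‖z.2 - y‖ ^ 2 - N * z.1 :=
    nhdsWithin_le_nhds ((hcont.tendsto (0, y)).eventually_const_lt (by simp; linarith))
  have h2 : ∀ᶠ z in 𝓝[Icc 0 T ×ˢ univ] ((0 : ℝ), y), ‖z.2 - y‖ < 1 :=
    nhdsWithin_le_nhds (((by fun_prop : Continuous fun z : ℝ × Vec d => ‖z.2 - y‖).tendsto
      (0, y)).eventually_lt_const (by simp))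
  rw [← sub_le_iff_le_add]
  refine le_lowerLimit (hjM j) h0T ?_
  filter_upwards [eventually_lowerFilter_mem, eventually_lowerFilter_snd h1,
    eventually_lowerFilter_snd h2] with q h3 h4 h5
  exact h4.le.trans (hQN (Uc q.1 j) (hUc_cont q.1 h3.1 j) (hjM j q.1 h3.1) (hUc_init q.1 h3.1 j)
    (hH j q.1 h3.1) q.2.1 h3.2 q.2.2 h5.le)

end AssumptionA

/-- Convergence of the switching-system approximation to the
finite-control HJBVI as the switching cost tends to zero (Theorem 3.3). -/
theorem switching_system_converges_as_cost_vanishes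
    {n d m J : ℕ} (ν : Measure (Vec n)) (A : Set (Vec m)) (T : ℝ)
    (b : Vec m → Vec d → Vec d) (σ : Vec m → Vec d → Matrix (Fin d) (Fin d) ℝ)
    (η : Vec m → Vec d → Vec n → Vec d) (γ : Vec d → Vec n → ℝ)
    (f : Vec m → ℝ → Vec d → ℝ → Vec d → ℝ → ℝ)
    (ζ : ℝ → Vec d → ℝ) (g : Vec d → ℝ) (C : ℝ)
    (hA : AssumptionA ν A T b σ η γ f ζ g C)
    (ε : ℝ) (hε : ε ∈ Ioo (0:ℝ) 1)
    (hJ : 2 ≤ J) (αs : Fin J → Vec m) (hαs : ∀ j, αs j ∈ A)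
    -- for each cost `c ∈ (0,1]`, `Uc c` is a viscosity solution of the
    -- switching system with switching cost `c`
    (Uc : ℝ → Fin J → ℝ → Vec d → ℝ)
    (hUc_cont : ∀ c ∈ Ioc (0:ℝ) 1, ∀ j,
      ContinuousOn (fun p : ℝ × Vec d => Uc c j p.1 p.2) (Icc 0 T ×ˢ univ))
    (hUc_init : ∀ c ∈ Ioc (0:ℝ) 1, ∀ j x, Uc c j 0 x = g x)
    (hUc_sub : ∀ c ∈ Ioc (0:ℝ) 1, SubsolnSwitch ν T b σ η γ f ζ ε αs c (Uc c))
    (hUc_super : ∀ c ∈ Ioc (0:ℝ) 1, SupersolnSwitch ν T b σ η γ f ζ ε αs c (Uc c))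
    -- uniform boundedness in `c`
    (hUc_bdd : ∃ M, ∀ c ∈ Ioc (0:ℝ) 1, ∀ j t x, |Uc c j t x| ≤ M)
    -- `u` is a viscosity solution of the HJBVI with control set `A' = {α_1,…,α_J}`
    (u : ℝ → Vec d → ℝ)
    (hu_bdd : ∃ M, ∀ t x, |u t x| ≤ M)
    (hu_cont : ContinuousOn (fun p : ℝ × Vec d => u p.1 p.2) (Icc 0 T ×ˢ univ))
    (hu_init : ∀ x, u 0 x = g x)
    (hu_sub : SubsolnHJBVIe ν (Set.range αs) T b σ η γ f ζ ε u)
    (hu_super : SupersolnHJBVIe ν (Set.range αs) T b σ η γ f ζ ε u) :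
    ∀ j, ∀ K : Set (ℝ × Vec d), IsCompact K → K ⊆ Icc 0 T ×ˢ univ →
      TendstoUniformlyOn (fun c (p : ℝ × Vec d) => Uc c j p.1 p.2)
        (fun p : ℝ × Vec d => u p.1 p.2) (nhdsWithin 0 (Ioc (0:ℝ) 1)) K := by
  intro j K hK hKs
  obtain ⟨M₁, hM₁⟩ := hUc_bdd
  obtain ⟨M₂, hM₂⟩ := hu_bdd
  have hUM : ∀ c ∈ Ioc (0 : ℝ) 1, ∀ j t x, |Uc c j t x| ≤ max M₁ M₂ :=
    fun c hc j t x => (hM₁ c hc j t x).trans (le_max_left _ _)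
  have huM : ∀ t x, |u t x| ≤ max M₁ M₂ := fun t x => (hM₂ t x).trans (le_max_right _ _)
  rw [Metric.tendstoUniformlyOn_iff]
  intro κ hκ
  have hlow : ∀ᶠ c in 𝓝[Ioc (0 : ℝ) 1] 0, ∀ z ∈ K, u z.1 z.2 - Uc c j z.1 z.2 < κ := by
    refine eventually_forall_of_compact hK hKs fun z hz => ?_
    have hw := hA.le_lowerLimit_switch hε hJ hαs hUM hUc_cont hUc_init hUc_super huM hu_cont
      hu_init hu_sub j (hKs hz).1 z.2
    have h1 : ∀ᶠ z' in 𝓝[Icc 0 T ×ˢ univ] z, u z'.1 z'.2 < u z.1 z.2 + κ / 2 :=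
      (hu_cont z (hKs hz)).eventually_lt_const (by linarith)
    filter_upwards [eventually_lt_of_lt_lowerLimit (fun c hc => hUM c hc j)
      (lt_of_lt_of_le (sub_lt_self (u z.1 z.2) (half_pos hκ)) hw),
      eventually_lowerFilter_snd h1] with q h2 h3
    linarith
  filter_upwards [hlow, self_mem_nhdsWithin] with c h1 hc z hz
  have h2 := hA.switch_le hε hJ hαs hc.1 (hUM c hc) (hUc_cont c hc) (hUc_init c hc) (hUc_sub c hc)
    huM hu_cont hu_init hu_super j (hKs hz).1 z.2
  rw [Real.dist_eq, abs_of_nonneg (sub_nonneg.2 h2)]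
  exact h1 z hz
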